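/- arXiv:2307.06787 — 5 statements merged into one kernel-verified Lean document; each statement's English description precedes it below -/
import Mathlib

section
/- Let d ≥ 2 and let ‖·‖_B be a norm on ℝ^d with unit ball B. There exists a constant ξ_B with d/(d+1) ≤ ξ_B ≤ (d/(d+1)) · ( d·log d + d·log log d + 5d )^{1/d} such that for every bounded Jordan measurable set D ⊂ ℝ^d with nonempty interior, lim_{n→∞} n^{1/d} · e(n, F^B(D)) = ξ_B · λ^d(D)^{(d+1)/d} · λ^d(B)^{−1/d}. -/
open MeasureTheory

/-- The Lipschitz class `F^B(D)` with respect to the norm `N` (unit ball `B`):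
all `f : D → ℝ` with `|f(x) - f(y)| ≤ ‖x - y‖_B`. -/
def FB (d : ℕ) (N : Seminorm ℝ (Fin d → ℝ)) (D : Set (Fin d → ℝ)) :
    Set ((Fin d → ℝ) → ℝ) :=
  { f | ∀ x ∈ D, ∀ y ∈ D, |f x - f y| ≤ N (x - y) }

/-- The `n`-th minimal worst-case error of numerical integration on the class `F` over `D`:
`e(n,F) = inf_{x₁,…,xₙ ∈ D} sup{ ∫_D f : f ∈ F, f(x₁) = ⋯ = f(xₙ) = 0 }`. -/
noncomputable def interr {d : ℕ} (D : Set (Fin d → ℝ))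
    (F : Set ((Fin d → ℝ) → ℝ)) (n : ℕ) : ℝ :=
  ⨅ x : Fin n → D, sSup ((fun f => ∫ t in D, f t) ''
    {f | f ∈ F ∧ ∀ i, f ((x i : Fin d → ℝ)) = 0})

namespace LipschitzIntegration

theorem exists_seminorm_le_norm {d : ℕ} (N : Seminorm ℝ (Fin d → ℝ)) :
    ∃ A : ℝ, 0 < A ∧ ∀ x, N x ≤ A * ‖x‖ := by
  refine ⟨∑ i, N (Pi.single i 1) + 1, by positivity, fun x => ?_⟩
  have hx : x = ∑ i, x i • (Pi.single i (1 : ℝ) : Fin d → ℝ) := by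
    simpa using (pi_eq_sum_univ' x)
  have h1 : N x ≤ ∑ i, N (x i • (Pi.single i (1 : ℝ) : Fin d → ℝ)) := by
    conv_lhs => rw [hx]
    exact Finset.le_sum_of_subadditive N (map_zero N).le (map_add_le_add N) _ _
  have h2 : ∑ i, N (x i • (Pi.single i (1 : ℝ) : Fin d → ℝ))
      ≤ ∑ i, ‖x‖ * N (Pi.single i (1 : ℝ)) := by
    refine Finset.sum_le_sum fun i _ => ?_
    rw [map_smul_eq_mul]
    exact mul_le_mul_of_nonneg_right (norm_le_pi_norm x i) (apply_nonneg _ _)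
  rw [← Finset.mul_sum] at h2
  nlinarith [norm_nonneg x]

theorem continuous_seminorm {d : ℕ} (N : Seminorm ℝ (Fin d → ℝ)) : Continuous N := by
  obtain ⟨A, hA, h⟩ := exists_seminorm_le_norm N
  refine (LipschitzWith.of_dist_le_mul (K := ⟨A, hA.le⟩) fun x y => ?_).continuous
  rw [Real.dist_eq, dist_eq_norm]
  exact (abs_sub_map_le_sub N x y).trans (h _)

theorem exists_norm_le_seminorm {d : ℕ} (N : Seminorm ℝ (Fin d → ℝ))
    (hN : ∀ x, N x = 0 → x = 0) : ∃ a : ℝ, 0 < a ∧ ∀ x, ‖x‖ ≤ a * N x := by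
  by_cases hS : (Metric.sphere (0 : Fin d → ℝ) 1).Nonempty
  · obtain ⟨z, hz, hmin⟩ := (isCompact_sphere (0 : Fin d → ℝ) 1).exists_isMinOn hS
      (continuous_seminorm N).continuousOn
    have hz0 : 0 < N z := by
      refine lt_of_le_of_ne (apply_nonneg _ _) fun h => ?_
      have := hN z h.symm
      simp [this] at hz
    refine ⟨(N z)⁻¹, by positivity, fun x => ?_⟩
    rcases eq_or_ne x 0 with rfl | hx
    · simp
    have hx' : 0 < ‖x‖ := norm_pos_iff.2 hx
    have h1 : N z ≤ N (‖x‖⁻¹ • x) := hmin (by simp [norm_smul, hx'.ne'])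
    rw [map_smul_eq_mul, norm_inv, norm_norm, inv_mul_eq_div, le_div_iff₀ hx'] at h1
    rw [inv_mul_eq_div, le_div_iff₀ hz0]
    linarith
  · refine ⟨1, one_pos, fun x => ?_⟩
    have hx : x = 0 := by
      by_contra hx
      refine hS ⟨‖x‖⁻¹ • x, ?_⟩
      simp [norm_smul, norm_ne_zero_iff.2 hx]
    simp [hx]

/-- The distance from `t` to the finite set `P` with respect to `N`, as an extended real. -/
noncomputable def ptDist {d : ℕ} (N : Seminorm ℝ (Fin d → ℝ)) (P : Finset (Fin d → ℝ))
    (t : Fin d → ℝ) : ENNReal :=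
  ⨅ p ∈ P, ENNReal.ofReal (N (t - p))

/-- The integrated distance of the points of `D` to the finite set `P`. -/
noncomputable def cost {d : ℕ} (N : Seminorm ℝ (Fin d → ℝ)) (D : Set (Fin d → ℝ))
    (P : Finset (Fin d → ℝ)) : ENNReal :=
  ∫⁻ t in D, ptDist N P t

theorem ptDist_le {d : ℕ} (N : Seminorm ℝ (Fin d → ℝ)) {P : Finset (Fin d → ℝ)}
    {p : Fin d → ℝ} (hp : p ∈ P) (t : Fin d → ℝ) :
    ptDist N P t ≤ ENNReal.ofReal (N (t - p)) :=
  iInf₂_le p hp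

theorem ptDist_anti {d : ℕ} (N : Seminorm ℝ (Fin d → ℝ)) {P R : Finset (Fin d → ℝ)}
    (h : P ⊆ R) (t : Fin d → ℝ) : ptDist N R t ≤ ptDist N P t :=
  le_iInf₂ fun _ hp => ptDist_le N (h hp) t

theorem measurable_ptDist {d : ℕ} (N : Seminorm ℝ (Fin d → ℝ)) (P : Finset (Fin d → ℝ)) :
    Measurable (ptDist N P) := by
  refine Measurable.biInf _ P.countable_toSet fun p _ => ?_
  have := continuous_seminorm N
  exact (ENNReal.continuous_ofReal.comp (this.comp (continuous_id.sub continuous_const))).measurable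

theorem cost_mono {d : ℕ} (N : Seminorm ℝ (Fin d → ℝ)) {D D' : Set (Fin d → ℝ)}
    {P R : Finset (Fin d → ℝ)} (hD : D ⊆ D') (h : P ⊆ R) : cost N D R ≤ cost N D' P :=
  (lintegral_mono (ptDist_anti N h)).trans (lintegral_mono_set hD)

theorem cost_union_le {d : ℕ} (N : Seminorm ℝ (Fin d → ℝ)) (D D' : Set (Fin d → ℝ))
    (P : Finset (Fin d → ℝ)) : cost N (D ∪ D') P ≤ cost N D P + cost N D' P :=
  lintegral_union_le _ _ _

theorem cost_biUnion_le {d : ℕ} {ι : Type*} (N : Seminorm ℝ (Fin d → ℝ)) (J : Finset ι)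
    (D : ι → Set (Fin d → ℝ)) (P : Finset (Fin d → ℝ)) :
    cost N (⋃ j ∈ J, D j) P ≤ ∑ j ∈ J, cost N (D j) P := by
  classical
  induction J using Finset.induction_on with
  | empty => simp [cost]
  | insert j J hj ih =>
    rw [Finset.set_biUnion_insert, Finset.sum_insert hj]
    exact (cost_union_le _ _ _ _).trans (by gcongr)

theorem cost_le_of_ptDist_le {d : ℕ} (N : Seminorm ℝ (Fin d → ℝ)) {D : Set (Fin d → ℝ)}
    {P : Finset (Fin d → ℝ)} {r : ENNReal} (h : ∀ t ∈ D, ptDist N P t ≤ r) :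
    cost N D P ≤ r * volume D := by
  have hS : MeasurableSet (toMeasurable volume D ∩ {t | ptDist N P t ≤ r}) :=
    (measurableSet_toMeasurable _ _).inter (measurable_ptDist N P measurableSet_Iic)
  calc cost N D P ≤ cost N (toMeasurable volume D ∩ {t | ptDist N P t ≤ r}) P :=
        cost_mono N (fun t ht => ⟨subset_toMeasurable _ _ ht, h t ht⟩) le_rfl
    _ ≤ r * volume (toMeasurable volume D ∩ {t | ptDist N P t ≤ r}) := by
        rw [← setLIntegral_const]
        exact setLIntegral_mono' hS fun t ht => ht.2
    _ ≤ r * volume D := by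
        rw [← measure_toMeasurable D]
        gcongr
        exact Set.inter_subset_left

/-- The homothety `t ↦ b + a t`. -/
def homoth {d : ℕ} (b : Fin d → ℝ) (a : ℝ) (t : Fin d → ℝ) : Fin d → ℝ := b + a • t

theorem measurableEmbedding_homoth {d : ℕ} (b : Fin d → ℝ) {a : ℝ} (ha : a ≠ 0) :
    MeasurableEmbedding (homoth b a) :=
  (((Homeomorph.smulOfNeZero a ha).trans (Homeomorph.addLeft b))).measurableEmbedding

theorem map_homoth {d : ℕ} (b : Fin d → ℝ) {a : ℝ} (ha : 0 < a) :
    (volume : Measure (Fin d → ℝ)) = ENNReal.ofReal (a ^ d) •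
      Measure.map (homoth b a) volume := by
  have h1 : Measure.map (homoth b a) volume
      = Measure.map (fun x => b + x) (Measure.map (fun x : Fin d → ℝ => a • x) volume) := by
    rw [Measure.map_map (measurable_const_add b) (measurable_const_smul a)]
    rfl
  rw [h1, Measure.map_addHaar_smul _ ha.ne', Measure.map_smul,
    (measurePreserving_add_left volume b).map_eq, smul_smul, ← ENNReal.ofReal_mul (by positivity)]
  rw [abs_of_pos (by positivity), Module.finrank_fin_fun, mul_inv_cancel₀ (by positivity)]
  simp

theorem volume_homoth_image {d : ℕ} (b : Fin d → ℝ) {a : ℝ} (ha : 0 < a)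
    (D : Set (Fin d → ℝ)) :
    volume (homoth b a '' D) = ENNReal.ofReal (a ^ d) * volume D := by
  have hφ := measurableEmbedding_homoth b ha.ne'
  conv_lhs => rw [map_homoth b ha]
  rw [Measure.smul_apply, hφ.map_apply, Set.preimage_image_eq _ hφ.injective, smul_eq_mul]

theorem ptDist_homoth {d : ℕ} (N : Seminorm ℝ (Fin d → ℝ)) (b : Fin d → ℝ) {a : ℝ} (ha : 0 < a)
    (P : Finset (Fin d → ℝ)) (t : Fin d → ℝ) :
    ptDist N (P.image (homoth b a)) (homoth b a t) = ENNReal.ofReal a * ptDist N P t := by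
  have h0 : ENNReal.ofReal a ≠ 0 := by simpa using ha
  simp only [ptDist, Finset.iInf_finset_image, ENNReal.mul_iInf_of_ne h0 ENNReal.ofReal_ne_top]
  refine iInf_congr fun p => iInf_congr fun _ => ?_
  unfold homoth
  rw [add_sub_add_left_eq_sub, ← smul_sub, map_smul_eq_mul, Real.norm_of_nonneg ha.le,
    ENNReal.ofReal_mul ha.le]

theorem cost_homoth {d : ℕ} (N : Seminorm ℝ (Fin d → ℝ)) (b : Fin d → ℝ) {a : ℝ} (ha : 0 < a)
    (D : Set (Fin d → ℝ)) (P : Finset (Fin d → ℝ)) :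
    cost N (homoth b a '' D) (P.image (homoth b a)) =
      ENNReal.ofReal (a ^ (d + 1)) * cost N D P := by
  have hφ := measurableEmbedding_homoth b ha.ne'
  unfold cost
  conv_lhs => rw [map_homoth b ha]
  rw [Measure.restrict_smul, lintegral_smul_measure, hφ.restrict_map, hφ.lintegral_map,
    Set.preimage_image_eq _ hφ.injective]
  simp only [ptDist_homoth N b ha]
  rw [lintegral_const_mul _ (measurable_ptDist N P), smul_eq_mul, ← mul_assoc,
    ← ENNReal.ofReal_mul (by positivity), pow_succ]

/-- The half-open unit cube. -/
def unitCube (d : ℕ) : Set (Fin d → ℝ) := Set.univ.pi fun _ => Set.Ico 0 1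

theorem volume_unitCube (d : ℕ) : volume (unitCube d) = 1 := by
  simp [unitCube, volume_pi_pi]

theorem measurableSet_unitCube (d : ℕ) : MeasurableSet (unitCube d) :=
  MeasurableSet.univ_pi fun _ => measurableSet_Ico

theorem norm_sub_le_of_mem_unitCube {d : ℕ} {x y : Fin d → ℝ} (hx : x ∈ unitCube d)
    (hy : y ∈ unitCube d) : ‖x - y‖ ≤ 1 := by
  refine (pi_norm_le_iff_of_nonneg zero_le_one).2 fun i => ?_
  have h1 := hx i trivial
  have h2 := hy i trivial
  simp only [Set.mem_Ico] at h1 h2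
  rw [Pi.sub_apply, Real.norm_eq_abs, abs_le]
  constructor <;> linarith

theorem cost_unitCube_ne_top {d : ℕ} (N : Seminorm ℝ (Fin d → ℝ)) {P : Finset (Fin d → ℝ)}
    (hP : P.Nonempty) (hPQ : ↑P ⊆ unitCube d) : cost N (unitCube d) P ≠ ⊤ := by
  obtain ⟨A, hA, h⟩ := exists_seminorm_le_norm N
  obtain ⟨p, hp⟩ := hP
  have : cost N (unitCube d) P ≤ ENNReal.ofReal A * volume (unitCube d) := by
    refine cost_le_of_ptDist_le N fun t ht => ?_
    refine (ptDist_le N hp t).trans (ENNReal.ofReal_le_ofReal ?_)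
    have := norm_sub_le_of_mem_unitCube ht (hPQ hp)
    exact (h _).trans (by nlinarith)
  refine ne_top_of_le_ne_top ?_ this
  simp [volume_unitCube]

/-- The asymptotic constant of the unit cube. -/
noncomputable def quantConst {d : ℕ} (N : Seminorm ℝ (Fin d → ℝ)) : ℝ :=
  sInf {r | ∃ P : Finset (Fin d → ℝ), P.Nonempty ∧ ↑P ⊆ unitCube d ∧
    r = (P.card : ℝ) ^ ((1 : ℝ) / d) * (cost N (unitCube d) P).toReal}

theorem quantConst_le {d : ℕ} (N : Seminorm ℝ (Fin d → ℝ)) {P : Finset (Fin d → ℝ)}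
    (hP : P.Nonempty) (hPQ : ↑P ⊆ unitCube d) :
    quantConst N ≤ (P.card : ℝ) ^ ((1 : ℝ) / d) * (cost N (unitCube d) P).toReal := by
  refine csInf_le ⟨0, ?_⟩ ⟨P, hP, hPQ, rfl⟩
  rintro _ ⟨R, -, -, rfl⟩
  positivity

theorem unitCube_set_nonempty {d : ℕ} (N : Seminorm ℝ (Fin d → ℝ)) :
    {r | ∃ P : Finset (Fin d → ℝ), P.Nonempty ∧ ↑P ⊆ unitCube d ∧
    r = (P.card : ℝ) ^ ((1 : ℝ) / d) * (cost N (unitCube d) P).toReal}.Nonempty :=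
  ⟨_, {0}, by simp, by simp [unitCube], rfl⟩

theorem le_quantConst {d : ℕ} (N : Seminorm ℝ (Fin d → ℝ)) {r : ℝ}
    (h : ∀ P : Finset (Fin d → ℝ), P.Nonempty → ↑P ⊆ unitCube d →
      r ≤ (P.card : ℝ) ^ ((1 : ℝ) / d) * (cost N (unitCube d) P).toReal) :
    r ≤ quantConst N := by
  refine le_csInf (unitCube_set_nonempty N) ?_
  rintro _ ⟨P, hP, hPQ, rfl⟩
  exact h P hP hPQ

theorem quantConst_nonneg {d : ℕ} (N : Seminorm ℝ (Fin d → ℝ)) : 0 ≤ quantConst N :=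
  le_quantConst N fun _ _ _ => by positivity

theorem exists_cost_unitCube_lt {d : ℕ} (N : Seminorm ℝ (Fin d → ℝ)) {ε : ℝ} (hε : 0 < ε) :
    ∃ P : Finset (Fin d → ℝ), P.Nonempty ∧ ↑P ⊆ unitCube d ∧
      (P.card : ℝ) ^ ((1 : ℝ) / d) * (cost N (unitCube d) P).toReal < quantConst N + ε := by
  obtain ⟨_, ⟨P, hP, hPQ, rfl⟩, h⟩ :=
    exists_lt_of_csInf_lt (unitCube_set_nonempty N) (lt_add_of_pos_right (quantConst N) hε)
  exact ⟨P, hP, hPQ, h⟩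

/-- The half-open cell with index `z` of the grid of mesh `h`. -/
def cell {d : ℕ} (h : ℝ) (z : Fin d → ℤ) : Set (Fin d → ℝ) :=
  homoth (fun i => h * z i) h '' unitCube d

theorem mem_cell {d : ℕ} {h : ℝ} (hh : 0 < h) {z : Fin d → ℤ} {t : Fin d → ℝ} :
    t ∈ cell h z ↔ ∀ i, ⌊t i / h⌋ = z i := by
  constructor
  · rintro ⟨s, hs, rfl⟩ i
    have := hs i trivial
    simp only [Set.mem_Ico] at this
    have e : homoth (fun i => h * (z i : ℝ)) h s i / h = z i + s i := by
      simp only [homoth, Pi.add_apply, Pi.smul_apply, smul_eq_mul]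
      field_simp
    rw [e, Int.floor_eq_iff]
    constructor <;> linarith
  · intro H
    refine ⟨fun i => t i / h - z i, fun i _ => ?_, ?_⟩
    · have := Int.floor_eq_iff.1 (H i)
      simp only [Set.mem_Ico]
      constructor <;> linarith
    · ext i
      simp only [homoth, Pi.add_apply, Pi.smul_apply, smul_eq_mul]
      field_simp
      ring

theorem measurableSet_cell {d : ℕ} {h : ℝ} (hh : 0 < h) (z : Fin d → ℤ) :
    MeasurableSet (cell h z) :=
  (measurableEmbedding_homoth _ hh.ne').measurableSet_image.2 (measurableSet_unitCube d)

theorem volume_cell {d : ℕ} {h : ℝ} (hh : 0 < h) (z : Fin d → ℤ) :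
    volume (cell h z) = ENNReal.ofReal (h ^ d) := by
  rw [cell, volume_homoth_image _ hh, volume_unitCube, mul_one]

theorem norm_sub_le_of_floor_eq {d : ℕ} {h : ℝ} (hh : 0 < h) {s t : Fin d → ℝ}
    (H : ∀ i, ⌊s i / h⌋ = ⌊t i / h⌋) : ‖s - t‖ ≤ h := by
  refine (pi_norm_le_iff_of_nonneg hh.le).2 fun i => ?_
  have := Int.abs_sub_lt_one_of_floor_eq_floor (H i)
  rw [← sub_div, abs_div, abs_of_pos hh, div_lt_one hh] at this
  exact this.le

theorem isPreconnected_cell {d : ℕ} (h : ℝ) (z : Fin d → ℤ) :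
    IsPreconnected (cell h z) := by
  have : Convex ℝ (unitCube d) := convex_pi fun _ _ => convex_Ico 0 1
  refine this.isPreconnected.image _ (Continuous.continuousOn ?_)
  unfold homoth
  fun_prop

theorem finite_cells {d : ℕ} {h : ℝ} (hh : 0 < h) {D : Set (Fin d → ℝ)}
    (hD : Bornology.IsBounded D) : {z : Fin d → ℤ | cell h z ⊆ D}.Finite := by
  obtain ⟨L, hL⟩ := hD.subset_closedBall 0
  refine (Set.finite_Icc (fun _ => ⌊-L / h⌋) (fun _ => ⌊L / h⌋)).subset fun z hz => ?_
  have h0 : (fun i => h * z i : Fin d → ℝ) ∈ cell h z := by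
    rw [mem_cell hh]
    intro i
    rw [mul_div_cancel_left₀ _ hh.ne', Int.floor_intCast]
  have h1 := hL (hz h0)
  rw [mem_closedBall_zero_iff] at h1
  have h2 : ∀ i, |h * (z i : ℝ)| ≤ L := fun i => (norm_le_pi_norm _ i).trans h1
  constructor <;> intro i <;> have h3 := abs_le.1 (h2 i)
  · show ⌊-L / h⌋ ≤ z i
    refine Int.floor_le_iff.2 ?_
    rw [div_lt_iff₀ hh]
    nlinarith
  · show z i ≤ ⌊L / h⌋
    refine Int.le_floor.2 ?_
    rw [le_div_iff₀ hh]
    linarith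

theorem diff_cells_subset {d : ℕ} {h : ℝ} (hh : 0 < h) (D : Set (Fin d → ℝ)) :
    D \ (⋃ z ∈ {z : Fin d → ℤ | cell h z ⊆ D}, cell h z) ⊆
      Metric.cthickening h (frontier D) := by
  rintro t ⟨htD, ht⟩
  have htc : t ∈ cell h (fun i => ⌊t i / h⌋) := (mem_cell hh).2 fun _ => rfl
  have hnot : ¬ cell h (fun i => ⌊t i / h⌋) ⊆ D := fun H =>
    ht (Set.mem_biUnion (show (fun i => ⌊t i / h⌋) ∈ {z : Fin d → ℤ | cell h z ⊆ D} from H) htc)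
  obtain ⟨s, hsc, hs⟩ : (cell h (fun i => ⌊t i / h⌋) ∩ frontier D).Nonempty := by
    obtain ⟨u, hu, huD⟩ := Set.not_subset.1 hnot
    by_contra hne
    rw [Set.not_nonempty_iff_eq_empty] at hne
    have hsub : cell h (fun i => ⌊t i / h⌋) ⊆ interior D ∪ (closure D)ᶜ := by
      intro x hx
      by_contra hx'
      simp only [Set.mem_union, Set.mem_compl_iff, not_or, not_not] at hx'
      have : x ∈ cell h (fun i => ⌊t i / h⌋) ∩ frontier D := ⟨hx, hx'.2, hx'.1⟩
      rw [hne] at this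
      exact this
    rcases (isPreconnected_iff_subset_of_disjoint.1 (isPreconnected_cell h _)) _ _
      isOpen_interior isClosed_closure.isOpen_compl hsub (by
        refine Set.eq_empty_of_forall_notMem fun x hx => ?_
        exact hx.2.2 (subset_closure (interior_subset hx.2.1))) with H | H
    · exact huD (interior_subset (H hu))
    · exact H htc (subset_closure htD)
  refine Metric.mem_cthickening_of_dist_le t s h _ hs ?_
  rw [dist_eq_norm]
  exact norm_sub_le_of_floor_eq hh fun i => ((mem_cell hh).1 htc i).trans ((mem_cell hh).1 hsc i).symm

theorem exists_net {d : ℕ} (hd : 1 ≤ d) (N : Seminorm ℝ (Fin d → ℝ)) {D : Set (Fin d → ℝ)}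
    (hD : Bornology.IsBounded D) : ∃ C : ℝ, 0 < C ∧ ∀ n : ℕ, 1 ≤ n →
      ∃ P : Finset (Fin d → ℝ), ↑P ⊆ D ∧ P.card ≤ n ∧
        ∀ t ∈ D, ptDist N P t ≤ ENNReal.ofReal (C * (n : ℝ) ^ (-(1 : ℝ) / d)) := by
  obtain ⟨A, hA, hN⟩ := exists_seminorm_le_norm N
  obtain ⟨L, hL0, hL⟩ := hD.subset_ball_lt 0 0
  refine ⟨4 * L * A, by positivity, fun n hn => ?_⟩
  have hn' : (1 : ℝ) ≤ n := by exact_mod_cast hn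
  have hd' : (0 : ℝ) < d := by exact_mod_cast hd
  set x : ℝ := (n : ℝ) ^ ((1 : ℝ) / d) with hx
  have hx1 : 1 ≤ x := Real.one_le_rpow hn' (by positivity)
  set k : ℕ := ⌊x⌋₊ with hk
  have hk1 : 1 ≤ k := Nat.one_le_floor_iff _ |>.2 hx1
  have hk1' : (1 : ℝ) ≤ k := by exact_mod_cast hk1
  have hkx : (k : ℝ) ≤ x := Nat.floor_le (by linarith)
  have hxk : x ≤ 2 * k := by
    have := Nat.lt_floor_add_one x
    linarith
  have hkn : k ^ d ≤ n := by
    have h1 : (k : ℝ) ^ d ≤ x ^ d := pow_le_pow_left₀ (by positivity) hkx d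
    have h2 : x ^ d = n := by
      rw [hx, ← Real.rpow_natCast, ← Real.rpow_mul (by positivity), one_div,
        inv_mul_cancel₀ hd'.ne', Real.rpow_one]
    rw [h2] at h1
    exact_mod_cast h1
  set h : ℝ := 2 * L / k with hh
  have hh0 : 0 < h := by positivity
  let F : (Fin d → ℝ) → (Fin d → ℤ) := fun t i => ⌊(t i + L) / h⌋
  have hF : ∀ t ∈ D, F t ∈ Fintype.piFinset fun _ : Fin d => Finset.Ico (0 : ℤ) k := by
    intro t ht
    have h1 := hL ht
    rw [mem_ball_zero_iff] at h1
    refine Fintype.mem_piFinset.2 fun i => ?_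
    have h2 : |t i| < L := (norm_le_pi_norm t i).trans_lt h1
    rw [abs_lt] at h2
    rw [Finset.mem_Ico]
    refine ⟨Int.floor_nonneg.2 (div_nonneg (by linarith) hh0.le), Int.floor_lt.2 ?_⟩
    rw [div_lt_iff₀ hh0, hh]
    push_cast
    field_simp
    linarith
  have hfin : (F '' D).Finite :=
    (Finset.finite_toSet _).subset (Set.image_subset_iff.2 fun t ht => hF t ht)
  have hex : ∀ z : Fin d → ℤ, ∃ t, z ∈ F '' D → t ∈ D ∧ F t = z := by
    intro z
    by_cases hz : z ∈ F '' D
    · obtain ⟨t, ht, rfl⟩ := hz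
      exact ⟨t, fun _ => ⟨ht, rfl⟩⟩
    · exact ⟨0, fun H => (hz H).elim⟩
  choose g hg using hex
  refine ⟨hfin.toFinset.image g, ?_, ?_, ?_⟩
  · intro p hp
    obtain ⟨z, hz, rfl⟩ := Finset.mem_image.1 (Finset.mem_coe.1 hp)
    exact (hg z (hfin.mem_toFinset.1 hz)).1
  · refine Finset.card_image_le.trans (le_trans ?_ hkn)
    have : hfin.toFinset ⊆ Fintype.piFinset fun _ : Fin d => Finset.Ico (0 : ℤ) k := by
      intro z hz
      obtain ⟨t, ht, rfl⟩ := hfin.mem_toFinset.1 hz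
      exact hF t ht
    refine (Finset.card_le_card this).trans ?_
    simp [Fintype.card_piFinset]
  · intro t ht
    have hz : F t ∈ F '' D := ⟨t, ht, rfl⟩
    have hp : g (F t) ∈ hfin.toFinset.image g :=
      Finset.mem_image_of_mem _ (hfin.mem_toFinset.2 hz)
    refine (ptDist_le N hp t).trans (ENNReal.ofReal_le_ofReal ?_)
    have h1 : ‖(fun i => t i + L) - (fun i => g (F t) i + L)‖ ≤ h :=
      norm_sub_le_of_floor_eq hh0 fun i => (congrFun (hg _ hz).2 i).symm
    have h2 : (fun i => t i + L) - (fun i => g (F t) i + L) = t - g (F t) := by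
      ext i; simp
    rw [h2] at h1
    have h3 : (n : ℝ) ^ (-(1 : ℝ) / d) = x⁻¹ := by
      rw [hx, neg_div, Real.rpow_neg (by positivity)]
    rw [h3]
    calc N (t - g (F t)) ≤ A * h := (hN _).trans (by gcongr)
      _ ≤ A * (4 * L * x⁻¹) := by
        gcongr
        rw [hh, ← div_eq_mul_inv, div_le_div_iff₀ (by positivity) (by positivity)]
        nlinarith
      _ = 4 * L * A * x⁻¹ := by ring

theorem exists_points_of_grid {d : ℕ} (N : Seminorm ℝ (Fin d → ℝ)) {D : Set (Fin d → ℝ)}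
    (hD : Bornology.IsBounded D) {h : ℝ} (hh : 0 < h) {P₀ P₁ : Finset (Fin d → ℝ)}
    (h₀ : ↑P₀ ⊆ unitCube d) (h₁ : ↑P₁ ⊆ D) {r : ENNReal} (hr : ∀ t ∈ D, ptDist N P₁ t ≤ r) :
    ∃ (M : ℕ) (P : Finset (Fin d → ℝ)), ↑P ⊆ D ∧ M * ENNReal.ofReal (h ^ d) ≤ volume D ∧
      P.card ≤ M * P₀.card + P₁.card ∧
      cost N D P ≤ M * (ENNReal.ofReal (h ^ (d + 1)) * cost N (unitCube d) P₀) +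
        r * volume (Metric.cthickening h (frontier D)) := by
  classical
  have hfin := finite_cells hh hD
  set J := hfin.toFinset with hJ
  let G : (Fin d → ℤ) → Finset (Fin d → ℝ) := fun z => P₀.image (homoth (fun i => h * z i) h)
  refine ⟨J.card, J.biUnion G ∪ P₁, ?_, ?_, ?_, ?_⟩
  · intro p hp
    rw [Finset.mem_coe, Finset.mem_union, Finset.mem_biUnion] at hp
    rcases hp with ⟨z, hz, hp⟩ | hp
    · obtain ⟨q, hq, rfl⟩ := Finset.mem_image.1 hp
      exact hfin.mem_toFinset.1 hz ⟨q, h₀ hq, rfl⟩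
    · exact h₁ hp
  · have hdisj : (↑J : Set (Fin d → ℤ)).PairwiseDisjoint (cell h) := by
      intro z _ w _ hzw
      refine Set.disjoint_left.2 fun t ht ht' => hzw ?_
      ext i
      rw [← (mem_cell hh).1 ht i, (mem_cell hh).1 ht' i]
    have := measure_biUnion_finset (μ := volume) hdisj fun z _ => measurableSet_cell hh z
    simp only [volume_cell hh, Finset.sum_const, nsmul_eq_mul] at this
    rw [← this]
    exact measure_mono (Set.iUnion₂_subset fun z hz => hfin.mem_toFinset.1 hz)
  · refine (Finset.card_union_le _ _).trans (Nat.add_le_add_right ?_ _)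
    exact Finset.card_biUnion_le_card_mul _ _ _ fun z _ => Finset.card_image_le
  · have hsub : D ⊆ (⋃ z ∈ J, cell h z) ∪ (D \ ⋃ z ∈ {z : Fin d → ℤ | cell h z ⊆ D}, cell h z) := by
      intro t ht
      by_cases H : t ∈ ⋃ z ∈ {z : Fin d → ℤ | cell h z ⊆ D}, cell h z
      · left
        obtain ⟨z, hz, htz⟩ := Set.mem_iUnion₂.1 H
        exact Set.mem_iUnion₂.2 ⟨z, hfin.mem_toFinset.2 hz, htz⟩
      · exact Or.inr ⟨ht, H⟩
    refine (cost_mono N hsub le_rfl).trans ((cost_union_le _ _ _ _).trans (add_le_add ?_ ?_))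
    · refine (cost_biUnion_le _ _ _ _).trans ?_
      rw [← nsmul_eq_mul, ← Finset.sum_const]
      refine Finset.sum_le_sum fun z hz => ?_
      rw [← cost_homoth N (fun i => h * (z i : ℝ)) hh]
      exact cost_mono N le_rfl
        ((Finset.subset_biUnion_of_mem G hz).trans Finset.subset_union_left)
    · refine (cost_le_of_ptDist_le N (r := r) fun t ht =>
        (ptDist_anti N Finset.subset_union_right t).trans (hr t ht.1)).trans ?_
      gcongr
      exact diff_cells_subset hh D

open Filter Topology in
theorem eventually_exists_cost_le {d : ℕ} (hd : 1 ≤ d) (N : Seminorm ℝ (Fin d → ℝ))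
    {D : Set (Fin d → ℝ)} (hD : Bornology.IsBounded D) (hfr : volume (frontier D) = 0)
    (hpos : 0 < volume D) {ε : ℝ} (hε : 0 < ε) :
    ∀ᶠ n : ℕ in atTop, ∃ P : Finset (Fin d → ℝ), ↑P ⊆ D ∧ P.card ≤ n ∧
      cost N D P ≤ ENNReal.ofReal
        ((quantConst N * (volume D).toReal ^ (((d : ℝ) + 1) / d) + ε) *
          (n : ℝ) ^ (-(1 : ℝ) / d)) := by
  have hd' : (0 : ℝ) < d := by exact_mod_cast hd
  set c := quantConst N
  have hc : 0 ≤ c := quantConst_nonneg N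
  set V := (volume D).toReal with hV
  have hVtop : volume D ≠ ⊤ := hD.measure_lt_top.ne
  have hV0 : 0 < V := ENNReal.toReal_pos hpos.ne' hVtop
  set p : ℝ := ((d : ℝ) + 1) / d with hp
  have hpe : V ^ p = V * V ^ ((1 : ℝ) / d) := by
    rw [hp, add_div, div_self hd'.ne', Real.rpow_add hV0, Real.rpow_one]
  let f : ℝ → ℝ := fun η => V ^ p * (1 - η) ^ (-(1 : ℝ) / d) * (c + η)
  have hf : ContinuousAt f 0 := by
    have h1 : ContinuousAt (fun η : ℝ => (1 - η) ^ (-(1 : ℝ) / d)) 0 :=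
      ContinuousAt.rpow_const (by fun_prop) (Or.inl (by norm_num))
    exact (continuousAt_const.mul h1).mul (by fun_prop)
  have hf0 : f 0 < c * V ^ p + ε := by
    simp only [f, sub_zero, Real.one_rpow, add_zero]
    linarith
  obtain ⟨η, hη1, hη⟩ : ∃ η, f η < c * V ^ p + ε ∧ η ∈ Set.Ioo (0 : ℝ) 1 :=
    (((hf.tendsto.mono_left nhdsWithin_le_nhds).eventually_lt_const hf0).and
      (Ioo_mem_nhdsGT (zero_lt_one' ℝ))).exists
  obtain ⟨hη0, hηl⟩ := hη
  set δ := c * V ^ p + ε - f η with hδ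
  have hδ0 : 0 < δ := by linarith
  obtain ⟨P₀, hP₀, hP₀Q, hκ⟩ := exists_cost_unitCube_lt N hη0
  obtain ⟨m, hm, hm0⟩ : ∃ m : ℕ, P₀.card = m ∧ (0 : ℝ) < m :=
    ⟨_, rfl, by exact_mod_cast hP₀.card_pos⟩
  rw [hm] at hκ
  set T := (cost N (unitCube d) P₀).toReal with hT
  have hTc : cost N (unitCube d) P₀ = ENNReal.ofReal T :=
    (ENNReal.ofReal_toReal (cost_unitCube_ne_top N hP₀ hP₀Q)).symm
  have hT0 : 0 ≤ T := ENNReal.toReal_nonneg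
  obtain ⟨C, hC, hnet⟩ := exists_net hd N hD
  obtain ⟨θ, hθ0, hθ⟩ : ∃ θ : ℝ, 0 < θ ∧ θ = 1 - η := ⟨1 - η, by linarith, rfl⟩
  let h : ℕ → ℝ := fun n => (V * m / θ) ^ ((1 : ℝ) / d) * (n : ℝ) ^ (-(1 : ℝ) / d)
  have hlim : Tendsto h atTop (𝓝 0) := by
    have h1 : Tendsto (fun n : ℕ => (n : ℝ) ^ (-((1 : ℝ) / d))) atTop (𝓝 0) :=
      (tendsto_rpow_neg_atTop (by positivity)).comp tendsto_natCast_atTop_atTop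
    have h2 := h1.const_mul ((V * m / θ) ^ ((1 : ℝ) / d))
    simpa only [mul_zero, ← neg_div] using h2
  have hfc : IsCompact (frontier D) :=
    Metric.isCompact_of_isClosed_isBounded isClosed_frontier
      (hD.closure.subset frontier_subset_closure)
  have hw : ∀ᶠ n : ℕ in atTop, volume (Metric.cthickening (h n) (frontier D)) <
      ENNReal.ofReal (δ / (C * (η / 2) ^ (-(1 : ℝ) / d))) := by
    have h1 := (tendsto_measure_cthickening_of_isCompact (μ := volume) hfc).comp hlim
    rw [hfr] at h1
    exact h1.eventually_lt_const (by rw [ENNReal.ofReal_pos]; positivity)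
  have hlarge : ∀ᶠ n : ℕ in atTop, 2 / η ≤ (n : ℝ) :=
    tendsto_natCast_atTop_atTop.eventually_ge_atTop _
  filter_upwards [hw, hlarge] with n hwn hn
  have hn0 : (0 : ℝ) < n := lt_of_lt_of_le (by positivity) hn
  rw [div_le_iff₀ hη0] at hn
  obtain ⟨n₁, hn₁1, hn₁l, hn₁u⟩ : ∃ k : ℕ, 1 ≤ k ∧ η / 2 * n ≤ k ∧ (k : ℝ) ≤ η * n := by
    refine ⟨⌊η * n⌋₊, (Nat.one_le_floor_iff _).2 (by linarith), ?_, Nat.floor_le (by positivity)⟩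
    have := Nat.lt_floor_add_one (η * n)
    linarith
  have hh0 : 0 < h n := by positivity
  have hhd : h n ^ d = V * m / θ / n := by
    simp only [h]
    rw [mul_pow, ← Real.rpow_natCast, ← Real.rpow_natCast, ← Real.rpow_mul (by positivity),
      ← Real.rpow_mul (by positivity), one_div, inv_mul_cancel₀ hd'.ne', neg_div, neg_mul, one_div,
      inv_mul_cancel₀ hd'.ne', Real.rpow_one, Real.rpow_neg_one, ← div_eq_mul_inv]
  obtain ⟨P₁, hP₁D, hP₁c, hP₁⟩ := hnet n₁ hn₁1
  obtain ⟨M, P, hPD, hM, hPc, hPcost⟩ := exists_points_of_grid N hD hh0 hP₀Q hP₁D hP₁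
  have hM' : M * h n ^ d ≤ V := by
    have := ENNReal.toReal_mono hVtop hM
    rwa [ENNReal.toReal_mul, ENNReal.toReal_natCast, ENNReal.toReal_ofReal (by positivity)] at this
  refine ⟨P, hPD, ?_, ?_⟩
  · have h1 : (M : ℝ) * m ≤ θ * n := by
      rw [hhd] at hM'
      have h2 : (M : ℝ) * (V * m / θ / n) = V * (M * m / (θ * n)) := by
        field_simp
      rw [h2] at hM'
      have h3 : (M : ℝ) * m / (θ * n) ≤ 1 := by
        by_contra H
        push Not at H
        nlinarith
      rwa [div_le_one (by positivity)] at h3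
    have h4 : ((M * m + n₁ : ℕ) : ℝ) ≤ n := by
      push_cast
      rw [hθ] at h1
      linarith
    have h5 : M * m + n₁ ≤ n := by exact_mod_cast h4
    rw [hm] at hPc
    exact hPc.trans ((Nat.add_le_add_left hP₁c _).trans h5)
  · refine hPcost.trans ?_
    rw [hTc]
    set w := δ / (C * (η / 2) ^ (-(1 : ℝ) / d)) with hwdef
    have hw0 : 0 ≤ w := by positivity
    calc _ ≤ (M : ENNReal) * (ENNReal.ofReal (h n ^ (d + 1)) * ENNReal.ofReal T) +
          ENNReal.ofReal (C * (n₁ : ℝ) ^ (-(1 : ℝ) / d)) * ENNReal.ofReal w := by gcongr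
      _ = ENNReal.ofReal (M * (h n ^ (d + 1) * T) + C * (n₁ : ℝ) ^ (-(1 : ℝ) / d) * w) := by
        rw [← ENNReal.ofReal_mul (by positivity), ← ENNReal.ofReal_natCast,
          ← ENNReal.ofReal_mul (by positivity), ← ENNReal.ofReal_mul (by positivity),
          ← ENNReal.ofReal_add (by positivity) (by positivity)]
      _ ≤ _ := by
        refine ENNReal.ofReal_le_ofReal ?_
        have e1 : M * (h n ^ (d + 1) * T) ≤ f η * (n : ℝ) ^ (-(1 : ℝ) / d) := by
          calc M * (h n ^ (d + 1) * T) = (M * h n ^ d) * h n * T := by rw [pow_succ]; ring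
            _ ≤ V * h n * T := by gcongr
            _ = V ^ p * θ ^ (-(1 : ℝ) / d) * ((m : ℝ) ^ ((1 : ℝ) / d) * T) *
                  (n : ℝ) ^ (-(1 : ℝ) / d) := by
              simp only [h]
              rw [Real.div_rpow (by positivity) hθ0.le, Real.mul_rpow hV0.le hm0.le, hpe,
                neg_div, Real.rpow_neg hθ0.le]
              ring
            _ ≤ _ := by
              simp only [f, ← hθ]
              gcongr
        have e2 : C * (n₁ : ℝ) ^ (-(1 : ℝ) / d) * w ≤ δ * (n : ℝ) ^ (-(1 : ℝ) / d) := by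
          have e3 : (n₁ : ℝ) ^ (-(1 : ℝ) / d) ≤
              (η / 2) ^ (-(1 : ℝ) / d) * (n : ℝ) ^ (-(1 : ℝ) / d) := by
            rw [← Real.mul_rpow (by positivity) hn0.le]
            exact Real.rpow_le_rpow_of_nonpos (by positivity) hn₁l
              (by rw [neg_div]; simp)
          calc _ ≤ C * ((η / 2) ^ (-(1 : ℝ) / d) * (n : ℝ) ^ (-(1 : ℝ) / d)) * w := by gcongr
            _ = _ := by
              rw [hwdef]
              field_simp
        calc _ ≤ f η * (n : ℝ) ^ (-(1 : ℝ) / d) + δ * (n : ℝ) ^ (-(1 : ℝ) / d) := add_le_add e1 e2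
          _ = _ := by rw [hδ]; ring

theorem le_cost_cube {d : ℕ} (N : Seminorm ℝ (Fin d → ℝ)) (b : Fin d → ℝ) {L : ℝ} (hL : 0 < L)
    {P : Finset (Fin d → ℝ)} (hP : P.Nonempty) (hPS : ↑P ⊆ homoth b L '' unitCube d)
    {k : ℕ} (hk : P.card ≤ k) :
    ENNReal.ofReal (L ^ (d + 1) * quantConst N * (k : ℝ) ^ (-(1 : ℝ) / d)) ≤
      cost N (homoth b L '' unitCube d) P := by
  obtain ⟨R, hR, rfl⟩ := Finset.subset_set_image_iff.1 hPS
  have hinj := (measurableEmbedding_homoth b hL.ne').injective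
  rw [Finset.card_image_of_injective _ hinj] at hk
  have hRn : R.Nonempty := Finset.image_nonempty.1 hP
  rw [cost_homoth N b hL, mul_assoc, ENNReal.ofReal_mul (by positivity)]
  gcongr
  rw [ENNReal.ofReal_le_iff_le_toReal (cost_unitCube_ne_top N hRn hR)]
  have h1 := quantConst_le N hRn hR
  have hk0 : (0 : ℝ) < k := by exact_mod_cast hRn.card_pos.trans_le hk
  rw [neg_div, Real.rpow_neg hk0.le, ← div_eq_mul_inv, div_le_iff₀ (by positivity), mul_comm]
  refine h1.trans ?_
  gcongr

open Filter Topology in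
theorem eventually_le_cost {d : ℕ} (hd : 1 ≤ d) (N : Seminorm ℝ (Fin d → ℝ))
    (b : Fin d → ℝ) {L : ℝ} (hL : 0 < L) {D : Set (Fin d → ℝ)}
    (hDS : D ⊆ homoth b L '' unitCube d) (hfr : volume (frontier D) = 0)
    (hpos : 0 < volume D) (hlt : (volume D).toReal < L ^ d) {ε : ℝ} (hε : 0 < ε) :
    ∀ᶠ n : ℕ in atTop, ∀ P : Finset (Fin d → ℝ), P.Nonempty → ↑P ⊆ homoth b L '' unitCube d →
      P.card ≤ n → ENNReal.ofReal
        ((quantConst N * (volume D).toReal ^ (((d : ℝ) + 1) / d) - ε) *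
          (n : ℝ) ^ (-(1 : ℝ) / d)) ≤ cost N D P := by
  have hd' : (0 : ℝ) < d := by exact_mod_cast hd
  set c := quantConst N
  have hc : 0 ≤ c := quantConst_nonneg N
  set S := homoth b L '' unitCube d with hS
  have hSvol : volume S = ENNReal.ofReal (L ^ d) := by
    rw [hS, volume_homoth_image b hL, volume_unitCube, mul_one]
  have hSb : Bornology.IsBounded S := by
    refine Metric.isBounded_iff.2 ⟨L, ?_⟩
    rintro _ ⟨x, hx, rfl⟩ _ ⟨y, hy, rfl⟩
    rw [dist_eq_norm, homoth, homoth, add_sub_add_left_eq_sub, ← smul_sub, norm_smul,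
      Real.norm_of_nonneg hL.le]
    exact mul_le_of_le_one_right hL.le (norm_sub_le_of_mem_unitCube hx hy)
  have hSc : Convex ℝ S := by
    have h1 : Convex ℝ (unitCube d) := convex_pi fun _ _ => convex_Ico 0 1
    rintro _ ⟨x, hx, rfl⟩ _ ⟨y, hy, rfl⟩ u v hu hv huv
    refine ⟨u • x + v • y, h1 hx hy hu hv huv, ?_⟩
    ext i
    simp only [homoth, Pi.add_apply, Pi.smul_apply, smul_eq_mul]
    linear_combination (-b i) * huv
  have hDtop : volume D ≠ ⊤ := (hSb.subset hDS).measure_lt_top.ne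
  set α := (volume D).toReal with hα
  have hα0 : 0 < α := ENNReal.toReal_pos hpos.ne' hDtop
  set W := S \ D with hW
  have hWfr : volume (frontier W) = 0 := by
    have h1 : frontier W ⊆ frontier S ∪ frontier D := by
      rw [hW, Set.sdiff_eq]
      refine (frontier_inter_subset _ _).trans (Set.union_subset_union Set.inter_subset_left ?_)
      rw [frontier_compl]
      exact Set.inter_subset_right
    refine measure_mono_null h1 (measure_union_null ?_ hfr)
    exact hSc.addHaar_frontier volume
  have hWvol : volume W = ENNReal.ofReal (L ^ d - α) := by
    rw [hW, measure_sdiff hDS (nullMeasurableSet_of_null_frontier hfr) hDtop, hSvol,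
      ENNReal.ofReal_sub _ hα0.le, hα, ENNReal.ofReal_toReal hDtop]
  set β := L ^ d - α with hβ
  have hβ0 : 0 < β := by linarith
  have hWr : (volume W).toReal = β := by rw [hWvol, ENNReal.toReal_ofReal hβ0.le]
  set ρ := β / α with hρ
  have hρ0 : 0 < ρ := by positivity
  set p : ℝ := ((d : ℝ) + 1) / d with hp
  have hpe : ∀ x : ℝ, 0 < x → x ^ p = x * x ^ ((1 : ℝ) / d) := fun x hx => by
    rw [hp, add_div, div_self hd'.ne', Real.rpow_add hx, Real.rpow_one]
  set ε₁ := ε / 2 / ρ ^ (-(1 : ℝ) / d) with hε₁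
  have hε₁0 : 0 < ε₁ := by positivity
  let m : ℕ → ℕ := fun n => ⌊ρ * n⌋₊
  have hm : Tendsto m atTop atTop :=
    tendsto_nat_floor_atTop.comp (tendsto_natCast_atTop_atTop.const_mul_atTop hρ0)
  have hmn : Tendsto (fun n : ℕ => (m n : ℝ) / n) atTop (𝓝 ρ) :=
    (tendsto_nat_floor_mul_div_atTop hρ0.le).comp tendsto_natCast_atTop_atTop
  let g : ℝ → ℝ := fun x => L ^ (d + 1) * c * (1 + x) ^ (-(1 : ℝ) / d) -
    (c * β ^ p + ε₁) * x ^ (-(1 : ℝ) / d)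
  have hg : ContinuousAt g ρ := by
    have h1 : ContinuousAt (fun x : ℝ => (1 + x) ^ (-(1 : ℝ) / d)) ρ :=
      ContinuousAt.rpow_const (by fun_prop) (Or.inl (by positivity))
    have h2 : ContinuousAt (fun x : ℝ => x ^ (-(1 : ℝ) / d)) ρ :=
      ContinuousAt.rpow_const (by fun_prop) (Or.inl (by positivity))
    exact (continuousAt_const.mul h1).sub (continuousAt_const.mul h2)
  have hgρ : g ρ = c * α ^ p - ε / 2 := by
    have h1 : 1 + ρ = L ^ d / α := by
      rw [hρ, hβ]; field_simp; ring
    have h2 : (L ^ d : ℝ) ^ ((1 : ℝ) / d) = L := by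
      rw [← Real.rpow_natCast, ← Real.rpow_mul hL.le, mul_one_div, div_self hd'.ne', Real.rpow_one]
    have h3 : ε₁ * ρ ^ (-(1 : ℝ) / d) = ε / 2 := by
      rw [hε₁]; field_simp
    have h4 : ρ ^ (-(1 : ℝ) / d) = α ^ ((1 : ℝ) / d) / β ^ ((1 : ℝ) / d) := by
      rw [neg_div, Real.rpow_neg hρ0.le, hρ, Real.div_rpow hβ0.le hα0.le, inv_div]
    have h5 : (1 + ρ) ^ (-(1 : ℝ) / d) = α ^ ((1 : ℝ) / d) / L := by
      rw [h1, neg_div, Real.rpow_neg (by positivity), Real.div_rpow (by positivity) hα0.le, h2,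
        inv_div]
    simp only [g]
    rw [add_mul, h3, h5, h4, hpe α hα0, hpe β hβ0, pow_succ]
    have h6 : L ^ d = α + β := by rw [hβ]; ring
    have h7 : 0 < β ^ ((1 : ℝ) / d) := by positivity
    rw [h6]
    field_simp
    ring
  have hev1 := hm.eventually (eventually_exists_cost_le hd N (hSb.subset Set.sdiff_subset) hWfr
    (by rw [hWvol]; simpa using hβ0) hε₁0)
  have hev2 : ∀ᶠ n : ℕ in atTop, c * α ^ p - ε < g ((m n : ℝ) / n) :=
    (hg.tendsto.comp hmn).eventually_const_lt (by rw [hgρ]; linarith)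
  filter_upwards [hev1, hev2, eventually_gt_atTop 0, hm.eventually_gt_atTop 0] with
    n hn1 hn2 hn hmn0 P hP hPS hPc
  obtain ⟨R, hRW, hRc, hR⟩ := hn1
  rw [hWr] at hR
  have hn' : (0 : ℝ) < n := by exact_mod_cast hn
  have hm' : (0 : ℝ) < m n := by exact_mod_cast hmn0
  have h1 := le_cost_cube N b hL (P := P ∪ R) (hP.mono Finset.subset_union_left)
    (by
      rw [Finset.coe_union]
      exact Set.union_subset hPS (hRW.trans Set.sdiff_subset))
    (k := n + m n) ((Finset.card_union_le _ _).trans (by omega))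
  have h2 : cost N S (P ∪ R) ≤ cost N D P + ENNReal.ofReal ((c * β ^ p + ε₁) *
      (m n : ℝ) ^ (-(1 : ℝ) / d)) := by
    have h3 : S ⊆ D ∪ W := by rw [hW, Set.union_sdiff_self]; exact Set.subset_union_right
    refine (cost_mono N h3 le_rfl).trans ((cost_union_le _ _ _ _).trans (add_le_add ?_ ?_))
    · exact cost_mono N le_rfl Finset.subset_union_left
    · exact (cost_mono N le_rfl Finset.subset_union_right).trans hR
  have h4 := tsub_le_iff_right.2 (h1.trans h2)
  rw [← ENNReal.ofReal_sub _ (by positivity)] at h4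
  refine le_trans (ENNReal.ofReal_le_ofReal ?_) h4
  have h5 : ((n + m n : ℕ) : ℝ) ^ (-(1 : ℝ) / d) =
      (1 + (m n : ℝ) / n) ^ (-(1 : ℝ) / d) * (n : ℝ) ^ (-(1 : ℝ) / d) := by
    rw [← Real.mul_rpow (by positivity) hn'.le]
    congr 1
    push_cast
    field_simp
  have h6 : (m n : ℝ) ^ (-(1 : ℝ) / d) =
      ((m n : ℝ) / n) ^ (-(1 : ℝ) / d) * (n : ℝ) ^ (-(1 : ℝ) / d) := by
    rw [← Real.mul_rpow (by positivity) hn'.le]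
    congr 1
    field_simp
  rw [h5, h6]
  calc _ ≤ g ((m n : ℝ) / n) * (n : ℝ) ^ (-(1 : ℝ) / d) := by gcongr
    _ = _ := by simp only [g]; ring

theorem volume_seminorm_ball {d : ℕ} (N : Seminorm ℝ (Fin d → ℝ)) (t : Fin d → ℝ) {s : ℝ}
    (hs : 0 < s) :
    volume {y | N (t - y) ≤ s} = ENNReal.ofReal (s ^ d) * volume {x | N x ≤ 1} := by
  rw [← volume_homoth_image t hs]
  congr 1
  ext y
  constructor
  · intro hy
    refine ⟨s⁻¹ • (y - t), ?_, ?_⟩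
    · have hy' : N (t - y) ≤ s := hy
      rw [map_sub_rev] at hy'
      simp only [Set.mem_ofPred_eq, map_smul_eq_mul, norm_inv, Real.norm_of_nonneg hs.le]
      rwa [inv_mul_le_iff₀ hs, mul_one]
    · simp [homoth, smul_smul, hs.ne']
  · rintro ⟨x, hx, rfl⟩
    simp only [Set.mem_ofPred_eq] at hx ⊢
    rw [homoth, sub_add_cancel_left, map_neg_eq_map, map_smul_eq_mul, Real.norm_of_nonneg hs.le]
    exact mul_le_of_le_one_right hs.le hx

theorem volume_unitBall_ne_top {d : ℕ} (N : Seminorm ℝ (Fin d → ℝ))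
    (hN : ∀ x, N x = 0 → x = 0) : volume {x | N x ≤ 1} ≠ ⊤ := by
  obtain ⟨a, ha, h⟩ := exists_norm_le_seminorm N hN
  refine ((Metric.isBounded_closedBall (x := (0 : Fin d → ℝ)) (r := a)).subset
    fun x hx => ?_).measure_lt_top.ne
  rw [mem_closedBall_zero_iff]
  exact (h x).trans (mul_le_of_le_one_right ha.le hx)

theorem volume_unitBall_toReal_pos {d : ℕ} (N : Seminorm ℝ (Fin d → ℝ))
    (hN : ∀ x, N x = 0 → x = 0) : 0 < (volume {x | N x ≤ 1}).toReal := by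
  refine ENNReal.toReal_pos (ne_of_gt ?_) (volume_unitBall_ne_top N hN)
  have ho : IsOpen {x | N x < 1} := isOpen_lt (continuous_seminorm N) continuous_const
  exact (ho.measure_pos volume ⟨0, by simp⟩).trans_le (measure_mono (fun x (hx : N x < 1) => hx.le))

theorem ptDist_ne_top {d : ℕ} (N : Seminorm ℝ (Fin d → ℝ)) {P : Finset (Fin d → ℝ)}
    (hP : P.Nonempty) (t : Fin d → ℝ) : ptDist N P t ≠ ⊤ := by
  obtain ⟨p, hp⟩ := hP
  exact ne_top_of_le_ne_top ENNReal.ofReal_ne_top (ptDist_le N hp t)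

theorem one_sub_le_volume_far {d : ℕ} (N : Seminorm ℝ (Fin d → ℝ))
    (hN : ∀ x, N x = 0 → x = 0) (P : Finset (Fin d → ℝ)) {s : ℝ} (hs : 0 < s) :
    ENNReal.ofReal (1 - P.card * (volume {x | N x ≤ 1}).toReal * s ^ d) ≤
      (volume.restrict (unitCube d)) {t | ENNReal.ofReal s ≤ ptDist N P t} := by
  set v := (volume {x | N x ≤ 1}).toReal with hv
  have hv0 : 0 ≤ v := ENNReal.toReal_nonneg
  have hvv : volume {x | N x ≤ 1} = ENNReal.ofReal v :=
    (ENNReal.ofReal_toReal (volume_unitBall_ne_top N hN)).symm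
  obtain ⟨n, hn⟩ : ∃ n : ℕ, P.card = n := ⟨_, rfl⟩
  rw [hn]
  set μ := (volume : Measure (Fin d → ℝ)).restrict (unitCube d)
  have h1 : μ Set.univ = 1 := by
    rw [Measure.restrict_apply_univ, volume_unitCube]
  have hsub : (Set.univ : Set (Fin d → ℝ)) ⊆ {t | ENNReal.ofReal s ≤ ptDist N P t} ∪
      ⋃ p ∈ P, {t | N (p - t) ≤ s} := by
    intro t _
    by_cases h : ENNReal.ofReal s ≤ ptDist N P t
    · exact Or.inl h
    · right
      rw [not_le, ptDist, iInf_lt_iff] at h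
      obtain ⟨p, hp⟩ := h
      rw [iInf_lt_iff] at hp
      obtain ⟨hpP, hp⟩ := hp
      refine Set.mem_iUnion₂.2 ⟨p, hpP, ?_⟩
      rw [ENNReal.ofReal_lt_ofReal_iff hs, map_sub_rev] at hp
      exact hp.le
  have h2 : μ (⋃ p ∈ P, {t | N (p - t) ≤ s}) ≤ ENNReal.ofReal (n * v * s ^ d) := by
    refine (measure_biUnion_finset_le _ _).trans ?_
    calc _ ≤ ∑ p ∈ P, ENNReal.ofReal (s ^ d) * ENNReal.ofReal v := by
          refine Finset.sum_le_sum fun p _ => ?_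
          rw [← hvv, ← volume_seminorm_ball N p hs]
          exact Measure.restrict_apply_le _ _
      _ = _ := by
          rw [Finset.sum_const, hn, nsmul_eq_mul, ← ENNReal.ofReal_mul (by positivity),
            ← ENNReal.ofReal_natCast, ← ENNReal.ofReal_mul (by positivity)]
          congr 1
          ring
  have h3 := (measure_mono hsub).trans ((measure_union_le _ _).trans (add_le_add le_rfl h2))
  rw [h1] at h3
  rw [ENNReal.ofReal_sub _ (by positivity), ENNReal.ofReal_one]
  exact tsub_le_iff_right.2 h3

theorem le_rpow_mul_cost_unitCube {d : ℕ} (hd : 1 ≤ d) (N : Seminorm ℝ (Fin d → ℝ))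
    (hN : ∀ x, N x = 0 → x = 0) {P : Finset (Fin d → ℝ)} (hP : P.Nonempty)
    (hPQ : ↑P ⊆ unitCube d) :
    (d : ℝ) / (d + 1) * (volume {x | N x ≤ 1}).toReal ^ (-(1 : ℝ) / d) ≤
      (P.card : ℝ) ^ ((1 : ℝ) / d) * (cost N (unitCube d) P).toReal := by
  have hd' : (0 : ℝ) < d := by exact_mod_cast hd
  have hn : (0 : ℝ) < (P.card : ℝ) := by exact_mod_cast hP.card_pos
  have hfar := fun s : ℝ => one_sub_le_volume_far N hN P (s := s)
  set v := (volume {x | N x ≤ 1}).toReal with hv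
  have hv0 : 0 < v := volume_unitBall_toReal_pos N hN
  set n : ℝ := (P.card : ℝ)
  set R : ℝ := (n * v) ^ (-(1 : ℝ) / d) with hR
  have hR0 : 0 < R := by positivity
  have hRd : n * v * R ^ d = 1 := by
    rw [hR, ← Real.rpow_natCast, ← Real.rpow_mul (by positivity), neg_div, neg_mul, one_div,
      inv_mul_cancel₀ hd'.ne', Real.rpow_neg_one, mul_inv_cancel₀ (by positivity)]
  have hcake : cost N (unitCube d) P = ∫⁻ s in Set.Ioi (0 : ℝ),
      (volume.restrict (unitCube d)) {t | s ≤ (ptDist N P t).toReal} := by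
    rw [← lintegral_eq_lintegral_meas_le _ (Filter.Eventually.of_forall fun _ =>
      ENNReal.toReal_nonneg) (measurable_ptDist N P).ennreal_toReal.aemeasurable]
    refine lintegral_congr fun t => ?_
    rw [ENNReal.ofReal_toReal (ptDist_ne_top N hP t)]
  have h_int : ∫ s in (0 : ℝ)..R, (1 - n * v * s ^ d) = d / (d + 1) * R := by
    rw [intervalIntegral.integral_sub (by simp) (by
      apply Continuous.intervalIntegrable; fun_prop)]
    rw [intervalIntegral.integral_const_mul, integral_pow]
    simp only [intervalIntegral.integral_const, sub_zero, smul_eq_mul, mul_one]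
    have : n * v * R ^ (d + 1) = R := by rw [pow_succ, ← mul_assoc, hRd, one_mul]
    rw [zero_pow (by omega), sub_zero, ← mul_div_assoc, this]
    field_simp
    ring
  have hlow : ENNReal.ofReal (d / (d + 1) * R) ≤ cost N (unitCube d) P := by
    rw [← h_int, intervalIntegral.integral_of_le hR0.le, ofReal_integral_eq_lintegral_ofReal, hcake]
    · refine (setLIntegral_mono' measurableSet_Ioc fun s hs => ?_).trans
        (lintegral_mono_set ((Set.Ioc_subset_Ioi_self : Set.Ioc 0 R ⊆ Set.Ioi 0)))
      refine (hfar s hs.1).trans (measure_mono fun t ht => ?_)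
      exact (ENNReal.ofReal_le_iff_le_toReal (ptDist_ne_top N hP t)).1 ht
    · apply Continuous.integrableOn_Ioc
      fun_prop
    · refine (ae_restrict_iff' measurableSet_Ioc).2 (Filter.Eventually.of_forall fun s hs => ?_)
      have : n * v * s ^ d ≤ n * v * R ^ d := by
        have := hs.1.le
        have := hs.2
        gcongr
      simp only [Pi.zero_apply]
      linarith
  rw [ENNReal.ofReal_le_iff_le_toReal (cost_unitCube_ne_top N hP hPQ)] at hlow
  have e : (d : ℝ) / (d + 1) * v ^ (-(1 : ℝ) / d) = n ^ ((1 : ℝ) / d) * (d / (d + 1) * R) := by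
    rw [hR, Real.mul_rpow hn.le hv0.le, neg_div, Real.rpow_neg hn.le]
    field_simp
  rw [e]
  gcongr

theorem volume_far_le {d : ℕ} (N : Seminorm ℝ (Fin d → ℝ))
    (hN : ∀ x, N x = 0 → x = 0) {t : Fin d → ℝ} {s : ℝ} (hs : 0 < s)
    (hsub : {y | N (t - y) ≤ s} ⊆ unitCube d) :
    (volume.restrict (unitCube d)) {y | s < N (t - y)} ≤
      ENNReal.ofReal (Real.exp (-((volume {x | N x ≤ 1}).toReal * s ^ d))) := by
  have hvv := (ENNReal.ofReal_toReal (volume_unitBall_ne_top N hN)).symm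
  have hb := volume_seminorm_ball N t hs
  rw [hvv] at hb
  set v := (volume {x | N x ≤ 1}).toReal with hv
  have hv0 : 0 ≤ v := ENNReal.toReal_nonneg
  have hc : Continuous fun y => N (t - y) :=
    (continuous_seminorm N).comp (continuous_const.sub continuous_id)
  have hm : MeasurableSet {y | N (t - y) ≤ s} := (isClosed_le hc continuous_const).measurableSet
  have e : {y | s < N (t - y)} = {y | N (t - y) ≤ s}ᶜ := by
    ext y; simp
  rw [e, Measure.restrict_apply hm.compl, Set.inter_comm, ← Set.sdiff_eq,
    measure_sdiff hsub hm.nullMeasurableSet (by rw [hb]; finiteness), volume_unitCube, hb,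
    ← ENNReal.ofReal_mul (by positivity), ← ENNReal.ofReal_one, ← ENNReal.ofReal_sub _ (by positivity)]
  refine ENNReal.ofReal_le_ofReal ?_
  have := Real.add_one_le_exp (-(v * s ^ d))
  linarith

theorem Gamma_one_div_add_one_le {d : ℕ} (hd : 1 ≤ d) : Real.Gamma (1 / d + 1) ≤ 1 := by
  have hd' : (1 : ℝ) ≤ d := by exact_mod_cast hd
  have h1 : (1 : ℝ) / d ≤ 1 := by rw [div_le_one (by linarith)]; exact hd'
  have h := Real.convexOn_Gamma.2 (show (1 : ℝ) ∈ Set.Ioi 0 by simp)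
    (show (2 : ℝ) ∈ Set.Ioi 0 by simp) (show (0 : ℝ) ≤ 1 - 1 / d by linarith)
    (show (0 : ℝ) ≤ 1 / d by positivity) (by ring)
  have e : (1 - 1 / (d : ℝ)) • (1 : ℝ) + (1 / (d : ℝ)) • (2 : ℝ) = 1 / d + 1 := by
    simp only [smul_eq_mul]; ring
  rw [e] at h
  simpa [Real.Gamma_two] using h

theorem lintegral_exp_neg_le {d : ℕ} (hd : 1 ≤ d) {b : ℝ} (hb : 0 < b) :
    ∫⁻ s in Set.Ioi (0 : ℝ), ENNReal.ofReal (Real.exp (-b * s ^ d)) ≤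
      ENNReal.ofReal (b ^ (-(1 : ℝ) / d)) := by
  have hd' : (0 : ℝ) < d := by exact_mod_cast hd
  have h := integral_exp_neg_mul_rpow hd' hb
  simp only [Real.rpow_natCast] at h
  have hG : 0 < Real.Gamma (1 / d + 1) := Real.Gamma_pos_of_pos (by positivity)
  have h_int : Integrable (fun s : ℝ => Real.exp (-b * s ^ d)) (volume.restrict (Set.Ioi 0)) := by
    refine Integrable.of_integral_ne_zero ?_
    rw [h]
    positivity
  rw [← ofReal_integral_eq_lintegral_ofReal h_int
    (Filter.Eventually.of_forall fun _ => (Real.exp_pos _).le), h]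
  exact ENNReal.ofReal_le_ofReal
    (mul_le_of_le_one_right (by positivity) (Gamma_one_div_add_one_le hd))

theorem measurable_ptDist_image {d n : ℕ} (N : Seminorm ℝ (Fin d → ℝ)) :
    Measurable (Function.uncurry fun (x : Fin n → Fin d → ℝ) t =>
      ptDist N (Finset.univ.image x) t) := by
  have heq : (Function.uncurry fun (x : Fin n → Fin d → ℝ) t =>
      ptDist N (Finset.univ.image x) t) = fun p => ⨅ i, ENNReal.ofReal (N (p.2 - p.1 i)) := by
    funext p
    simp only [Function.uncurry, ptDist, Finset.iInf_finset_image, Finset.mem_univ, iInf_pos]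
  rw [heq]
  have := continuous_seminorm N
  refine Measurable.iInf fun i => (ENNReal.continuous_ofReal.comp ?_).measurable
  fun_prop

theorem lintegral_ptDist_image_le {d : ℕ} (hd : 1 ≤ d) (N : Seminorm ℝ (Fin d → ℝ))
    (hN : ∀ x, N x = 0 → x = 0) {n : ℕ} (hn : 0 < n) {t : Fin d → ℝ} {s₀ A : ℝ} (hs₀ : 0 < s₀)
    (hsub : {y | N (t - y) ≤ s₀} ⊆ unitCube d) (hA : 0 ≤ A)
    (hNA : ∀ x ∈ unitCube d, ∀ y ∈ unitCube d, N (x - y) ≤ A) :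
    ∫⁻ x : Fin n → Fin d → ℝ, ptDist N (Finset.univ.image x) t
        ∂(Measure.pi fun _ => volume.restrict (unitCube d)) ≤
      ENNReal.ofReal ((n * (volume {x | N x ≤ 1}).toReal) ^ (-(1 : ℝ) / d) +
        A * Real.exp (-(n * (volume {x | N x ≤ 1}).toReal * s₀ ^ d))) := by
  have hn' : (0 : ℝ) < n := by exact_mod_cast hn
  have : Nonempty (Fin n) := ⟨⟨0, hn⟩⟩
  have hne : ∀ x : Fin n → Fin d → ℝ, (Finset.univ.image x).Nonempty := fun x =>
    Finset.univ_nonempty.image x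
  have hfar : ∀ s, 0 < s → s ≤ s₀ → (volume.restrict (unitCube d)) {y | s < N (t - y)} ≤
      ENNReal.ofReal (Real.exp (-((volume {x | N x ≤ 1}).toReal * s ^ d))) := fun s hs hss =>
    volume_far_le N hN (t := t) hs (fun y (hy : N (t - y) ≤ s) => hsub (hy.trans hss))
  set v := (volume {x | N x ≤ 1}).toReal with hv
  have hv0 : 0 < v := volume_unitBall_toReal_pos N hN
  have htQ : t ∈ unitCube d := hsub (by simpa using hs₀.le)
  set μ : Measure (Fin d → ℝ) := volume.restrict (unitCube d) with hμ
  have : IsProbabilityMeasure μ := ⟨by simp [hμ, volume_unitCube]⟩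
  have hmeas : Measurable fun x : Fin n → Fin d → ℝ => ptDist N (Finset.univ.image x) t :=
    Measurable.of_uncurry_right (measurable_ptDist_image N)
  have hcake : ∫⁻ x : Fin n → Fin d → ℝ, ptDist N (Finset.univ.image x) t ∂(Measure.pi fun _ => μ)
      = ∫⁻ s in Set.Ioi (0 : ℝ), (Measure.pi fun _ => μ)
        {x : Fin n → Fin d → ℝ | s < (ptDist N (Finset.univ.image x) t).toReal} := by
    rw [← lintegral_eq_lintegral_meas_lt _ (Filter.Eventually.of_forall fun _ =>
      ENNReal.toReal_nonneg) hmeas.ennreal_toReal.aemeasurable]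
    refine lintegral_congr fun x => ?_
    rw [ENNReal.ofReal_toReal (ptDist_ne_top N (hne x) t)]
  have hpow : ∀ s : ℝ, (Measure.pi fun _ => μ)
      {x : Fin n → Fin d → ℝ | s < (ptDist N (Finset.univ.image x) t).toReal} ≤
      (μ {y | s < N (t - y)}) ^ n := fun s => by
    calc _ ≤ (Measure.pi fun _ : Fin n => μ) (Set.univ.pi fun _ => {y | s < N (t - y)}) := by
          refine measure_mono fun x hx i _ => ?_
          refine lt_of_lt_of_le (b := (ptDist N (Finset.univ.image x) t).toReal) hx ?_
          exact ENNReal.toReal_le_of_le_ofReal (apply_nonneg _ _)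
            (ptDist_le N (Finset.mem_image_of_mem x (Finset.mem_univ i)) t)
      _ = _ := by rw [Measure.pi_pi]; simp
  have hexp : ∀ s, 0 < s → s ≤ s₀ → (μ {y | s < N (t - y)}) ^ n ≤
      ENNReal.ofReal (Real.exp (-(n * v) * s ^ d)) := fun s hs hss => by
    refine (pow_le_pow_left' (hfar s hs hss) n).trans_eq ?_
    rw [← ENNReal.ofReal_pow (Real.exp_pos _).le, ← Real.exp_nat_mul]
    congr 2
    ring
  rw [hcake]
  calc _ ≤ ∫⁻ s in Set.Ioi (0 : ℝ), (ENNReal.ofReal (Real.exp (-(n * v) * s ^ d)) +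
        (Set.Ioc 0 A).indicator (fun _ => ENNReal.ofReal (Real.exp (-(n * v * s₀ ^ d)))) s) := by
        refine setLIntegral_mono' measurableSet_Ioi fun s (hs : 0 < s) => (hpow s).trans ?_
        rcases le_or_gt s s₀ with h | h
        · exact (hexp s hs h).trans le_self_add
        rcases le_or_gt s A with h' | h'
        · rw [Set.indicator_of_mem (show s ∈ Set.Ioc 0 A from ⟨hs, h'⟩)]
          refine le_trans ?_ le_add_self
          have := hexp s₀ hs₀ le_rfl
          rw [neg_mul] at this
          refine le_trans ?_ this
          gcongr
        · have : μ {y | s < N (t - y)} = 0 := by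
            have e : ∀ᵐ y ∂μ, ¬ s < N (t - y) := by
              filter_upwards [ae_restrict_mem (measurableSet_unitCube d)] with y hy
              exact not_lt.2 ((hNA t htQ y hy).trans h'.le)
            simpa [ae_iff] using e
          rw [this, zero_pow hn.ne']
          exact zero_le
    _ ≤ ENNReal.ofReal ((n * v) ^ (-(1 : ℝ) / d)) +
        ENNReal.ofReal (A * Real.exp (-(n * v * s₀ ^ d))) := by
        have hm : Measurable fun s : ℝ => ENNReal.ofReal (Real.exp (-(n * v) * s ^ d)) := by
          fun_prop
        rw [lintegral_add_left hm]
        refine add_le_add (lintegral_exp_neg_le hd (by positivity)) ?_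
        refine (setLIntegral_le_lintegral _ _).trans ?_
        rw [lintegral_indicator measurableSet_Ioc, setLIntegral_const, Real.volume_Ioc, sub_zero,
          ← ENNReal.ofReal_mul (Real.exp_pos _).le, mul_comm]
    _ = _ := by rw [ENNReal.ofReal_add (by positivity) (by positivity)]

theorem exists_points_le {d : ℕ} (hd : 1 ≤ d) (N : Seminorm ℝ (Fin d → ℝ))
    (hN : ∀ x, N x = 0 → x = 0) {n : ℕ} (hn : 0 < n) {D : Set (Fin d → ℝ)} {s₀ A : ℝ}
    (hD : MeasurableSet D) (hs₀ : 0 < s₀)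
    (hsub : ∀ t ∈ D, {y | N (t - y) ≤ s₀} ⊆ unitCube d) (hA : 0 ≤ A)
    (hNA : ∀ x ∈ unitCube d, ∀ y ∈ unitCube d, N (x - y) ≤ A) :
    ∃ P : Finset (Fin d → ℝ), P.Nonempty ∧ ↑P ⊆ unitCube d ∧ P.card ≤ n ∧
      cost N D P ≤ ENNReal.ofReal ((n * (volume {x | N x ≤ 1}).toReal) ^ (-(1 : ℝ) / d) +
        A * Real.exp (-(n * (volume {x | N x ≤ 1}).toReal * s₀ ^ d))) * volume D := by
  have : Nonempty (Fin n) := ⟨⟨0, hn⟩⟩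
  set π : Measure (Fin n → Fin d → ℝ) := Measure.pi fun _ => volume.restrict (unitCube d) with hπ
  have : IsProbabilityMeasure (volume.restrict (unitCube d)) := ⟨by simp [volume_unitCube]⟩
  have hmeas := measurable_ptDist_image (n := n) N
  have hle : ∫⁻ x, cost N D (Finset.univ.image x) ∂π ≤
      ENNReal.ofReal ((n * (volume {x | N x ≤ 1}).toReal) ^ (-(1 : ℝ) / d) +
        A * Real.exp (-(n * (volume {x | N x ≤ 1}).toReal * s₀ ^ d))) * volume D := by
    unfold cost
    rw [lintegral_lintegral_swap hmeas.aemeasurable, ← setLIntegral_const]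
    exact setLIntegral_mono' hD fun t ht =>
      lintegral_ptDist_image_le hd N hN hn hs₀ (hsub t ht) hA hNA
  have hnull : ∀ᵐ x ∂π, x ∈ Set.univ.pi fun _ => unitCube d := by
    rw [hπ, ← Measure.restrict_pi_pi]
    exact ae_restrict_mem (MeasurableSet.univ_pi fun _ => measurableSet_unitCube d)
  obtain ⟨x, hx, hxle⟩ := exists_notMem_null_le_lintegral
    (f := fun x => cost N D (Finset.univ.image x)) hmeas.lintegral_prod_right'.aemeasurable
    (ae_iff.1 hnull)
  refine ⟨Finset.univ.image x, Finset.univ_nonempty.image x, ?_, ?_, hxle.trans hle⟩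
  · have hx' : x ∈ Set.univ.pi fun _ => unitCube d := by simpa using hx
    rintro y hy
    simp only [Finset.coe_image, Finset.coe_univ, Set.image_univ, Set.mem_range] at hy
    obtain ⟨i, rfl⟩ := hy
    exact hx' i trivial
  · exact Finset.card_image_le.trans (by simp)

theorem quantConst_mul_le_rpow {d : ℕ} (hd : 1 ≤ d) (N : Seminorm ℝ (Fin d → ℝ))
    (hN : ∀ x, N x = 0 → x = 0) {δ : ℝ} (hδ : 0 < δ) (hδ' : δ < 1 / 2) :
    quantConst N * (1 - 2 * δ) ≤ (volume {x | N x ≤ 1}).toReal ^ (-(1 : ℝ) / d) := by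
  have hd' : (0 : ℝ) < d := by exact_mod_cast hd
  obtain ⟨A, hA, hNA⟩ := exists_seminorm_le_norm N
  obtain ⟨a, ha, hNa⟩ := exists_norm_le_seminorm N hN
  set D : Set (Fin d → ℝ) := Set.Icc (fun _ => δ) (fun _ => 1 - δ) with hD
  have hl : 0 < 1 - 2 * δ := by linarith
  have hV : volume D = ENNReal.ofReal ((1 - 2 * δ) ^ d) := by
    rw [hD, Real.volume_Icc_pi]
    simp only [Finset.prod_const, Finset.card_univ, Fintype.card_fin]
    rw [ENNReal.ofReal_pow hl.le]
    congr 2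
    ring
  have hVr : (volume D).toReal = (1 - 2 * δ) ^ d := by
    rw [hV, ENNReal.toReal_ofReal (by positivity)]
  have hid : homoth (0 : Fin d → ℝ) 1 '' unitCube d = unitCube d := by
    have : homoth (0 : Fin d → ℝ) 1 = id := by funext x; simp [homoth]
    rw [this, Set.image_id]
  have hDQ : D ⊆ unitCube d := fun x hx i _ => by
    have h1 := hx.1 i
    have h2 := hx.2 i
    simp only at h1 h2
    constructor <;> linarith
  have hsub : ∀ t ∈ D, {y | N (t - y) ≤ δ / (2 * a)} ⊆ unitCube d := fun t ht y hy i _ => by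
    have h1 := ht.1 i
    have h2 := ht.2 i
    simp only at h1 h2
    have h3 := (norm_le_pi_norm (t - y) i).trans (hNa (t - y))
    have h4 : a * N (t - y) ≤ a * (δ / (2 * a)) := mul_le_mul_of_nonneg_left hy ha.le
    have h5 : a * (δ / (2 * a)) = δ / 2 := by field_simp
    rw [h5] at h4
    have h6 := abs_le.1 (h3.trans h4)
    simp only [Pi.sub_apply] at h6
    constructor <;> linarith
  have hNA' : ∀ x ∈ unitCube d, ∀ y ∈ unitCube d, N (x - y) ≤ A := fun x hx y hy =>
    (hNA _).trans (mul_le_of_le_one_right hA.le (norm_sub_le_of_mem_unitCube hx hy))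
  have hv0 : 0 < (volume {x | N x ≤ 1}).toReal := volume_unitBall_toReal_pos N hN
  have hpts := fun (n : ℕ) (hn : 0 < n) => exists_points_le hd N hN hn (D := D)
    (s₀ := δ / (2 * a)) (A := A) measurableSet_Icc (by positivity) hsub hA.le hNA'
  set v := (volume {x | N x ≤ 1}).toReal
  have hs0 : 0 < (δ / (2 * a)) ^ d := by positivity
  set κ := v * (δ / (2 * a)) ^ d with hκ
  have hκ0 : 0 < κ := by positivity
  have key : ∀ ε : ℝ, 0 < ε → quantConst N * (1 - 2 * δ) ^ (d + 1) - ε ≤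
      (v ^ (-(1 : ℝ) / d)) * (1 - 2 * δ) ^ d := by
    intro ε hε
    have hev := eventually_le_cost hd N 0 (L := 1) one_pos (D := D) (hid.symm ▸ hDQ)
      ((convex_Icc _ _).addHaar_frontier volume) (by rw [hV]; simpa using pow_pos hl d)
      (by rw [hVr, one_pow]; exact pow_lt_one₀ hl.le (by linarith) (by omega)) hε
    have hlim : Filter.Tendsto (fun n : ℕ => (v ^ (-(1 : ℝ) / d) +
        A * ((n : ℝ) ^ ((1 : ℝ) / d) * Real.exp (-κ * n))) * (1 - 2 * δ) ^ d) Filter.atTop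
        (nhds ((v ^ (-(1 : ℝ) / d) + A * 0) * (1 - 2 * δ) ^ d)) := by
      have := (tendsto_rpow_mul_exp_neg_mul_atTop_nhds_zero ((1 : ℝ) / d) κ hκ0).comp
        tendsto_natCast_atTop_atTop
      exact (tendsto_const_nhds.add (this.const_mul A)).mul_const _
    rw [mul_zero, add_zero] at hlim
    refine ge_of_tendsto hlim ?_
    filter_upwards [hev, Filter.eventually_gt_atTop 0] with n hn hn0
    obtain ⟨P, hP, hPQ, hPn, hPc⟩ := hpts n hn0
    have h := (hn P hP (hid.symm ▸ hPQ) hPn).trans hPc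
    have hn' : (0 : ℝ) < n := by exact_mod_cast hn0
    rw [hV, ← ENNReal.ofReal_mul (by positivity), ENNReal.ofReal_le_ofReal_iff (by positivity),
      ENNReal.toReal_ofReal (by positivity)] at h
    have e1 : ((1 - 2 * δ) ^ d) ^ (((d : ℝ) + 1) / d) = (1 - 2 * δ) ^ (d + 1) := by
      rw [← Real.rpow_natCast, ← Real.rpow_natCast, ← Real.rpow_mul hl.le]
      congr 1
      push_cast
      field_simp
    have e2 : (n : ℝ) ^ (-(1 : ℝ) / d) = ((n : ℝ) ^ ((1 : ℝ) / d))⁻¹ := by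
      rw [neg_div, Real.rpow_neg hn'.le]
    have hr : 0 < (n : ℝ) ^ ((1 : ℝ) / d) := by positivity
    rw [e1, Real.mul_rpow hn'.le hv0.le, e2] at h
    have e3 : -(n * v * (δ / (2 * a)) ^ d) = -κ * n := by rw [hκ]; ring
    rw [e3] at h
    set r := (n : ℝ) ^ ((1 : ℝ) / d)
    calc quantConst N * (1 - 2 * δ) ^ (d + 1) - ε
        = r * ((quantConst N * (1 - 2 * δ) ^ (d + 1) - ε) * r⁻¹) := by field_simp
      _ ≤ r * ((r⁻¹ * v ^ (-(1 : ℝ) / d) + A * Real.exp (-κ * n)) * (1 - 2 * δ) ^ d) := by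
        gcongr
      _ = _ := by field_simp
  have h0 : quantConst N * (1 - 2 * δ) ^ (d + 1) ≤ (v ^ (-(1 : ℝ) / d)) * (1 - 2 * δ) ^ d :=
    le_of_forall_pos_le_add fun ε hε => by linarith [key ε hε]
  rw [pow_succ', ← mul_assoc] at h0
  exact le_of_mul_le_mul_right h0 (by positivity)

theorem quantConst_le_rpow {d : ℕ} (hd : 1 ≤ d) (N : Seminorm ℝ (Fin d → ℝ))
    (hN : ∀ x, N x = 0 → x = 0) :
    quantConst N ≤ (volume {x | N x ≤ 1}).toReal ^ (-(1 : ℝ) / d) := by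
  have hc : Continuous fun δ : ℝ => quantConst N * (1 - 2 * δ) := by fun_prop
  have hlim : Filter.Tendsto (fun δ : ℝ => quantConst N * (1 - 2 * δ)) (nhdsWithin 0 (Set.Ioi 0))
      (nhds (quantConst N)) := by
    simpa using (hc.tendsto 0).mono_left nhdsWithin_le_nhds
  refine le_of_tendsto hlim ?_
  filter_upwards [Ioo_mem_nhdsGT (show (0 : ℝ) < 1 / 2 by norm_num)] with δ hδ
  exact quantConst_mul_le_rpow hd N hN hδ.1 hδ.2

/-- Equivalently, `(1 + 1/d)^d ≤ d log d + d log log d + 5d`. -/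
theorem one_le_mul_rpow {d : ℕ} (hd : 2 ≤ d) :
    1 ≤ (d : ℝ) / (d + 1) *
        ((d : ℝ) * Real.log d + d * Real.log (Real.log d) + 5 * d) ^ ((1 : ℝ) / d) := by
  have hd2 : (2 : ℝ) ≤ d := by exact_mod_cast hd
  have hd' : (0 : ℝ) < d := by linarith
  have hl2 : Real.log 2 ≤ Real.log d := Real.log_le_log (by norm_num) hd2
  have hl2' := Real.log_two_gt_d9
  have hll : -1 ≤ Real.log (Real.log d) := by
    rw [Real.le_log_iff_exp_le (by linarith)]
    have : Real.exp (-1) ≤ 1 / 2 := by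
      rw [Real.exp_neg, inv_eq_one_div]
      have := Real.add_one_le_exp (1 : ℝ)
      exact one_div_le_one_div_of_le (by norm_num) (by linarith)
    linarith
  have hC : 8 ≤ (d : ℝ) * Real.log d + d * Real.log (Real.log d) + 5 * d := by nlinarith
  have hpow : ((d : ℝ) + 1) / d ≤ 3 ^ ((1 : ℝ) / d) := by
    have h1 : ((d : ℝ) + 1) / d ≤ Real.exp (1 / d) := by
      have := Real.add_one_le_exp (1 / (d : ℝ))
      have e : ((d : ℝ) + 1) / d = 1 / d + 1 := by field_simp; ring
      rw [e]; exact this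
    refine h1.trans ?_
    rw [← Real.exp_one_rpow]
    exact Real.rpow_le_rpow (Real.exp_pos _).le (by linarith [Real.exp_one_lt_d9]) (by positivity)
  have hmono : (3 : ℝ) ^ ((1 : ℝ) / d) ≤
      ((d : ℝ) * Real.log d + d * Real.log (Real.log d) + 5 * d) ^ ((1 : ℝ) / d) :=
    Real.rpow_le_rpow (by norm_num) (by linarith) (by positivity)
  calc (1 : ℝ) = d / (d + 1) * ((d + 1) / d) := by field_simp
    _ ≤ _ := by
      have := hpow.trans hmono
      gcongr

theorem exists_ptDist_eq {d : ℕ} (N : Seminorm ℝ (Fin d → ℝ)) {P : Finset (Fin d → ℝ)}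
    (hP : P.Nonempty) (t : Fin d → ℝ) : ∃ p ∈ P, (ptDist N P t).toReal = N (t - p) := by
  obtain ⟨p, hp, hmin⟩ := P.exists_min_image (fun p => N (t - p)) hP
  refine ⟨p, hp, ?_⟩
  have : ptDist N P t = ENNReal.ofReal (N (t - p)) :=
    le_antisymm (ptDist_le N hp t) (le_iInf₂ fun q hq => ENNReal.ofReal_le_ofReal (hmin q hq))
  rw [this, ENNReal.toReal_ofReal (apply_nonneg _ _)]

theorem toReal_ptDist_le {d : ℕ} (N : Seminorm ℝ (Fin d → ℝ)) {P : Finset (Fin d → ℝ)}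
    {p : Fin d → ℝ} (hp : p ∈ P) (t : Fin d → ℝ) : (ptDist N P t).toReal ≤ N (t - p) :=
  ENNReal.toReal_le_of_le_ofReal (apply_nonneg _ _) (ptDist_le N hp t)

theorem toReal_ptDist_sub_le {d : ℕ} (N : Seminorm ℝ (Fin d → ℝ)) {P : Finset (Fin d → ℝ)}
    (hP : P.Nonempty) (x y : Fin d → ℝ) :
    (ptDist N P x).toReal - (ptDist N P y).toReal ≤ N (x - y) := by
  obtain ⟨p, hp, h⟩ := exists_ptDist_eq N hP y
  have h1 := toReal_ptDist_le N hp x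
  have h2 := map_add_le_add N (x - y) (y - p)
  rw [sub_add_sub_cancel] at h2
  linarith

theorem cost_ne_top {d : ℕ} (N : Seminorm ℝ (Fin d → ℝ)) {D : Set (Fin d → ℝ)}
    (hD : Bornology.IsBounded D) {P : Finset (Fin d → ℝ)} (hP : P.Nonempty) :
    cost N D P ≠ ⊤ := by
  obtain ⟨A, hA, h⟩ := exists_seminorm_le_norm N
  obtain ⟨p, hp⟩ := hP
  obtain ⟨r, hr⟩ := hD.subset_closedBall p
  refine ne_top_of_le_ne_top (ENNReal.mul_ne_top (ENNReal.ofReal_ne_top (r := A * r))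
    hD.measure_lt_top.ne) (cost_le_of_ptDist_le N fun t ht => ?_)
  refine (ptDist_le N hp t).trans (ENNReal.ofReal_le_ofReal ((h _).trans ?_))
  have := hr ht
  rw [Metric.mem_closedBall, dist_eq_norm] at this
  gcongr

/-- The worst function vanishing on `P` is the distance to `P`. -/
theorem isGreatest_integral_FB {d : ℕ} (N : Seminorm ℝ (Fin d → ℝ)) {D : Set (Fin d → ℝ)}
    (hD : Bornology.IsBounded D) (hfr : volume (frontier D) = 0) {P : Finset (Fin d → ℝ)}
    (hP : P.Nonempty) (hPD : ↑P ⊆ D) :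
    IsGreatest ((fun f => ∫ t in D, f t) '' {f | f ∈ FB d N D ∧ ∀ p ∈ P, f p = 0})
      (cost N D P).toReal := by
  have hm := measurable_ptDist N P
  have h_int : ∫ t in D, (ptDist N P t).toReal = (cost N D P).toReal :=
    integral_toReal hm.aemeasurable
      (Filter.Eventually.of_forall fun t => (ptDist_ne_top N hP t).lt_top)
  refine ⟨⟨fun t => (ptDist N P t).toReal, ⟨fun x _ y _ => ?_, fun p hp => ?_⟩, h_int⟩, ?_⟩
  · refine abs_sub_le_iff.2 ⟨toReal_ptDist_sub_le N hP x y, ?_⟩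
    rw [map_sub_rev]
    exact toReal_ptDist_sub_le N hP y x
  · refine le_antisymm ?_ ENNReal.toReal_nonneg
    simpa using toReal_ptDist_le N hp p
  · rintro _ ⟨f, ⟨hf, hf0⟩, rfl⟩
    simp only
    by_cases hfi : IntegrableOn f D
    · rw [← h_int]
      refine integral_mono_ae hfi
        (integrable_toReal_of_lintegral_ne_top hm.aemeasurable (cost_ne_top N hD hP)) ?_
      have hDm : NullMeasurableSet D := nullMeasurableSet_of_null_frontier hfr
      filter_upwards [ae_restrict_mem₀ hDm] with t ht
      obtain ⟨p, hp, h⟩ := exists_ptDist_eq N hP t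
      have := (le_abs_self _).trans (hf t ht p (hPD hp))
      rw [hf0 p hp, sub_zero] at this
      exact this.trans h.ge
    · rw [integral_undef hfi]
      exact ENNReal.toReal_nonneg

theorem interr_FB_eq {d : ℕ} (N : Seminorm ℝ (Fin d → ℝ)) {D : Set (Fin d → ℝ)}
    (hD : Bornology.IsBounded D) (hfr : volume (frontier D) = 0) {n : ℕ} (hn : 0 < n) :
    interr D (FB d N D) n =
      ⨅ x : Fin n → D, (cost N D (Finset.univ.image fun i => (x i : Fin d → ℝ))).toReal := by
  have : Nonempty (Fin n) := ⟨⟨0, hn⟩⟩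
  refine iInf_congr fun x => ?_
  have h := isGreatest_integral_FB N hD hfr
    (P := Finset.univ.image fun i => (x i : Fin d → ℝ)) (Finset.univ_nonempty.image _)
    (by
      intro y hy
      simp only [Finset.coe_image, Finset.coe_univ, Set.image_univ, Set.mem_range] at hy
      obtain ⟨i, rfl⟩ := hy
      exact (x i).2)
  simp only [Finset.mem_image, Finset.mem_univ, true_and, forall_exists_index,
    forall_apply_eq_imp_iff] at h
  exact h.csSup_eq

theorem interr_FB_le {d : ℕ} (N : Seminorm ℝ (Fin d → ℝ)) {D : Set (Fin d → ℝ)}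
    (hD : Bornology.IsBounded D) (hfr : volume (frontier D) = 0) {n : ℕ} {P : Finset (Fin d → ℝ)}
    (hP : P.Nonempty) (hPD : ↑P ⊆ D) (hn : P.card ≤ n) :
    interr D (FB d N D) n ≤ (cost N D P).toReal := by
  have hn0 : 0 < n := hP.card_pos.trans_le hn
  rw [interr_FB_eq N hD hfr hn0]
  have : Nonempty P := hP.to_subtype
  obtain ⟨g⟩ : Nonempty (P ↪ Fin n) := Function.Embedding.nonempty_of_card_le (by simpa using hn)
  refine (ciInf_le ⟨0, ?_⟩ fun i =>
    ⟨(Function.invFun g i : P), hPD (Function.invFun g i : P).2⟩).trans ?_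
  · rintro _ ⟨x, rfl⟩
    exact ENNReal.toReal_nonneg
  · refine ENNReal.toReal_mono (cost_ne_top N hD hP) (cost_mono N le_rfl fun p hp => ?_)
    obtain ⟨i, hi⟩ := Function.invFun_surjective g.injective ⟨p, hp⟩
    refine Finset.mem_image.2 ⟨i, Finset.mem_univ _, ?_⟩
    simp [hi]

theorem le_interr_FB {d : ℕ} (N : Seminorm ℝ (Fin d → ℝ)) {D : Set (Fin d → ℝ)}
    (hD : Bornology.IsBounded D) (hfr : volume (frontier D) = 0) (hDn : D.Nonempty) {n : ℕ}
    (hn : 0 < n) {r : ℝ} (h : ∀ P : Finset (Fin d → ℝ), P.Nonempty → ↑P ⊆ D → P.card ≤ n →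
      ENNReal.ofReal r ≤ cost N D P) :
    r ≤ interr D (FB d N D) n := by
  have : Nonempty (Fin n) := ⟨⟨0, hn⟩⟩
  have : Nonempty D := hDn.to_subtype
  rw [interr_FB_eq N hD hfr hn]
  refine le_ciInf fun x => ?_
  have hne : (Finset.univ.image fun i => (x i : Fin d → ℝ)).Nonempty :=
    Finset.univ_nonempty.image _
  refine (ENNReal.ofReal_le_iff_le_toReal (cost_ne_top N hD hne)).1 (h _ hne ?_ ?_)
  · intro y hy
    simp only [Finset.coe_image, Finset.coe_univ, Set.image_univ, Set.mem_range] at hy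
    obtain ⟨i, rfl⟩ := hy
    exact (x i).2
  · exact Finset.card_image_le.trans (by simp)

theorem exists_cube_superset {d : ℕ} (hd : 1 ≤ d) {D : Set (Fin d → ℝ)}
    (hD : Bornology.IsBounded D) : ∃ (b : Fin d → ℝ) (L : ℝ), 0 < L ∧
      D ⊆ homoth b L '' unitCube d ∧ (volume D).toReal < L ^ d := by
  obtain ⟨r, hr⟩ := hD.subset_ball 0
  set L : ℝ := max 1 (max (2 * r) ((volume D).toReal + 1)) with hL
  have h1 : 1 ≤ L := le_max_left _ _
  have h2 : 2 * r ≤ L := (le_max_left _ _).trans (le_max_right _ _)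
  have h3 : (volume D).toReal + 1 ≤ L := (le_max_right _ _).trans (le_max_right _ _)
  have hL0 : 0 < L := by linarith
  refine ⟨fun _ => -(L / 2), L, hL0, fun t ht => ?_, ?_⟩
  · have ht := hr ht
    rw [mem_ball_zero_iff] at ht
    refine ⟨fun i => (t i + L / 2) / L, fun i _ => ?_, ?_⟩
    · have h := abs_lt.1 ((norm_le_pi_norm t i).trans_lt ht)
      simp only [Set.mem_Ico]
      rw [div_lt_one hL0]
      exact ⟨div_nonneg (by linarith) hL0.le, by linarith⟩
    · funext i
      simp only [homoth, Pi.add_apply, Pi.smul_apply, smul_eq_mul]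
      field_simp
      ring
  · have : L ≤ L ^ d := le_self_pow₀ h1 (by omega)
    linarith

theorem tendsto_rpow_mul_interr {d : ℕ} (hd : 1 ≤ d) (N : Seminorm ℝ (Fin d → ℝ))
    {D : Set (Fin d → ℝ)} (hD : Bornology.IsBounded D) (hfr : volume (frontier D) = 0)
    (hpos : 0 < volume D) :
    Filter.Tendsto (fun n : ℕ => (n : ℝ) ^ ((1 : ℝ) / d) * interr D (FB d N D) n) Filter.atTop
      (nhds (quantConst N * (volume D).toReal ^ (((d : ℝ) + 1) / d))) := by
  have hDn : D.Nonempty := nonempty_of_measure_ne_zero hpos.ne'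
  obtain ⟨b, L, hL, hDS, hlt⟩ := exists_cube_superset hd hD
  rw [Metric.tendsto_atTop']
  intro ε hε
  obtain ⟨n₀, hn₀⟩ := Filter.eventually_atTop.1
    ((eventually_exists_cost_le hd N hD hfr hpos (half_pos hε)).and
      (eventually_le_cost hd N b hL hDS hfr hpos hlt (half_pos hε)))
  have hc : 0 ≤ quantConst N * (volume D).toReal ^ (((d : ℝ) + 1) / d) :=
    mul_nonneg (quantConst_nonneg N) (by positivity)
  refine ⟨n₀, fun n hn => ?_⟩
  obtain ⟨⟨P, hPD, hPn, hPc⟩, hlow⟩ := hn₀ n hn.le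
  set c := quantConst N * (volume D).toReal ^ (((d : ℝ) + 1) / d)
  have hn0 : 0 < n := by omega
  have hn' : (0 : ℝ) < n := by exact_mod_cast hn0
  have hP : P.Nonempty := by
    by_contra hP
    rw [Finset.not_nonempty_iff_eq_empty] at hP
    subst hP
    refine absurd (ENNReal.ofReal_lt_top.trans_le' hPc) ?_
    simp [cost, ptDist, hpos.ne']
  have hu : interr D (FB d N D) n ≤ (c + ε / 2) * (n : ℝ) ^ (-(1 : ℝ) / d) :=
    (interr_FB_le N hD hfr hP hPD hPn).trans
      (ENNReal.toReal_le_of_le_ofReal (by positivity) hPc)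
  have hl : (c - ε / 2) * (n : ℝ) ^ (-(1 : ℝ) / d) ≤ interr D (FB d N D) n :=
    le_interr_FB N hD hfr hDn hn0 fun R hR hRD hRn => hlow R hR (hRD.trans hDS) hRn
  rw [neg_div, Real.rpow_neg hn'.le] at hu hl
  have hr : 0 < (n : ℝ) ^ ((1 : ℝ) / d) := by positivity
  rw [← div_eq_mul_inv] at hu hl
  rw [le_div_iff₀ hr, mul_comm] at hu
  rw [div_le_iff₀ hr, mul_comm] at hl
  rw [Real.dist_eq, abs_lt]
  constructor
  · linarith [mul_comm (interr D (FB d N D) n) ((n : ℝ) ^ ((1 : ℝ) / d))]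
  · linarith

end LipschitzIntegration

open LipschitzIntegration

/-- Asymptotic constant for integration of Lipschitz functions: there is a constant
`ξ_B ∈ [d/(d+1), (d/(d+1))(d log d + d log log d + 5d)^{1/d}]` such that for every bounded
Jordan measurable `D` with nonempty interior,
`lim_n n^{1/d} e(n, F^B(D)) = ξ_B λ(D)^{(d+1)/d} λ(B)^{-1/d}`. -/
theorem lipschitz_integration_asymptotics (d : ℕ) (hd : 2 ≤ d)
    (N : Seminorm ℝ (Fin d → ℝ)) (hN : ∀ x, N x = 0 → x = 0) :
    ∃ ξ : ℝ, (d : ℝ) / (d + 1) ≤ ξ ∧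
      ξ ≤ (d : ℝ) / (d + 1) *
        ((d : ℝ) * Real.log d + d * Real.log (Real.log d) + 5 * d) ^ ((1 : ℝ) / d) ∧
      ∀ D : Set (Fin d → ℝ), Bornology.IsBounded D → volume (frontier D) = 0 →
        (interior D).Nonempty →
        Filter.Tendsto (fun n : ℕ => (n : ℝ) ^ ((1 : ℝ) / d) * interr D (FB d N D) n)
          Filter.atTop
          (nhds (ξ * (volume D).toReal ^ (((d : ℝ) + 1) / d) *
            (volume {x : Fin d → ℝ | N x ≤ 1}).toReal ^ (-(1 : ℝ) / d))) := by
  have hd1 : 1 ≤ d := by omega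
  have hv : 0 < (volume {x | N x ≤ 1}).toReal := volume_unitBall_toReal_pos N hN
  have hlow := le_quantConst N fun P hP hPQ => le_rpow_mul_cost_unitCube hd1 N hN hP hPQ
  have hup := quantConst_le_rpow hd1 N hN
  set v := (volume {x | N x ≤ 1}).toReal
  rw [neg_div, Real.rpow_neg hv.le] at hlow hup ⊢
  have hr : 0 < v ^ ((1 : ℝ) / d) := by positivity
  refine ⟨quantConst N * v ^ ((1 : ℝ) / d), ?_, ?_, fun D hD hfr h_int => ?_⟩
  · rwa [← div_eq_mul_inv, div_le_iff₀ hr] at hlow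
  · refine le_trans ?_ (one_le_mul_rpow hd)
    rwa [← one_div, le_div_iff₀ hr] at hup
  · have hpos : 0 < volume D :=
      (isOpen_interior.measure_pos volume h_int).trans_le (measure_mono interior_subset)
    convert tendsto_rpow_mul_interr hd1 N hD hfr hpos using 2
    field_simp
end

section
/- Let d, n ∈ ℕ, let ‖·‖_B be a norm on ℝ^d with unit ball B, let r > 0, and let D ⊂ ℝ^d be the union of n pairwise disjoint open ‖·‖_B-balls of radius r. Then e(n, F^B(D)) = (d/(d+1)) · λ^d(B)^{−1/d} · λ^d(D)^{(d+1)/d} · n^{−1/d} = (d/(d+1)) · λ^d(B) · n · r^{d+1}; i.e., the disjoint union of n equal balls attains the minimal possible normalized integration error among all Jordan measurable domains. -/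
open MeasureTheory

namespace Seminorm

section Cone

variable {E : Type*} [NormedAddCommGroup E] [NormedSpace ℝ E]

/-- The cone of height `r` over the `N`-ball of radius `r` centred at the origin. -/
noncomputable def cone (N : Seminorm ℝ E) (r : ℝ) (x : E) : ℝ := max (r - N x) 0

theorem cone_nonneg (N : Seminorm ℝ E) (r : ℝ) (x : E) : 0 ≤ N.cone r x := le_max_right _ _

theorem cone_eq_zero (N : Seminorm ℝ E) {r : ℝ} {x : E} (h : r ≤ N x) : N.cone r x = 0 :=
  max_eq_right (by linarith)

variable [FiniteDimensional ℝ E]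

theorem continuous_of_finiteDimensional (N : Seminorm ℝ E) : Continuous N :=
  N.convexOn.locallyLipschitz.continuous

theorem exists_pos_mul_norm_le (N : Seminorm ℝ E) (hN : ∀ x, N x = 0 → x = 0) :
    ∃ c > 0, ∀ x, c * ‖x‖ ≤ N x := by
  have : ProperSpace E := FiniteDimensional.proper ℝ E
  rcases (Metric.sphere (0 : E) 1).eq_empty_or_nonempty with hS | hS
  · refine ⟨1, one_pos, fun x => ?_⟩
    have hx : x = 0 := by
      by_contra hx
      have : ‖x‖⁻¹ • x ∈ Metric.sphere (0 : E) 1 := by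
        simp [norm_smul, norm_ne_zero_iff.2 hx]
      simp [hS] at this
    simp [hx]
  · obtain ⟨a, ha, hmin⟩ := (isCompact_sphere (0 : E) 1).exists_isMinOn hS
      N.continuous_of_finiteDimensional.continuousOn
    have ha0 : a ≠ 0 := by rintro rfl; simp at ha
    refine ⟨N a, lt_of_le_of_ne (apply_nonneg N a) fun h => ha0 (hN a h.symm), fun x => ?_⟩
    rcases eq_or_ne x 0 with rfl | hx
    · simp
    have hx' : 0 < ‖x‖ := norm_pos_iff.2 hx
    have hle : N a ≤ N (‖x‖⁻¹ • x) := hmin (by simp [norm_smul, hx'.ne'])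
    rw [map_smul_eq_mul, norm_inv, norm_norm, inv_mul_eq_div, le_div_iff₀ hx'] at hle
    exact hle

theorem isCompact_le (N : Seminorm ℝ E) (hN : ∀ x, N x = 0 → x = 0) (a : E) (r : ℝ) :
    IsCompact {x | N (x - a) ≤ r} := by
  have : ProperSpace E := FiniteDimensional.proper ℝ E
  obtain ⟨c, hc, hcN⟩ := N.exists_pos_mul_norm_le hN
  have hcont := N.continuous_of_finiteDimensional
  refine Metric.isCompact_of_isClosed_isBounded
    (isClosed_le (by fun_prop) continuous_const)
    (Metric.isBounded_closedBall (x := a) (r := r / c) |>.subset fun x hx => ?_)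
  rw [mem_closedBall_iff_norm, le_div_iff₀' hc]
  exact (hcN _).trans hx

theorem continuous_cone (N : Seminorm ℝ E) (r : ℝ) : Continuous (N.cone r) := by
  have := N.continuous_of_finiteDimensional
  unfold cone
  fun_prop

section Measure

open Module
open scoped Pointwise

variable [MeasurableSpace E] [BorelSpace E] (μ : Measure E) [μ.IsAddHaarMeasure]

theorem measureReal_le (N : Seminorm ℝ E) [Nontrivial E] (hN : ∀ x, N x = 0 → x = 0)
    {s : ℝ} (hs : 0 ≤ s) :
    μ.real {x | N x ≤ s} = s ^ finrank ℝ E * μ.real {x | N x ≤ 1} := by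
  rcases hs.eq_or_lt with rfl | hs
  · have : {x | N x ≤ 0} = {(0 : E)} := by
      ext x
      exact ⟨fun h => hN x (le_antisymm h (apply_nonneg N x)), by rintro rfl; simp⟩
    simp [this, finrank_pos.ne', Measure.real]
  · have : {x | N x ≤ s} = s • {x | N x ≤ 1} := by
      ext x
      rw [Set.mem_smul_set_iff_inv_smul_mem₀ hs.ne']
      simp [map_smul_eq_mul, abs_of_pos hs, inv_mul_le_iff₀ hs]
    rw [this, Measure.real, Measure.addHaar_smul, ENNReal.toReal_mul,
      ENNReal.toReal_ofReal (abs_nonneg _), abs_of_pos (by positivity), Measure.real]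

theorem measureReal_lt (N : Seminorm ℝ E) [Nontrivial E] (hN : ∀ x, N x = 0 → x = 0)
    {s : ℝ} (hs : 0 ≤ s) :
    μ.real {x | N x < s} = s ^ finrank ℝ E * μ.real {x | N x ≤ 1} := by
  rw [← N.measureReal_le μ hN hs, Measure.real, Measure.real,
    measure_le_eq_lt μ (map_zero N) (map_neg_eq_map N) (map_add_le_add N) (hN _)
      (fun c x => (map_smul_eq_mul N c x).le)]

theorem integrable_cone (N : Seminorm ℝ E) (hN : ∀ x, N x = 0 → x = 0) (r : ℝ) :
    Integrable (N.cone r) μ :=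
  (N.continuous_cone r).integrable_of_hasCompactSupport <|
    HasCompactSupport.intro (N.isCompact_le hN 0 r)
      fun x hx => N.cone_eq_zero (by simpa using hx : r < N x).le

theorem integral_cone (N : Seminorm ℝ E) [Nontrivial E] (hN : ∀ x, N x = 0 → x = 0)
    {r : ℝ} (hr : 0 ≤ r) :
    ∫ x, N.cone r x ∂μ =
      r ^ (finrank ℝ E + 1) / (finrank ℝ E + 1) * μ.real {x | N x ≤ 1} := by
  rw [(N.integrable_cone μ hN r).integral_eq_integral_Ioc_meas_le (M := r)
    (.of_forall (N.cone_nonneg r))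
    (.of_forall fun x => max_le (by linarith [apply_nonneg N x]) hr)]
  have hset : ∀ t ∈ Set.Ioc 0 r, μ.real {a | t ≤ N.cone r a} =
      (r - t) ^ finrank ℝ E * μ.real {x | N x ≤ 1} := by
    intro t ht
    rw [← N.measureReal_le μ hN (sub_nonneg.2 ht.2)]
    congr 1
    ext x
    simp only [cone, Set.mem_ofPred_eq, le_max_iff, not_le.2 ht.1, or_false]
    exact le_sub_comm
  rw [setIntegral_congr_fun measurableSet_Ioc hset, ← intervalIntegral.integral_of_le hr,
    intervalIntegral.integral_mul_const,
    intervalIntegral.integral_comp_sub_left (fun t : ℝ => t ^ finrank ℝ E) r]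
  simp

end Measure

end Cone

end Seminorm

section UnionOfBalls

variable {d n : ℕ} {N : Seminorm ℝ (Fin d → ℝ)} {r : ℝ} {z : Fin n → Fin d → ℝ}
  {D : Set (Fin d → ℝ)}

/-- The integral over `D` of `r` minus the sum of `n` cones of height `r` supported in `D`. -/
noncomputable def coneDefect (N : Seminorm ℝ (Fin d → ℝ)) (D : Set (Fin d → ℝ)) (n : ℕ)
    (r : ℝ) : ℝ :=
  volume.real D * r - n * ∫ t, N.cone r t

theorem integrableOn_sub_of_eq_iUnion (hN : ∀ x, N x = 0 → x = 0)
    (hD : D = ⋃ k, {x : Fin d → ℝ | N (x - z k) < r}) (a : Fin d → ℝ) :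
    IntegrableOn (fun t => N (t - a)) D := by
  have hcont := N.continuous_of_finiteDimensional
  refine IntegrableOn.mono_set (ContinuousOn.integrableOn_compact
    (isCompact_iUnion fun k => N.isCompact_le hN (z k) r) (by fun_prop)) ?_
  rw [hD]
  exact Set.iUnion_mono fun k x (hx : N (x - z k) < r) => hx.le

theorem measurableSet_of_eq_iUnion (hD : D = ⋃ k, {x : Fin d → ℝ | N (x - z k) < r}) :
    MeasurableSet D := by
  have hcont := N.continuous_of_finiteDimensional
  rw [hD]
  exact .iUnion fun k => (isOpen_lt (by fun_prop) continuous_const).measurableSet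

theorem volume_ne_top_of_eq_iUnion (hN : ∀ x, N x = 0 → x = 0)
    (hD : D = ⋃ k, {x : Fin d → ℝ | N (x - z k) < r}) : volume D ≠ ⊤ := by
  refine ((measure_mono ?_).trans_lt
    (isCompact_iUnion fun k => N.isCompact_le hN (z k) r).measure_lt_top).ne
  rw [hD]
  exact Set.iUnion_mono fun k x (hx : N (x - z k) < r) => hx.le

theorem volumeReal_of_eq_iUnion (hd : 0 < d) (hN : ∀ x, N x = 0 → x = 0) (hr : 0 ≤ r)
    (hdisj : Pairwise fun k l =>
      Disjoint {x : Fin d → ℝ | N (x - z k) < r} {x : Fin d → ℝ | N (x - z l) < r})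
    (hD : D = ⋃ k, {x : Fin d → ℝ | N (x - z k) < r}) :
    volume.real D = n * (r ^ d * volume.real {x : Fin d → ℝ | N x ≤ 1}) := by
  have : Nonempty (Fin d) := ⟨⟨0, hd⟩⟩
  have hcont := N.continuous_of_finiteDimensional
  have htrans : ∀ k, volume {x : Fin d → ℝ | N (x - z k) < r} = volume {x | N x < r} :=
    fun k => by
      simpa [sub_eq_add_neg] using measure_preimage_add_right volume (-z k) {x | N x < r}
  have hvol := N.measureReal_lt volume hN hr
  rw [Module.finrank_fin_fun] at hvol
  rw [← hvol, hD, Measure.real, measure_iUnion hdisj fun k =>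
    (isOpen_lt (by fun_prop) continuous_const).measurableSet]
  simp [htrans, Measure.real]

theorem integrable_cone_sub (hN : ∀ x, N x = 0 → x = 0) (r : ℝ) (a : Fin d → ℝ) :
    Integrable (fun t => N.cone r (t - a)) :=
  (N.integrable_cone volume hN r).comp_sub_right a

theorem integrableOn_sub_sum_cone (hN : ∀ x, N x = 0 → x = 0) (hfin : volume D ≠ ⊤)
    (r : ℝ) (x : Fin n → Fin d → ℝ) :
    IntegrableOn (fun t => r - ∑ i, N.cone r (t - x i)) D :=
  (integrableOn_const hfin).sub
    (integrable_finsetSum _ fun i _ => (integrable_cone_sub hN r (x i)).integrableOn)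

theorem setIntegral_sub_sum_cone (hN : ∀ x, N x = 0 → x = 0) (hfin : volume D ≠ ⊤)
    (r : ℝ) (x : Fin n → Fin d → ℝ) :
    ∫ t in D, (r - ∑ i, N.cone r (t - x i)) =
      volume.real D * r - ∑ i, ∫ t in D, N.cone r (t - x i) := by
  have hint := fun i => (integrable_cone_sub hN r (x i)).integrableOn (s := D)
  have hconst : IntegrableOn (fun _ => r) D := integrableOn_const hfin
  rw [integral_sub hconst (integrable_finsetSum _ fun i _ => hint i),
    integral_finsetSum _ fun i _ => hint i, setIntegral_const, smul_eq_mul]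

theorem coneDefect_le_setIntegral (hN : ∀ x, N x = 0 → x = 0) (hfin : volume D ≠ ⊤)
    (r : ℝ) (x : Fin n → Fin d → ℝ) :
    coneDefect N D n r ≤ ∫ t in D, (r - ∑ i, N.cone r (t - x i)) := by
  have hle : ∀ i, ∫ t in D, N.cone r (t - x i) ≤ ∫ t, N.cone r t := fun i =>
    (setIntegral_le_integral (integrable_cone_sub hN r (x i))
      (.of_forall fun t => N.cone_nonneg r _)).trans_eq
        (integral_sub_right_eq_self (N.cone r) (x i))
  rw [setIntegral_sub_sum_cone hN hfin, coneDefect]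
  have := Finset.sum_le_sum fun i (_ : i ∈ Finset.univ) => hle i
  simp only [Finset.sum_const, Finset.card_univ, Fintype.card_fin, nsmul_eq_mul] at this
  linarith

theorem setIntegral_sub_sum_cone_centers (hN : ∀ x, N x = 0 → x = 0)
    (hD : D = ⋃ k, {x : Fin d → ℝ | N (x - z k) < r}) :
    ∫ t in D, (r - ∑ i, N.cone r (t - z i)) = coneDefect N D n r := by
  have heq : ∀ i, ∫ t in D, N.cone r (t - z i) = ∫ t, N.cone r t := fun i => by
    rw [← integral_sub_right_eq_self (N.cone r) (z i)]
    refine setIntegral_eq_integral_of_forall_compl_eq_zero fun t ht => ?_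
    refine N.cone_eq_zero (not_lt.1 fun h => ht ?_)
    rw [hD]
    exact Set.mem_iUnion.2 ⟨i, h⟩
  rw [setIntegral_sub_sum_cone hN (volume_ne_top_of_eq_iUnion hN hD), coneDefect]
  simp [heq]

theorem sub_sum_cone_eq_of_mem_ball
    (hdisj : Pairwise fun k l =>
      Disjoint {x : Fin d → ℝ | N (x - z k) < r} {x : Fin d → ℝ | N (x - z l) < r})
    {t : Fin d → ℝ} {k : Fin n} (hk : N (t - z k) < r) :
    r - ∑ i, N.cone r (t - z i) = N (t - z k) := by
  rw [Finset.sum_eq_single k]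
  · rw [Seminorm.cone, max_eq_left (by linarith)]
    ring
  · intro l _ hl
    exact N.cone_eq_zero (not_lt.1 fun h => Set.disjoint_left.1 (hdisj hl) h hk)
  · simp

/-- The distance to a nonempty finite set of nodes is the extremal function of the Lipschitz
class. -/
theorem iInf_sub_mem_FB [Nonempty (Fin n)] (x : Fin n → Fin d → ℝ) :
    (fun t => ⨅ i, N (t - x i)) ∈ FB d N D := by
  have key : ∀ s t, (⨅ i, N (s - x i)) - (⨅ i, N (t - x i)) ≤ N (s - t) := fun s t => by
    rw [sub_le_iff_le_add, ← sub_le_iff_le_add']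
    refine le_ciInf fun i => ?_
    have h1 : (⨅ i, N (s - x i)) ≤ N (s - x i) := ciInf_le (Set.finite_range _).bddBelow i
    have h2 := map_add_le_add N (s - t) (t - x i)
    rw [sub_add_sub_cancel] at h2
    linarith
  intro s _ t _
  rw [abs_sub_le_iff]
  exact ⟨key s t, by rw [map_sub_rev]; exact key t s⟩

theorem iInf_sub_node [Nonempty (Fin n)] (x : Fin n → Fin d → ℝ) (i : Fin n) :
    ⨅ j, N (x i - x j) = 0 :=
  le_antisymm ((ciInf_le (Set.finite_range _).bddBelow i).trans_eq (by simp))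
    (le_ciInf fun _ => apply_nonneg N _)

theorem sub_sum_cone_le_iInf [Nonempty (Fin n)] (r : ℝ) (x : Fin n → Fin d → ℝ)
    (t : Fin d → ℝ) : r - ∑ i, N.cone r (t - x i) ≤ ⨅ i, N (t - x i) := by
  refine le_ciInf fun i => ?_
  have h1 : N.cone r (t - x i) ≤ ∑ i, N.cone r (t - x i) :=
    Finset.single_le_sum (f := fun i => N.cone r (t - x i)) (fun j _ => N.cone_nonneg r _)
      (Finset.mem_univ i)
  have h2 : r - N (t - x i) ≤ N.cone r (t - x i) := le_max_left _ _
  linarith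

theorem abs_le_of_mem_FB {f : (Fin d → ℝ) → ℝ} (hf : f ∈ FB d N D) {a t : Fin d → ℝ}
    (ha : a ∈ D) (ht : t ∈ D) (hfa : f a = 0) : |f t| ≤ N (t - a) := by
  simpa [hfa] using hf t ht a ha

theorem bddAbove_integral_image (hn : 0 < n) (hN : ∀ x, N x = 0 → x = 0)
    (hD : D = ⋃ k, {x : Fin d → ℝ | N (x - z k) < r}) (x : Fin n → D) :
    BddAbove ((fun f => ∫ t in D, f t) ''
      {f | f ∈ FB d N D ∧ ∀ i, f ((x i : Fin d → ℝ)) = 0}) := by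
  refine ⟨∫ t in D, N (t - x ⟨0, hn⟩), ?_⟩
  rintro _ ⟨f, ⟨hf, hfx⟩, rfl⟩
  refine (Real.le_norm_self _).trans
    (norm_integral_le_of_norm_le (integrableOn_sub_of_eq_iUnion hN hD _) ?_)
  exact ae_restrict_of_forall_mem (measurableSet_of_eq_iUnion hD) fun t ht =>
    abs_le_of_mem_FB hf (x _).2 ht (hfx _)

theorem coneDefect_le_sSup (hn : 0 < n) (hN : ∀ x, N x = 0 → x = 0)
    (hD : D = ⋃ k, {x : Fin d → ℝ | N (x - z k) < r}) (x : Fin n → D) :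
    coneDefect N D n r ≤ sSup ((fun f => ∫ t in D, f t) ''
      {f | f ∈ FB d N D ∧ ∀ i, f ((x i : Fin d → ℝ)) = 0}) := by
  have : Nonempty (Fin n) := ⟨⟨0, hn⟩⟩
  have hcont := N.continuous_of_finiteDimensional
  have hfin := volume_ne_top_of_eq_iUnion hN hD
  set m : (Fin d → ℝ) → ℝ := fun t => ⨅ i, N (t - x i) with hm
  have hmeas : Measurable m := .iInf fun i => Continuous.measurable (by fun_prop)
  have hmint : IntegrableOn m D := by
    refine (integrableOn_sub_of_eq_iUnion hN hD (x ⟨0, hn⟩)).mono' hmeas.aestronglyMeasurable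
      (.of_forall fun t => ?_)
    rw [Real.norm_of_nonneg (le_ciInf fun i => apply_nonneg N _)]
    exact ciInf_le (Set.finite_range _).bddBelow _
  calc coneDefect N D n r ≤ ∫ t in D, (r - ∑ i, N.cone r (t - x i)) :=
        coneDefect_le_setIntegral hN hfin r _
    _ ≤ ∫ t in D, m t :=
        setIntegral_mono (integrableOn_sub_sum_cone hN hfin r _) hmint
          fun t => sub_sum_cone_le_iInf r _ t
    _ ≤ _ := le_csSup (bddAbove_integral_image hn hN hD x)
        ⟨m, ⟨iInf_sub_mem_FB _, fun i => iInf_sub_node (fun j => (x j : Fin d → ℝ)) i⟩, rfl⟩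

theorem sSup_centers_le (hN : ∀ x, N x = 0 → x = 0)
    (hdisj : Pairwise fun k l =>
      Disjoint {x : Fin d → ℝ | N (x - z k) < r} {x : Fin d → ℝ | N (x - z l) < r})
    (hD : D = ⋃ k, {x : Fin d → ℝ | N (x - z k) < r}) (hz : ∀ k, z k ∈ D) :
    sSup ((fun f => ∫ t in D, f t) '' {f | f ∈ FB d N D ∧ ∀ i, f (z i) = 0}) ≤
      coneDefect N D n r := by
  refine csSup_le (Set.Nonempty.image _ ⟨0, ?_, fun _ => rfl⟩) ?_
  · intro s _ t _
    simp
  rintro _ ⟨f, ⟨hf, hfz⟩, rfl⟩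
  rw [← setIntegral_sub_sum_cone_centers hN hD]
  refine (Real.le_norm_self _).trans (norm_integral_le_of_norm_le
    (integrableOn_sub_sum_cone hN (volume_ne_top_of_eq_iUnion hN hD) r z) ?_)
  refine ae_restrict_of_forall_mem (measurableSet_of_eq_iUnion hD) fun t ht => ?_
  obtain ⟨k, hk⟩ := Set.mem_iUnion.1 (hD ▸ ht)
  rw [sub_sum_cone_eq_of_mem_ball hdisj hk]
  exact abs_le_of_mem_FB hf (hz k) ht (hfz k)

theorem interr_eq_coneDefect (hn : 0 < n) (hN : ∀ x, N x = 0 → x = 0) (hr : 0 < r)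
    (hdisj : Pairwise fun k l =>
      Disjoint {x : Fin d → ℝ | N (x - z k) < r} {x : Fin d → ℝ | N (x - z l) < r})
    (hD : D = ⋃ k, {x : Fin d → ℝ | N (x - z k) < r}) :
    interr D (FB d N D) n = coneDefect N D n r := by
  have hz : ∀ k, z k ∈ D := fun k => hD ▸ Set.mem_iUnion.2 ⟨k, by simpa using hr⟩
  have : Nonempty (Fin n → D) := ⟨fun k => ⟨z k, hz k⟩⟩
  refine le_antisymm ((ciInf_le ?_ fun k => ⟨z k, hz k⟩).trans
    (sSup_centers_le hN hdisj hD hz)) (le_ciInf fun x => coneDefect_le_sSup hn hN hD x)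
  exact ⟨coneDefect N D n r, Set.forall_mem_range.2 fun x => coneDefect_le_sSup hn hN hD x⟩

end UnionOfBalls

theorem rpow_normalized_error_eq {d : ℕ} (hd : 0 < d) {V n r : ℝ} (hV : 0 < V) (hn : 0 < n)
    (hr : 0 < r) :
    V ^ (-(1 : ℝ) / d) * (n * (r ^ d * V)) ^ (((d : ℝ) + 1) / d) * n ^ (-(1 : ℝ) / d) =
      V * n * r ^ (d + 1) := by
  have hd' : (d : ℝ) ≠ 0 := by positivity
  have hexp : ((d : ℝ) + 1) / d = 1 + 1 / d := by field_simp
  have hroot : (r ^ d) ^ (1 / (d : ℝ)) = r := by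
    rw [one_div, Real.pow_rpow_inv_natCast hr.le hd.ne']
  have hVn : V ^ (1 / (d : ℝ)) ≠ 0 := (Real.rpow_pos_of_pos hV _).ne'
  have hnn : n ^ (1 / (d : ℝ)) ≠ 0 := (Real.rpow_pos_of_pos hn _).ne'
  rw [hexp, Real.rpow_add (by positivity), Real.rpow_one,
    Real.mul_rpow hn.le (by positivity), Real.mul_rpow (by positivity) hV.le, hroot,
    neg_div, Real.rpow_neg hV.le, Real.rpow_neg hn.le]
  field_simp
  ring

/-- The disjoint union of `n` equal `‖·‖_B`-balls of radius `r` attains the minimal possible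
normalized integration error:
`e(n, F^B(D)) = (d/(d+1)) λ(B)^{-1/d} λ(D)^{(d+1)/d} n^{-1/d} = (d/(d+1)) λ(B) n r^{d+1}`. -/
theorem lipschitz_integration_union_of_balls (d n : ℕ) (hd : 0 < d) (hn : 0 < n)
    (N : Seminorm ℝ (Fin d → ℝ)) (hN : ∀ x, N x = 0 → x = 0)
    (r : ℝ) (hr : 0 < r) (z : Fin n → Fin d → ℝ)
    (hdisj : Pairwise fun k l =>
      Disjoint {x : Fin d → ℝ | N (x - z k) < r} {x : Fin d → ℝ | N (x - z l) < r})
    (D : Set (Fin d → ℝ)) (hD : D = ⋃ k, {x : Fin d → ℝ | N (x - z k) < r}) :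
    interr D (FB d N D) n =
      (d : ℝ) / (d + 1) * (volume {x : Fin d → ℝ | N x ≤ 1}).toReal ^ (-(1 : ℝ) / d) *
        (volume D).toReal ^ (((d : ℝ) + 1) / d) * (n : ℝ) ^ (-(1 : ℝ) / d) ∧
    interr D (FB d N D) n =
      (d : ℝ) / (d + 1) * (volume {x : Fin d → ℝ | N x ≤ 1}).toReal * n * r ^ (d + 1) := by
  have : Nonempty (Fin d) := ⟨⟨0, hd⟩⟩
  have hvol := volumeReal_of_eq_iUnion hd hN hr.le hdisj hD
  have hcone := N.integral_cone volume hN hr.le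
  rw [Module.finrank_fin_fun] at hcone
  have hV : 0 < volume.real {x : Fin d → ℝ | N x ≤ 1} := by
    have hopen : IsOpen {x : Fin d → ℝ | N x < 1} :=
      isOpen_lt N.continuous_of_finiteDimensional continuous_const
    refine ENNReal.toReal_pos ((hopen.measure_pos volume ⟨0, by simp⟩).trans_le
      (measure_mono fun x (hx : N x < 1) => hx.le)).ne' ?_
    simpa using (N.isCompact_le hN 0 1).measure_lt_top.ne
  have hmain : interr D (FB d N D) n =
      (d : ℝ) / (d + 1) * (volume {x : Fin d → ℝ | N x ≤ 1}).toReal * n * r ^ (d + 1) := by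
    rw [interr_eq_coneDefect hn hN hr hdisj hD, coneDefect, hcone, hvol, Measure.real]
    field_simp
    ring
  refine ⟨?_, hmain⟩
  have hpow := rpow_normalized_error_eq hd hV (Nat.cast_pos.2 hn : (0 : ℝ) < n) hr
  rw [← hvol] at hpow
  simp only [Measure.real] at hpow
  rw [hmain]
  linear_combination -(d : ℝ) / (d + 1) * hpow
end

section
/- For every k ∈ ℕ there exists a constant c_k > 0 such that for all d, n ∈ ℕ and every open set D ⊂ ℝ^d with Lebesgue measure λ^d(D) = 1, e(n, F^k_d(D)) ≥ min{ 1/2 , c_k · d · n^{−k/d} }. -/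
open MeasureTheory

/-- Iterated partial derivative in coordinate direction `i`. -/
noncomputable def pderiv' (d : ℕ) (i : Fin d) (f : (Fin d → ℝ) → ℝ) : (Fin d → ℝ) → ℝ :=
  fun x => fderiv ℝ f x (Pi.single i 1)

/-- The partial derivative `D^α f` for a multi-index `α`. -/
noncomputable def mderiv (d : ℕ) (α : Fin d → ℕ) (f : (Fin d → ℝ) → ℝ) : (Fin d → ℝ) → ℝ :=
  ((List.finRange d).flatMap fun i => List.replicate (α i) i).foldr (pderiv' d) f

/-- The open unit cube `(0,1)^d`. -/
def unitCube (d : ℕ) : Set (Fin d → ℝ) := Set.univ.pi fun _ => Set.Ioo 0 1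

/-- The class `F^k_d(D)` of `C^k` functions with all partial derivatives of order `≤ k`
bounded by one on `D`. -/
def Fkd (k d : ℕ) (D : Set (Fin d → ℝ)) : Set ((Fin d → ℝ) → ℝ) :=
  { f | ContDiffOn ℝ k f D ∧
      ∀ α : Fin d → ℕ, (∑ i, α i) ≤ k → ∀ x ∈ D, |mderiv d α f x| ≤ 1 }

open scoped ContDiff Convolution

/-- A smooth nonnegative kernel of mass one supported in `(-r, r)`. The `L¹` norms of its
derivatives are bounded by powers of `M / r` with `M` independent of `r`. -/
structure IsKernel (k : ℕ) (M r : ℝ) (ψ : ℝ → ℝ) : Prop where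
  contDiff : ContDiff ℝ ∞ ψ
  nonneg : ∀ t, 0 ≤ ψ t
  integral_eq_one : ∫ t, ψ t = 1
  abs_lt_of_ne_zero : ∀ t, ψ t ≠ 0 → |t| < r
  integral_abs_iteratedDeriv_le :
    ∀ m ≤ k, ∫ t, |iteratedDeriv m ψ t| ≤ (M / r) ^ m

theorem exists_isKernel (k : ℕ) :
    ∃ M : ℝ, 1 ≤ M ∧ ∀ r : ℝ, 0 < r → ∃ ψ, IsKernel k M r ψ := by
  let b : ContDiffBump (0 : ℝ) := ⟨1 / 2, 1, by norm_num, by norm_num⟩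
  let φ : ℝ → ℝ := b.normed volume
  have hφ : ContDiff ℝ ∞ φ := b.contDiff_normed
  let A : ℕ → ℝ := fun m => ∫ t, |iteratedDeriv m φ t|
  have hA : ∀ m, 0 ≤ A m := fun m => integral_nonneg fun t => abs_nonneg _
  have hA0 : A 0 = 1 := by
    have : ∀ t, |φ t| = φ t := fun t => abs_of_nonneg (b.nonneg_normed t)
    simp only [A, iteratedDeriv_zero, this]
    exact b.integral_normed
  refine ⟨1 + ∑ m ∈ Finset.range (k + 1), A m, ?_, fun r hr => ?_⟩
  · linarith [Finset.sum_nonneg fun m (_ : m ∈ Finset.range (k + 1)) => hA m]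
  set M := 1 + ∑ m ∈ Finset.range (k + 1), A m
  have hM1 : 1 ≤ M := by
    linarith [Finset.sum_nonneg fun m (_ : m ∈ Finset.range (k + 1)) => hA m]
  have hAM : ∀ m ≤ k, A m ≤ M ^ m := by
    intro m hm
    rcases Nat.eq_zero_or_pos m with rfl | hpos
    · simp [hA0]
    · have h1 : A m ≤ ∑ m ∈ Finset.range (k + 1), A m :=
        Finset.single_le_sum (fun m _ => hA m) (Finset.mem_range.2 (by omega))
      exact (by linarith : A m ≤ M).trans (le_self_pow₀ hM1 hpos.ne')
  have hcomp : ContDiff ℝ ∞ (fun t => φ (r⁻¹ * t)) := by fun_prop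
  refine ⟨r⁻¹ • fun t => φ (r⁻¹ * t), ?_, ?_, ?_, ?_, ?_⟩
  · exact hcomp.const_smul (r⁻¹ : ℝ)
  · intro t
    exact mul_nonneg (inv_nonneg.2 hr.le) (b.nonneg_normed _)
  · simp only [Pi.smul_apply, integral_smul, Measure.integral_comp_mul_left]
    have : ∫ t, φ t = 1 := b.integral_normed
    simp [this, abs_of_pos hr, hr.ne']
  · intro t ht
    have h1 : r⁻¹ * t ∈ Function.support φ := by
      intro h
      apply ht
      simp [h]
    rw [b.support_normed_eq] at h1
    simp only [Metric.mem_ball, dist_zero_right, Real.norm_eq_abs, abs_mul, abs_inv,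
      abs_of_pos hr, b] at h1
    rw [inv_mul_lt_iff₀ hr] at h1
    simpa using h1
  · intro m hm
    have h1 : ∀ t, iteratedDeriv m (r⁻¹ • fun t => φ (r⁻¹ * t)) t
        = r⁻¹ * (r⁻¹ ^ m * iteratedDeriv m φ (r⁻¹ * t)) := by
      intro t
      have hcm : ContDiff ℝ m (fun t => φ (r⁻¹ * t)) :=
        hcomp.of_le (by exact_mod_cast le_top)
      have hm' : ContDiff ℝ m φ := hφ.of_le (by exact_mod_cast le_top)
      rw [iteratedDeriv_const_smul hcm.contDiffAt, iteratedDeriv_comp_const_mul hm' r⁻¹,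
        smul_eq_mul]
    have hr' : 0 < r⁻¹ := inv_pos.2 hr
    simp only [h1, abs_mul, abs_pow, abs_of_pos hr', integral_const_mul]
    rw [Measure.integral_comp_mul_left (fun t => |iteratedDeriv m φ t|), inv_inv, abs_of_pos hr,
      smul_eq_mul, div_pow]
    have : r⁻¹ * (r⁻¹ ^ m * (r * ∫ t, |iteratedDeriv m φ t|)) = A m / r ^ m := by
      
      rw [inv_pow]
      field_simp
      rfl
    rw [this]
    exact div_le_div_of_nonneg_right (hAM m hm) (pow_nonneg hr.le m)

theorem IsKernel.hasCompactSupport {k : ℕ} {M r : ℝ} {ψ : ℝ → ℝ} (h : IsKernel k M r ψ) :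
    HasCompactSupport ψ := by
  refine HasCompactSupport.intro (isCompact_closedBall (0 : ℝ) r) fun t ht => ?_
  by_contra hne
  exact ht (by simpa using (h.abs_lt_of_ne_zero t hne).le)

/-- Coordinate derivatives of a tensor product act factorwise. -/
theorem pderiv'_prod {d : ℕ} (i : Fin d) (g : Fin d → ℝ → ℝ) (hg : ∀ j, Differentiable ℝ (g j)) :
    pderiv' d i (fun x => ∏ j, g j (x j)) =
      fun x => ∏ j, Function.update g i (deriv (g i)) j (x j) := by
  funext x
  have hdiff : DifferentiableAt ℝ (fun x : Fin d → ℝ => ∏ j, g j (x j)) x := by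
    have h : ∀ j, DifferentiableAt ℝ (fun x : Fin d → ℝ => g j (x j)) x := fun j =>
      (hg j).differentiableAt.comp x (differentiableAt_apply (𝕜 := ℝ) j x)
    exact (HasFDerivAt.finsetProd fun j _ => (h j).hasFDerivAt).differentiableAt
  have hline := hdiff.hasFDerivAt.hasLineDerivAt (Pi.single i 1)
  have hprod : HasDerivAt (fun t : ℝ => g i (x i + t) * ∏ j ∈ Finset.univ.erase i, g j (x j))
      (deriv (g i) (x i) * ∏ j ∈ Finset.univ.erase i, g j (x j)) 0 := by
    refine HasDerivAt.mul_const ?_ _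
    have := (hg i (x i + 0)).hasDerivAt.comp_const_add (x i) 0
    simpa using this
  have hfun : (fun t : ℝ => ∏ j, g j ((x + t • Pi.single i (1 : ℝ) : Fin d → ℝ) j)) =
      fun t : ℝ => g i (x i + t) * ∏ j ∈ Finset.univ.erase i, g j (x j) := by
    funext t
    rw [← Finset.mul_prod_erase _ _ (Finset.mem_univ i)]
    congr 1
    · simp
    · refine Finset.prod_congr rfl fun j hj => ?_
      simp [Finset.ne_of_mem_erase hj]
  have huniq := HasDerivAt.unique (by simpa only [HasLineDerivAt, hfun] using hline) hprod
  rw [pderiv', huniq, ← Finset.mul_prod_erase _ _ (Finset.mem_univ i)]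
  congr 1
  · simp
  · refine Finset.prod_congr rfl fun j hj => ?_
    simp [Finset.ne_of_mem_erase hj]

theorem foldr_pderiv'_prod {d : ℕ} {ψ : ℝ → ℝ} (hψ : ContDiff ℝ ∞ ψ) (l : List (Fin d)) :
    l.foldr (pderiv' d) (fun x => ∏ j, ψ (x j)) =
      fun x => ∏ j, iteratedDeriv (l.count j) ψ (x j) := by
  induction l with
  | nil => simp
  | cons i l ih =>
    rw [List.foldr_cons, ih, pderiv'_prod]
    · funext x
      refine Finset.prod_congr rfl fun j _ => ?_
      rcases eq_or_ne j i with rfl | hne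
      · simp [iteratedDeriv_succ]
      · rw [Function.update_of_ne hne, List.count_cons_of_ne hne.symm]
    · intro j
      exact hψ.differentiable_iteratedDeriv _ (by exact_mod_cast WithTop.coe_lt_top _)

theorem ContDiff.pderiv' {d : ℕ} {f : (Fin d → ℝ) → ℝ} (hf : ContDiff ℝ ∞ f) (i : Fin d) :
    ContDiff ℝ ∞ (pderiv' d i f) :=
  (hf.fderiv_right (m := ∞) (by simp)).clm_apply contDiff_const

theorem HasCompactSupport.pderiv' {d : ℕ} {f : (Fin d → ℝ) → ℝ} (hf : HasCompactSupport f)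
    (i : Fin d) : HasCompactSupport (pderiv' d i f) :=
  hf.fderiv_apply ℝ _

theorem contDiff_foldr_pderiv' {d : ℕ} {f : (Fin d → ℝ) → ℝ} (hf : ContDiff ℝ ∞ f)
    (l : List (Fin d)) : ContDiff ℝ ∞ (l.foldr (pderiv' d) f) := by
  induction l with
  | nil => exact hf
  | cons i l ih => exact ih.pderiv' i

theorem hasCompactSupport_foldr_pderiv' {d : ℕ} {f : (Fin d → ℝ) → ℝ} (hf : HasCompactSupport f)
    (l : List (Fin d)) : HasCompactSupport (l.foldr (pderiv' d) f) := by
  induction l with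
  | nil => exact hf
  | cons i l ih => exact ih.pderiv' i

theorem pderiv'_convolution {d : ℕ} {f g : (Fin d → ℝ) → ℝ} (hf : Continuous f)
    (hg : ContDiff ℝ ∞ g) (hgc : HasCompactSupport g) (i : Fin d) :
    pderiv' d i (f ⋆[ContinuousLinearMap.mul ℝ ℝ, volume] g) =
      f ⋆[ContinuousLinearMap.mul ℝ ℝ, volume] pderiv' d i g := by
  funext x
  have hf' : LocallyIntegrable f volume := hf.locallyIntegrable
  have hg1 : ContDiff ℝ 1 g := hg.of_le (by exact_mod_cast le_top)
  rw [pderiv', (hgc.hasFDerivAt_convolution_right _ hf' hg1 x).fderiv]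
  exact convolution_precompR_apply _ hf' (hgc.fderiv ℝ) (hg1.continuous_fderiv (by simp)) x _

theorem foldr_pderiv'_convolution {d : ℕ} {f g : (Fin d → ℝ) → ℝ} (hf : Continuous f)
    (hg : ContDiff ℝ ∞ g) (hgc : HasCompactSupport g) (l : List (Fin d)) :
    l.foldr (pderiv' d) (f ⋆[ContinuousLinearMap.mul ℝ ℝ, volume] g) =
      f ⋆[ContinuousLinearMap.mul ℝ ℝ, volume] l.foldr (pderiv' d) g := by
  induction l with
  | nil => rfl
  | cons i l ih =>
    rw [List.foldr_cons, List.foldr_cons, ih, pderiv'_convolution hf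
      (contDiff_foldr_pderiv' hg l) (hasCompactSupport_foldr_pderiv' hgc l)]

/-- Convolving with an integrable kernel multiplies the Lipschitz constant in each coordinate
direction by the `L¹` norm of the kernel. -/
theorem abs_pderiv'_convolution_le {d : ℕ} {f g : (Fin d → ℝ) → ℝ} {L : ℝ} (hf : Continuous f)
    (hL : 0 ≤ L) (i : Fin d) (hlip : ∀ x (s : ℝ), |f (x + s • Pi.single i 1) - f x| ≤ L * |s|)
    (hg : ContDiff ℝ ∞ g) (hgc : HasCompactSupport g) (x : Fin d → ℝ) :
    |pderiv' d i (f ⋆[ContinuousLinearMap.mul ℝ ℝ, volume] g) x| ≤ L * ∫ t, |g t| := by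
  have hg1 : ContDiff ℝ 1 g := hg.of_le (by exact_mod_cast le_top)
  have hline := (hgc.hasFDerivAt_convolution_right (ContinuousLinearMap.mul ℝ ℝ)
    (hf.locallyIntegrable (μ := volume)) hg1 x).differentiableAt.hasFDerivAt.hasLineDerivAt
      (Pi.single i 1)
  have hint : ∀ y, Integrable (fun t => f (y - t) * g t) := fun y =>
    ((hf.comp (continuous_const.sub continuous_id)).mul hg.continuous).integrable_of_hasCompactSupport
      hgc.mul_left
  have hgi : Integrable (fun t => |g t|) :=
    (hg.continuous.integrable_of_hasCompactSupport hgc).abs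
  refine HasDerivAt.le_of_lip' hline
    (mul_nonneg hL (integral_nonneg fun t => abs_nonneg _)) (Filter.Eventually.of_forall fun s => ?_)
  simp only [convolution_eq_swap, ContinuousLinearMap.mul_apply', zero_smul, add_zero, sub_zero,
    Real.norm_eq_abs]
  rw [← integral_sub (hint _) (hint _)]
  rw [← Real.norm_eq_abs]
  calc ‖∫ t, (f (x + s • Pi.single i 1 - t) * g t - f (x - t) * g t)‖
      ≤ ∫ t, L * |s| * |g t| := by
        refine norm_integral_le_of_norm_le (hgi.const_mul _)
          (Filter.Eventually.of_forall fun t => ?_)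
        have h1 := hlip (x - t) s
        rw [Real.norm_eq_abs, ← sub_mul, abs_mul, add_sub_right_comm]
        exact mul_le_mul_of_nonneg_right h1 (abs_nonneg _)
    _ = L * (∫ t, |g t|) * |s| := by rw [integral_const_mul]; ring

theorem IsKernel.hasCompactSupport_prod {k d : ℕ} {M r : ℝ} {ψ : ℝ → ℝ} (h : IsKernel k M r ψ) :
    HasCompactSupport (fun x : Fin d → ℝ => ∏ j, ψ (x j)) := by
  refine HasCompactSupport.intro
    (isCompact_univ_pi fun _ : Fin d => isCompact_closedBall (0 : ℝ) r) fun x hx => ?_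
  by_contra hne
  refine hx fun j _ => ?_
  simpa using (h.abs_lt_of_ne_zero _ (Finset.prod_ne_zero_iff.1 hne j (Finset.mem_univ j))).le

theorem IsKernel.contDiff_prod {k d : ℕ} {M r : ℝ} {ψ : ℝ → ℝ} (h : IsKernel k M r ψ) :
    ContDiff ℝ ∞ (fun x : Fin d → ℝ => ∏ j, ψ (x j)) :=
  _root_.contDiff_prod fun j _ => h.contDiff.comp (contDiff_apply ℝ ℝ j)

theorem IsKernel.integral_prod {k d : ℕ} {M r : ℝ} {ψ : ℝ → ℝ} (h : IsKernel k M r ψ) :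
    ∫ x : Fin d → ℝ, ∏ j, ψ (x j) = 1 := by
  rw [integral_fintype_prod_volume_eq_prod (fun _ => ψ)]
  simp [h.integral_eq_one]

theorem IsKernel.integral_abs_foldr_pderiv'_le {k d : ℕ} {M r : ℝ} {ψ : ℝ → ℝ}
    (h : IsKernel k M r ψ) (l : List (Fin d)) (hl : l.length ≤ k) :
    ∫ x, |l.foldr (pderiv' d) (fun x => ∏ j, ψ (x j)) x| ≤ (M / r) ^ l.length := by
  simp only [foldr_pderiv'_prod h.contDiff, Finset.abs_prod]
  rw [integral_fintype_prod_volume_eq_prod (fun j t => |iteratedDeriv (l.count j) ψ t|)]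
  have hsum : ∑ j, l.count j = l.length := by
    simpa using (Multiset.sum_count_eq_card (s := Finset.univ) (m := (l : Multiset (Fin d)))
      (fun a _ => Finset.mem_univ a))
  rw [← hsum, ← Finset.prod_pow_eq_pow_sum]
  exact Finset.prod_le_prod (fun j _ => integral_nonneg fun t => abs_nonneg _)
    fun j _ => h.integral_abs_iteratedDeriv_le _ (List.count_le_length.trans hl)

theorem length_flatMap_replicate {d : ℕ} (α : Fin d → ℕ) :
    ((List.finRange d).flatMap fun i => List.replicate (α i) i).length = ∑ i, α i := by
  simp [List.length_flatMap, Fin.sum_univ_def]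

/-- A function with small Lipschitz constants, smoothed by a product kernel, lies in `Fkd`. -/
theorem convolution_mem_Fkd {k d : ℕ} {M r : ℝ} {ψ : ℝ → ℝ} (h : IsKernel k M r ψ)
    (hr : 0 < r) (hrM : r ≤ M) {f : (Fin d → ℝ) → ℝ} (hf : Continuous f) (hf1 : ∀ x, |f x| ≤ 1)
    (hlip : ∀ i x (s : ℝ), |f (x + s • Pi.single i 1) - f x| ≤ (r / M) ^ (k - 1) * |s|)
    (D : Set (Fin d → ℝ)) :
    (f ⋆[ContinuousLinearMap.mul ℝ ℝ, volume] fun x => ∏ j, ψ (x j)) ∈ Fkd k d D := by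
  have hM : 0 < M := hr.trans_le hrM
  have hg := h.contDiff_prod (d := d)
  have hgc := h.hasCompactSupport_prod (d := d)
  constructor
  · have : ContDiff ℝ (k : ℕ∞)
        (f ⋆[ContinuousLinearMap.mul ℝ ℝ, volume] fun x => ∏ j, ψ (x j)) :=
      hgc.contDiff_convolution_right _ hf.locallyIntegrable (hg.of_le (by exact_mod_cast le_top))
    exact this.contDiffOn
  · intro α hα x _
    rw [← length_flatMap_replicate] at hα
    rw [mderiv]
    generalize (List.finRange d).flatMap (fun i => List.replicate (α i) i) = l at hα
    cases l with
    | nil =>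
      rw [List.foldr_nil, convolution_eq_swap]
      have hnn : ∀ t : Fin d → ℝ, 0 ≤ ∏ j, ψ (t j) :=
        fun t => Finset.prod_nonneg fun j _ => h.nonneg _
      rw [← h.integral_prod (d := d), ← Real.norm_eq_abs]
      refine norm_integral_le_of_norm_le
        (hg.continuous.integrable_of_hasCompactSupport hgc) (Filter.Eventually.of_forall fun t => ?_)
      simp only [ContinuousLinearMap.mul_apply', norm_mul, Real.norm_eq_abs, abs_of_nonneg (hnn t)]
      exact mul_le_of_le_one_left (hnn t) (hf1 _)
    | cons i l =>
      simp only [List.length_cons] at hα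
      rw [List.foldr_cons, foldr_pderiv'_convolution hf hg hgc]
      refine (abs_pderiv'_convolution_le hf (by positivity) i (hlip i)
        (contDiff_foldr_pderiv' hg l) (hasCompactSupport_foldr_pderiv' hgc l) x).trans ?_
      calc (r / M) ^ (k - 1) * ∫ t, |l.foldr (pderiv' d) (fun x => ∏ j, ψ (x j)) t|
          ≤ (r / M) ^ l.length * (M / r) ^ l.length := by
            refine mul_le_mul ?_ (h.integral_abs_foldr_pderiv'_le l (by omega))
              (integral_nonneg fun t => abs_nonneg _) (by positivity)
            exact pow_le_pow_of_le_one (by positivity) ((div_le_one hM).2 hrM) (by omega)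
        _ = 1 := by
            rw [← mul_pow, div_mul_div_cancel₀ hM.ne', div_self hr.ne', one_pow]

/-- Convolution with a product kernel of width `r` only sees the `ℓ¹` ball of radius `d * r`. -/
theorem convolution_eq_of_eqOn_ball {k d : ℕ} {M r : ℝ} {ψ : ℝ → ℝ} (h : IsKernel k M r ψ)
    {f : (Fin d → ℝ) → ℝ} {x : Fin d → ℝ} {v : ℝ}
    (hv : ∀ y, ∑ j, |x j - y j| ≤ d * r → f y = v) :
    (f ⋆[ContinuousLinearMap.mul ℝ ℝ, volume] fun x => ∏ j, ψ (x j)) x = v := by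
  rw [convolution_eq_swap]
  have : ∀ t : Fin d → ℝ, (ContinuousLinearMap.mul ℝ ℝ (f (x - t))) (∏ j, ψ (t j)) =
      v * ∏ j, ψ (t j) := by
    intro t
    by_cases ht : ∏ j, ψ (t j) = 0
    · simp [ht]
    · rw [ContinuousLinearMap.mul_apply', hv]
      have : ∀ j ∈ Finset.univ, |x j - (x - t) j| ≤ r := fun j _ => by
        simpa using (h.abs_lt_of_ne_zero _ (Finset.prod_ne_zero_iff.1 ht j (Finset.mem_univ j))).le
      simpa using Finset.sum_le_sum this
  simp only [this, integral_const_mul, h.integral_prod, mul_one]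

theorem convolution_nonneg {k d : ℕ} {M r : ℝ} {ψ : ℝ → ℝ} (h : IsKernel k M r ψ)
    {f : (Fin d → ℝ) → ℝ} (hf : ∀ x, 0 ≤ f x) (x : Fin d → ℝ) :
    0 ≤ (f ⋆[ContinuousLinearMap.mul ℝ ℝ, volume] fun x => ∏ j, ψ (x j)) x :=
  integral_nonneg fun t => mul_nonneg (hf t) (Finset.prod_nonneg fun _ _ => h.nonneg _)

/-- A truncated and rescaled `ℓ¹` distance to finitely many points, vanishing near them. -/
theorem exists_truncated_dist {d n : ℕ} (hn : 0 < n) (p : Fin n → Fin d → ℝ) {a R V : ℝ}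
    (ha : 0 ≤ a) (hV : 0 ≤ V) (hVR : V ≤ a * R) :
    ∃ f : (Fin d → ℝ) → ℝ, Continuous f ∧ (∀ x, 0 ≤ f x) ∧ (∀ x, f x ≤ V) ∧
      (∀ j x (s : ℝ), |f (x + s • Pi.single j 1) - f x| ≤ a * |s|) ∧
      (∀ i x, ∑ j, |p i j - x j| ≤ R → f x = 0) ∧
      (∀ x, (∀ i, 2 * R ≤ ∑ j, |p i j - x j|) → f x = V) := by
  have hne : (Finset.univ : Finset (Fin n)).Nonempty := ⟨⟨0, hn⟩, Finset.mem_univ _⟩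
  let g : Fin n → (Fin d → ℝ) → ℝ := fun i x => min V (max 0 (a * (∑ j, |p i j - x j| - R)))
  have hg0 : ∀ i x, 0 ≤ g i x := fun i x => le_min hV (le_max_left _ _)
  have hgV : ∀ i x, g i x ≤ V := fun i x => min_le_left _ _
  have hgc : ∀ i, Continuous (g i) := fun i => by fun_prop
  have hglip : ∀ i x y, g i y ≤ g i x + a * ∑ j, |y j - x j| := by
    intro i x y
    have htri : ∑ j, |p i j - y j| ≤ ∑ j, |p i j - x j| + ∑ j, |y j - x j| := by
      rw [← Finset.sum_add_distrib]
      refine Finset.sum_le_sum fun j _ => ?_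
      rw [abs_sub_comm (y j)]
      exact abs_sub_le _ _ _
    have hS : 0 ≤ a * ∑ j, |y j - x j| :=
      mul_nonneg ha (Finset.sum_nonneg fun j _ => abs_nonneg _)
    have h2 := mul_le_mul_of_nonneg_left htri ha
    simp only [g]
    rw [← min_add_add_right, ← max_add_add_right]
    refine min_le_min (by linarith) (max_le_max (by linarith) (by linarith))
  let f : (Fin d → ℝ) → ℝ := fun x => Finset.univ.inf' hne fun i => g i x
  have hf0 : ∀ x, 0 ≤ f x := fun x => Finset.le_inf' hne _ fun i _ => hg0 i x
  have hfg : ∀ i x, f x ≤ g i x := fun i x => Finset.inf'_le _ (Finset.mem_univ i)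
  have hflip : ∀ x y, f y ≤ f x + a * ∑ j, |y j - x j| := by
    intro x y
    obtain ⟨i, -, hi⟩ := Finset.exists_mem_eq_inf' hne fun i => g i x
    have : f x = g i x := hi
    rw [this]
    exact (hfg i y).trans (hglip i x y)
  refine ⟨f, Continuous.finset_inf'_apply hne fun i _ => hgc i, hf0,
    fun x => (hfg ⟨0, hn⟩ x).trans (hgV _ x), ?_, ?_, ?_⟩
  · intro i x s
    have hs : ∑ j, |(x + s • Pi.single i (1 : ℝ) : Fin d → ℝ) j - x j| = |s| := by
      rw [Finset.sum_eq_single i] <;> simp +contextual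
    have hs' : ∑ j, |x j - (x + s • Pi.single i (1 : ℝ) : Fin d → ℝ) j| = |s| := by
      rw [← hs]
      exact Finset.sum_congr rfl fun j _ => abs_sub_comm _ _
    have h1 := hflip x (x + s • Pi.single i (1 : ℝ))
    have h2 := hflip (x + s • Pi.single i (1 : ℝ)) x
    rw [hs] at h1
    rw [hs'] at h2
    rw [abs_le]
    constructor <;> linarith
  · intro i x hx
    refine le_antisymm ((hfg i x).trans ?_) (hf0 x)
    refine (min_le_right _ _).trans (max_le le_rfl ?_)
    exact mul_nonpos_of_nonneg_of_nonpos ha (by linarith)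
  · intro x hx
    refine le_antisymm ((hfg ⟨0, hn⟩ x).trans (hgV _ x)) (Finset.le_inf' hne _ fun i _ => ?_)
    refine le_min le_rfl (le_max_of_le_right (hVR.trans ?_))
    exact mul_le_mul_of_nonneg_left (by linarith [hx i]) ha

/-- The `ℓ¹` ball of radius `d * ρ` has volume at most `(6 * ρ) ^ d`. -/
theorem volume_l1_ball_le {d : ℕ} (hd : 0 < d) (p : Fin d → ℝ) {ρ : ℝ} (hρ : 0 ≤ ρ) :
    volume {x : Fin d → ℝ | ∑ j, |p j - x j| < d * ρ} ≤ ENNReal.ofReal ((6 * ρ) ^ d) := by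
  have : Nonempty (Fin d) := ⟨⟨0, hd⟩⟩
  have hvol := volume_sum_rpow_lt (Fin d) le_rfl (d * ρ)
  have hset : {x : Fin d → ℝ | ∑ j, |p j - x j| < d * ρ} =
      (fun x => p - x) ⁻¹' {x : Fin d → ℝ | (∑ i, |x i| ^ (1 : ℝ)) ^ (1 / (1 : ℝ)) < d * ρ} := by
    ext x; simp
  have hmeas : MeasurableSet
      {x : Fin d → ℝ | (∑ i, |x i| ^ (1 : ℝ)) ^ (1 / (1 : ℝ)) < d * ρ} := by
    refine (isOpen_lt ?_ continuous_const).measurableSet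
    simp only [Real.rpow_one, div_one]
    fun_prop
  have hmp : MeasurePreserving (fun x : Fin d → ℝ => p - x) volume volume :=
    Measure.measurePreserving_sub_left volume p
  rw [hset, hmp.measure_preimage hmeas.nullMeasurableSet, hvol,
    ← ENNReal.ofReal_pow (by positivity), ← ENNReal.ofReal_mul (by positivity)]
  refine ENNReal.ofReal_le_ofReal ?_
  have hG : Real.Gamma (1 / 1 + 1) = 1 := by norm_num [Real.Gamma_two]
  rw [hG, div_one, Fintype.card_fin, Real.Gamma_nat_eq_factorial, mul_one]
  have he : (d : ℝ) ^ d / d.factorial ≤ 3 ^ d := by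
    refine (Real.pow_div_factorial_le_exp d (Nat.cast_nonneg d) d).trans ?_
    rw [← Real.exp_one_pow]
    exact pow_le_pow_left₀ (Real.exp_pos 1).le Real.exp_one_lt_three.le d
  calc (d * ρ) ^ d * (2 ^ d / d.factorial) = ((d : ℝ) ^ d / d.factorial) * (2 * ρ) ^ d := by
        rw [mul_pow, mul_pow]; ring
    _ ≤ 3 ^ d * (2 * ρ) ^ d := mul_le_mul_of_nonneg_right he (by positivity)
    _ = (6 * ρ) ^ d := by rw [← mul_pow]; ring

theorem abs_le_one_of_mem_Fkd {k d : ℕ} {D : Set (Fin d → ℝ)} {f : (Fin d → ℝ) → ℝ}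
    (hf : f ∈ Fkd k d D) {x : Fin d → ℝ} (hx : x ∈ D) : |f x| ≤ 1 := by
  have hnil : (List.finRange d).flatMap (fun i => List.replicate ((0 : Fin d → ℕ) i) i) = [] := by
    rw [List.flatMap_eq_nil_iff]
    simp
  have h := hf.2 0 (by simp) x hx
  rwa [mderiv, hnil] at h

theorem abs_setIntegral_le_one_of_mem_Fkd {k d : ℕ} {D : Set (Fin d → ℝ)} (hD : volume D = 1)
    {f : (Fin d → ℝ) → ℝ} (hf : f ∈ Fkd k d D) : |∫ t in D, f t| ≤ 1 := by
  have h1 : ∀ x ∈ D, ‖f x‖ ≤ 1 := fun x hx => abs_le_one_of_mem_Fkd hf hx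
  have := norm_setIntegral_le_of_norm_le_const (μ := volume) (by simp [hD]) h1
  simpa [Measure.real, hD] using this

theorem half_le_setIntegral {d : ℕ} {D U : Set (Fin d → ℝ)} (hD : volume D = 1)
    (hDm : MeasurableSet D) (hU : MeasurableSet U) (hUv : volume U ≤ ENNReal.ofReal (1 / 2))
    {f : (Fin d → ℝ) → ℝ} (hfi : IntegrableOn f D) (hf : ∀ x, 0 ≤ f x) {V : ℝ} (hV : 0 ≤ V)
    (hfV : ∀ x ∉ U, f x = V) : V / 2 ≤ ∫ t in D, f t := by
  have h1 : ∫ t in D \ U, f t ≤ ∫ t in D, f t :=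
    setIntegral_mono_set hfi (Filter.Eventually.of_forall hf)
      (Filter.Eventually.of_forall Set.sdiff_subset)
  have h2 : ∫ t in D \ U, f t = volume.real (D \ U) * V := by
    rw [setIntegral_congr_fun (hDm.diff hU) (fun x hx => hfV x hx.2), setIntegral_const,
      smul_eq_mul]
  have h3 : 1 / 2 ≤ volume.real (D \ U) := by
    have hle := le_measureReal_sdiff (μ := volume) (s₁ := D) (s₂ := U) 
      (h := ne_top_of_le_ne_top ENNReal.ofReal_ne_top hUv)
    have hDr : volume.real D = 1 := by simp [Measure.real, hD]
    have hUr : volume.real U ≤ 1 / 2 := ENNReal.toReal_le_of_le_ofReal (by norm_num) hUv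
    linarith
  rw [h2] at h1
  nlinarith

/-- Uniform lower bound over all normalized open domains: for every `k` there is `c_k > 0`
such that `e(n, F^k_d(D)) ≥ min(1/2, c_k · d · n^{-k/d})` for all `d, n ≥ 1` and every open
`D ⊂ ℝ^d` with `λ^d(D) = 1`. -/
theorem lower_bound_Fkd_general_domain (k : ℕ) (hk : 0 < k) :
    ∃ c : ℝ, 0 < c ∧ ∀ d n : ℕ, 0 < d → 0 < n →
      ∀ D : Set (Fin d → ℝ), IsOpen D → volume D = 1 →
        min (1 / 2) (c * d * (n : ℝ) ^ (-(k : ℝ) / d)) ≤ interr D (Fkd k d D) n := by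
  obtain ⟨M, hM1, hM⟩ := exists_isKernel k
  have hM0 : 0 < M := by linarith
  refine ⟨1 / (2 * 36 ^ k * M ^ (k - 1)), by positivity, fun d n hd hn D hDo hD => ?_⟩
  have hd' : (0 : ℝ) < d := by exact_mod_cast hd
  have hn' : (0 : ℝ) < n := by exact_mod_cast hn
  set q : ℝ := (n : ℝ) ^ (-(1 : ℝ) / d) with hq
  have hq0 : 0 < q := Real.rpow_pos_of_pos hn' _
  have hq1 : q ≤ 1 := by
    refine Real.rpow_le_one_of_one_le_of_nonpos (by exact_mod_cast hn) ?_
    exact div_nonpos_of_nonpos_of_nonneg (by norm_num) hd'.le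
  have hqk : (n : ℝ) ^ (-(k : ℝ) / d) = q ^ k := by
    rw [hq, ← Real.rpow_natCast, ← Real.rpow_mul hn'.le]
    congr 1
    ring
  have hqd : n * q ^ d = 1 := by
    rw [hq, ← Real.rpow_natCast, ← Real.rpow_mul hn'.le, div_mul_cancel₀ _ hd'.ne',
      Real.rpow_neg_one, mul_inv_cancel₀ hn'.ne']
  set r : ℝ := q / 36 with hr
  have hr0 : 0 < r := by positivity
  have hrM : r ≤ M := by linarith
  obtain ⟨ψ, hψ⟩ := hM r hr0
  set a : ℝ := (r / M) ^ (k - 1) with ha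
  have ha0 : 0 < a := by positivity
  set V : ℝ := min 1 (a * (d * r)) with hV
  have hV0 : 0 ≤ V := le_min zero_le_one (by positivity)
  have hVval : min (1 / 2) (1 / (2 * 36 ^ k * M ^ (k - 1)) * d * (n : ℝ) ^ (-(k : ℝ) / d))
      = V / 2 := by
    rw [hV, ← min_div_div_right zero_le_two, hqk]
    congr 1
    obtain ⟨m, rfl⟩ : ∃ m, k = m + 1 := ⟨k - 1, by omega⟩
    rw [ha, hr, Nat.add_sub_cancel, div_pow, div_pow]
    field_simp
    ring
  rw [hVval]
  have hDne : D.Nonempty := nonempty_of_measure_ne_zero (μ := volume) (by simp [hD])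
  have : Nonempty (Fin n → D) := ⟨fun _ => ⟨hDne.some, hDne.some_mem⟩⟩
  refine le_ciInf fun x => ?_
  obtain ⟨f, hfc, hf0, hfV, hflip, hfnear, hffar⟩ :=
    exists_truncated_dist hn (fun i => (x i : Fin d → ℝ)) ha0.le hV0 (min_le_right 1 (a * (d * r)))
  have hf1 : ∀ y, |f y| ≤ 1 := fun y => by
    rw [abs_of_nonneg (hf0 y)]
    exact (hfV y).trans (min_le_left _ _)
  set F := f ⋆[ContinuousLinearMap.mul ℝ ℝ, volume] fun y : Fin d → ℝ => ∏ j, ψ (y j)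
  have hFmem : F ∈ Fkd k d D := convolution_mem_Fkd hψ hr0 hrM hfc hf1 hflip D
  have hFx : ∀ i, F (x i) = 0 := fun i => convolution_eq_of_eqOn_ball hψ fun y hy => hfnear i y hy
  let U : Set (Fin d → ℝ) := ⋃ i, {y | ∑ j, |(x i : Fin d → ℝ) j - y j| < d * (3 * r)}
  have hU : MeasurableSet U := by
    refine MeasurableSet.iUnion fun i => (isOpen_lt ?_ continuous_const).measurableSet
    fun_prop
  have hUv : volume U ≤ ENNReal.ofReal (1 / 2) := by
    refine (measure_iUnion_fintype_le _ _).trans ((Finset.sum_le_sum fun i _ =>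
      volume_l1_ball_le hd (x i) (by positivity : 0 ≤ 3 * r)).trans ?_)
    rw [Finset.sum_const, Finset.card_univ, Fintype.card_fin, nsmul_eq_mul,
      ← ENNReal.ofReal_natCast, ← ENNReal.ofReal_mul hn'.le]
    refine ENNReal.ofReal_le_ofReal ?_
    have : 6 * (3 * r) = q * (1 / 2) := by rw [hr]; ring
    rw [this, mul_pow, ← mul_assoc, hqd, one_mul]
    exact pow_le_of_le_one (by norm_num) (by norm_num) hd.ne'
  have hFU : ∀ y ∉ U, F y = V := by
    intro y hy
    refine convolution_eq_of_eqOn_ball hψ fun z hz => hffar z fun i => ?_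
    have h1 : d * (3 * r) ≤ ∑ j, |(x i : Fin d → ℝ) j - y j| := by
      by_contra hlt
      exact hy (Set.mem_iUnion.2 ⟨i, not_le.1 hlt⟩)
    have h2 : ∑ j, |(x i : Fin d → ℝ) j - y j| ≤
        ∑ j, |(x i : Fin d → ℝ) j - z j| + ∑ j, |y j - z j| := by
      rw [← Finset.sum_add_distrib]
      refine Finset.sum_le_sum fun j _ => ?_
      rw [abs_sub_comm (y j)]
      exact abs_sub_le _ _ _
    linarith
  have hFi : IntegrableOn F D := by
    refine IntegrableOn.of_bound (C := 1) (by simp [hD])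
      (hFmem.1.continuousOn.aestronglyMeasurable hDo.measurableSet) ?_
    refine (ae_restrict_iff' hDo.measurableSet).2 (Filter.Eventually.of_forall fun y hy => ?_)
    exact abs_le_one_of_mem_Fkd hFmem hy
  refine (half_le_setIntegral hD hDo.measurableSet hU hUv hFi
    (convolution_nonneg hψ hf0) hV0 hFU).trans ?_
  refine le_csSup ⟨1, ?_⟩ ⟨F, ⟨hFmem, hFx⟩, rfl⟩
  rintro _ ⟨g, ⟨hg, -⟩, rfl⟩
  exact (le_abs_self _).trans (abs_setIntegral_le_one_of_mem_Fkd hD hg)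
end

section
/- Let n ∈ ℕ and let A_n(f) = (1/n) Σ_{i=1}^n f((2i−1)/(2n)) be the n-point midpoint rule on [0,1]. Then sup{ | ∫₀¹ f(x) dx − A_n(f) | : f ∈ F¹₁ } = 1/(4n), and the midpoint rule is optimal: e(n, F¹₁) = 1/(4n). -/
open MeasureTheory

/-- The class `F¹₁`: differentiable functions on `(0,1)` with `‖f‖_∞ ≤ 1` and `‖f'‖_∞ ≤ 1`. -/
def F11 : Set (ℝ → ℝ) :=
  { f | ∀ x ∈ Set.Ioo (0 : ℝ) 1,
      |f x| ≤ 1 ∧ DifferentiableAt ℝ f x ∧ |deriv f x| ≤ 1 }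

/-- The `n`-th minimal worst-case error of numerical integration on the class `F` over
`D ⊂ ℝ`. -/
noncomputable def interr1 (D : Set ℝ) (F : Set (ℝ → ℝ)) (n : ℕ) : ℝ :=
  ⨅ x : Fin n → D, sSup ((fun f => ∫ t in D, f t) ''
    {f | f ∈ F ∧ ∀ i, f ((x i : ℝ)) = 0})

/-- The error of the `n`-point midpoint rule for `f` on `(0,1)`. -/
noncomputable def midpointErr (n : ℕ) (f : ℝ → ℝ) : ℝ :=
  (∫ x in Set.Ioo (0 : ℝ) 1, f x) -
    (1 / n) * ∑ i : Fin n, f ((2 * (i : ℝ) + 1) / (2 * n))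

theorem integral_abs_sub_center (m : ℝ) {h : ℝ} (hh : 0 ≤ h) :
    ∫ x in (m - h)..(m + h), |x - m| = h ^ 2 := by
  rw [intervalIntegral.integral_comp_sub_right (fun x => |x|) m,
    show m - h - m = -h by ring, show m + h - m = h by ring,
    ← intervalIntegral.integral_add_adjacent_intervals (b := 0)
      (continuous_abs.intervalIntegrable _ _) (continuous_abs.intervalIntegrable _ _)]
  have h1 : ∫ x in (-h)..0, |x| = ∫ x in (-h)..0, -x :=
    intervalIntegral.integral_congr fun x hx => by
      rw [Set.uIcc_of_le (by linarith)] at hx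
      exact abs_of_nonpos hx.2
  have h2 : ∫ x in (0)..h, |x| = ∫ x in (0)..h, x :=
    intervalIntegral.integral_congr fun x hx => by
      rw [Set.uIcc_of_le hh] at hx
      exact abs_of_nonneg hx.1
  rw [h1, h2, intervalIntegral.integral_neg, integral_id, integral_id]
  ring

theorem abs_sub_le_of_mem_F11 {f : ℝ → ℝ} (hf : f ∈ F11) {x y : ℝ} (hx : x ∈ Set.Ioo (0 : ℝ) 1)
    (hy : y ∈ Set.Ioo (0 : ℝ) 1) : |f x - f y| ≤ |x - y| := by
  have := (convex_Ioo (0 : ℝ) 1).norm_image_sub_le_of_norm_deriv_le (C := 1)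
    (fun z hz => (hf z hz).2.1) (fun z hz => (hf z hz).2.2) hy hx
  simpa using this

theorem integrableOn_of_mem_F11 {f : ℝ → ℝ} (hf : f ∈ F11) : IntegrableOn f (Set.Ioo 0 1) := by
  have hc : ContinuousOn f (Set.Ioo 0 1) := fun z hz =>
    (hf z hz).2.1.continuousAt.continuousWithinAt
  refine IntegrableOn.of_bound (by simp) (hc.aestronglyMeasurable measurableSet_Ioo) 1 ?_
  exact (ae_restrict_iff' measurableSet_Ioo).2 (.of_forall fun z hz => (hf z hz).1)

theorem integral_le_one_of_mem_F11 {f : ℝ → ℝ} (hf : f ∈ F11) :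
    ∫ t in Set.Ioo (0 : ℝ) 1, f t ≤ 1 := by
  have := setIntegral_mono_on (integrableOn_of_mem_F11 hf)
    (integrableOn_const (C := (1 : ℝ)) (by simp))
    measurableSet_Ioo fun z hz => (abs_le.1 (hf z hz).1).2
  simpa using this

theorem midpoint_mem_Ioo {n : ℕ} (hn : 0 < n) {k : ℕ} (hk : k < n) :
    (2 * (k : ℝ) + 1) / (2 * n) ∈ Set.Ioo (0 : ℝ) 1 := by
  have hn' : (0 : ℝ) < n := by exact_mod_cast hn
  have hk' : (k : ℝ) + 1 ≤ n := by exact_mod_cast hk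
  refine ⟨by positivity, ?_⟩
  rw [div_lt_one (by positivity)]
  linarith

theorem abs_integral_sub_center_le {f : ℝ → ℝ} {m h : ℝ} (hh : 0 ≤ h)
    (hi : IntervalIntegrable f volume (m - h) (m + h))
    (hf : ∀ x ∈ Set.Ioo (m - h) (m + h), |f x - f m| ≤ |x - m|) :
    |(∫ x in (m - h)..(m + h), f x) - 2 * h * f m| ≤ h ^ 2 := by
  have hle : m - h ≤ m + h := by linarith
  have hs : IntervalIntegrable (fun x => f x - f m) volume (m - h) (m + h) :=
    hi.sub intervalIntegrable_const
  have h1 : (∫ x in (m - h)..(m + h), f x) - 2 * h * f m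
      = ∫ x in (m - h)..(m + h), (f x - f m) := by
    rw [intervalIntegral.integral_sub hi intervalIntegrable_const,
      intervalIntegral.integral_const, smul_eq_mul]
    ring
  rw [h1, ← integral_abs_sub_center m hh]
  refine (intervalIntegral.abs_integral_le_integral_abs hle).trans ?_
  exact intervalIntegral.integral_mono_on_of_le_Ioo hle hs.abs
    (Continuous.intervalIntegrable (by fun_prop) _ _) hf

theorem abs_midpointErr_le {n : ℕ} (hn : 0 < n) {f : ℝ → ℝ} (hf : f ∈ F11) :
    |midpointErr n f| ≤ 1 / (4 * n) := by
  have hn' : (0 : ℝ) < n := by exact_mod_cast hn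
  have hleft (k : ℕ) : (2 * (k : ℝ) + 1) / (2 * n) - 1 / (2 * n) = k / n := by field_simp; ring
  have hright (k : ℕ) : (2 * (k : ℝ) + 1) / (2 * n) + 1 / (2 * n) = (k + 1 : ℕ) / n := by
    push_cast; field_simp; ring
  have hk0 (k : ℕ) : (0 : ℝ) ≤ k / n := by positivity
  have hk1 {k : ℕ} (hk : k ≤ n) : (k : ℝ) / n ≤ 1 := by
    rw [div_le_one hn']; exact_mod_cast hk
  have hI : IntervalIntegrable f volume 0 1 :=
    (intervalIntegrable_iff_integrableOn_Ioo_of_le zero_le_one).2 (integrableOn_of_mem_F11 hf)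
  have hint {k : ℕ} (hk : k < n) :
      IntervalIntegrable f volume ((k : ℝ) / n) ((k + 1 : ℕ) / n) := by
    refine hI.mono_set ?_
    rw [Set.uIcc_of_le zero_le_one]
    exact Set.uIcc_subset_Icc ⟨hk0 _, hk1 hk.le⟩ ⟨hk0 _, hk1 hk⟩
  have hsum : ∫ x in Set.Ioo (0 : ℝ) 1, f x
      = ∑ k ∈ Finset.range n, ∫ x in ((k : ℝ) / n)..((k + 1 : ℕ) / n), f x := by
    rw [intervalIntegral.sum_integral_adjacent_intervals (a := fun k : ℕ => (k : ℝ) / n)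
      fun k hk => hint hk, ← integral_Ioc_eq_integral_Ioo,
      ← intervalIntegral.integral_of_le zero_le_one]
    simp [hn'.ne']
  have hcell {k : ℕ} (hk : k < n) :
      |(∫ x in ((k : ℝ) / n)..((k + 1 : ℕ) / n), f x)
        - 1 / n * f ((2 * (k : ℝ) + 1) / (2 * n))| ≤ (1 / (2 * n)) ^ 2 := by
    have h := abs_integral_sub_center_le (f := f) (m := (2 * (k : ℝ) + 1) / (2 * n))
      (h := 1 / (2 * n)) (by positivity)
    rw [hleft, hright] at h
    have h2 : 2 * (1 / (2 * (n : ℝ))) = 1 / n := by field_simp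
    rw [h2] at h
    exact h (hint hk) fun x hx =>
      abs_sub_le_of_mem_F11 hf ⟨(hk0 k).trans_lt hx.1, hx.2.trans_le (hk1 hk)⟩
        (midpoint_mem_Ioo hn hk)
  rw [midpointErr, Fin.sum_univ_eq_sum_range (fun k : ℕ => f ((2 * (k : ℝ) + 1) / (2 * n))) n,
    hsum, Finset.mul_sum, ← Finset.sum_sub_distrib]
  calc _ ≤ ∑ k ∈ Finset.range n, _ := Finset.abs_sum_le_sum_abs _ _
    _ ≤ ∑ k ∈ Finset.range n, (1 / (2 * (n : ℝ))) ^ 2 :=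
      Finset.sum_le_sum fun k hk => hcell (Finset.mem_range.1 hk)
    _ = 1 / (4 * n) := by
      rw [Finset.sum_const, Finset.card_range, nsmul_eq_mul]; field_simp; norm_num

theorem setIntegral_tent_le (c : ℝ) {r : ℝ} (hr : 0 ≤ r) :
    ∫ t in Set.Ioo (0 : ℝ) 1, max (r - |t - c|) 0 ≤ r ^ 2 := by
  have hcont : Continuous fun t : ℝ => max (r - |t - c|) 0 := by fun_prop
  have hzero : ∀ t, t ∉ Set.Icc (c - r) (c + r) → max (r - |t - c|) 0 = 0 := fun t ht => by
    refine max_eq_right (sub_nonpos.2 (le_of_not_gt fun h => ht ?_))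
    constructor <;> linarith [abs_lt.1 h |>.1, abs_lt.1 h |>.2]
  have hint : Integrable fun t : ℝ => max (r - |t - c|) 0 :=
    (integrableOn_iff_integrable_of_support_subset fun t ht => by
      by_contra h
      exact ht (hzero t h)).1 (hcont.continuousOn.integrableOn_compact isCompact_Icc)
  calc _ ≤ ∫ t, max (r - |t - c|) 0 :=
        setIntegral_le_integral hint (.of_forall fun t => le_max_right _ _)
    _ = ∫ t in (c - r)..(c + r), max (r - |t - c|) 0 := by
      rw [intervalIntegral.integral_of_le (by linarith), ← integral_Icc_eq_integral_Ioc,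
        setIntegral_eq_integral_of_forall_compl_eq_zero hzero]
    _ = ∫ t in (c - r)..(c + r), (r - |t - c|) := by
      refine intervalIntegral.integral_congr fun t ht => max_eq_left ?_
      rw [Set.uIcc_of_le (by linarith)] at ht
      exact sub_nonneg.2 (abs_le.2 ⟨by linarith [ht.1], by linarith [ht.2]⟩)
    _ = r ^ 2 := by
      rw [intervalIntegral.integral_sub intervalIntegrable_const
        (Continuous.intervalIntegrable (by fun_prop) _ _), integral_abs_sub_center c hr,
        intervalIntegral.integral_const, smul_eq_mul]
      ring

theorem integrableOn_Ioo_of_continuous {g : ℝ → ℝ} (hg : Continuous g) (a b : ℝ) :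
    IntegrableOn g (Set.Ioo a b) :=
  (hg.continuousOn.integrableOn_compact isCompact_Icc).mono_set Set.Ioo_subset_Icc_self

/-- Among all `n`-point sets, the integral of the distance is at least `1/(4n)`. -/
theorem le_setIntegral_infDist_range {n : ℕ} (hn : 0 < n) (x : Fin n → ℝ) :
    1 / (4 * n) ≤ ∫ t in Set.Ioo (0 : ℝ) 1, Metric.infDist t (Set.range x) := by
  have hn' : (0 : ℝ) < n := by exact_mod_cast hn
  have : Nonempty (Fin n) := ⟨⟨0, hn⟩⟩
  set r : ℝ := 1 / (2 * n) with hr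
  have hr0 : 0 ≤ r := by positivity
  have hpt (t : ℝ) : r - ∑ i, max (r - |t - x i|) 0 ≤ Metric.infDist t (Set.range x) := by
    obtain ⟨_, ⟨j, rfl⟩, hj⟩ :=
      (Set.finite_range x).isCompact.exists_infDist_eq_dist (Set.range_nonempty x) t
    have h := Finset.single_le_sum (f := fun i => max (r - |t - x i|) 0)
      (fun i _ => le_max_right _ _) (Finset.mem_univ j)
    rw [hj, Real.dist_eq]
    linarith [le_max_left (r - |t - x j|) 0]
  have hint (i : Fin n) : IntegrableOn (fun t => max (r - |t - x i|) 0) (Set.Ioo 0 1) :=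
    integrableOn_Ioo_of_continuous (by fun_prop) _ _
  calc 1 / (4 * (n : ℝ)) = r - ∑ i : Fin n, r ^ 2 := by
        rw [Finset.sum_const, Finset.card_univ, Fintype.card_fin, nsmul_eq_mul, hr]
        field_simp; norm_num
    _ ≤ r - ∑ i, ∫ t in Set.Ioo (0 : ℝ) 1, max (r - |t - x i|) 0 := by
      gcongr with i
      exact setIntegral_tent_le (x i) hr0
    _ = ∫ t in Set.Ioo (0 : ℝ) 1, (r - ∑ i, max (r - |t - x i|) 0) := by
      rw [integral_sub (integrable_const r) (integrable_finsetSum _ fun i _ => hint i),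
        integral_finsetSum _ fun i _ => hint i]
      simp
    _ ≤ _ := setIntegral_mono (integrableOn_Ioo_of_continuous (by fun_prop) _ _)
        (integrableOn_Ioo_of_continuous (Metric.continuous_infDist_pt _) _ _) hpt

/-- The one-sided moving average over length `δ` of the truncated distance `(dist(·, s) - δ)₊`. -/
noncomputable def smoothedDist (s : Set ℝ) (δ x : ℝ) : ℝ :=
  δ⁻¹ * ∫ t in x..(x + δ), max (Metric.infDist t s - δ) 0

theorem continuous_truncatedDist (s : Set ℝ) (δ : ℝ) :
    Continuous fun t => max (Metric.infDist t s - δ) 0 :=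
  ((Metric.continuous_infDist_pt s).sub continuous_const).max continuous_const

theorem hasDerivAt_smoothedDist (s : Set ℝ) (δ x : ℝ) :
    HasDerivAt (smoothedDist s δ)
      (δ⁻¹ * (max (Metric.infDist (x + δ) s - δ) 0 - max (Metric.infDist x s - δ) 0)) x := by
  have hc := continuous_truncatedDist s δ
  have hF (y : ℝ) : HasDerivAt (fun u => ∫ t in (0)..u, max (Metric.infDist t s - δ) 0)
      (max (Metric.infDist y s - δ) 0) y := hc.integral_hasStrictDerivAt 0 y |>.hasDerivAt
  have h := (((hF (x + δ)).comp_add_const x δ).sub (hF x)).const_mul δ⁻¹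
  refine h.congr_of_eventuallyEq (.of_forall fun y => ?_)
  simp only [smoothedDist, Pi.sub_apply]
  rw [intervalIntegral.integral_interval_sub_left (hc.intervalIntegrable _ _)
    (hc.intervalIntegrable _ _)]

theorem abs_truncatedDist_sub_le (s : Set ℝ) (δ x y : ℝ) :
    |max (Metric.infDist x s - δ) 0 - max (Metric.infDist y s - δ) 0| ≤ |x - y| := by
  refine (abs_max_sub_max_le_abs _ _ _).trans ?_
  have := (Metric.lipschitz_infDist_pt s).dist_le_mul x y
  simpa [Real.dist_eq] using this

theorem abs_deriv_smoothedDist_le (s : Set ℝ) {δ : ℝ} (hδ : 0 < δ) (x : ℝ) :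
    |deriv (smoothedDist s δ) x| ≤ 1 := by
  have h := abs_truncatedDist_sub_le s δ (x + δ) x
  rw [add_sub_cancel_left, abs_of_pos hδ] at h
  rw [(hasDerivAt_smoothedDist s δ x).deriv, abs_mul, abs_of_pos (inv_pos.2 hδ)]
  calc _ ≤ δ⁻¹ * δ := by gcongr
    _ = 1 := inv_mul_cancel₀ hδ.ne'

theorem smoothedDist_nonneg (s : Set ℝ) {δ : ℝ} (hδ : 0 < δ) (x : ℝ) : 0 ≤ smoothedDist s δ x :=
  mul_nonneg (inv_nonneg.2 hδ.le)
    (intervalIntegral.integral_nonneg (by linarith) fun _ _ => le_max_right _ _)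

theorem smoothedDist_le {s : Set ℝ} {δ : ℝ} (hδ : 0 < δ) {x C : ℝ}
    (h : ∀ t ∈ Set.Icc x (x + δ), max (Metric.infDist t s - δ) 0 ≤ C) :
    smoothedDist s δ x ≤ C := by
  have := intervalIntegral.integral_mono_on (μ := volume) (by linarith)
    ((continuous_truncatedDist s δ).intervalIntegrable x (x + δ)) intervalIntegrable_const h
  rw [intervalIntegral.integral_const, smul_eq_mul, add_sub_cancel_left] at this
  rwa [smoothedDist, inv_mul_le_iff₀ hδ]

theorem le_smoothedDist (s : Set ℝ) {δ : ℝ} (hδ : 0 < δ) (x : ℝ) :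
    Metric.infDist x s - 2 * δ ≤ smoothedDist s δ x := by
  have h (t : ℝ) (ht : t ∈ Set.Icc x (x + δ)) :
      Metric.infDist x s - 2 * δ ≤ max (Metric.infDist t s - δ) 0 := by
    have h1 := Metric.infDist_le_infDist_add_dist (s := s) (x := x) (y := t)
    rw [Real.dist_eq, abs_sub_comm, abs_of_nonneg (sub_nonneg.2 ht.1)] at h1
    linarith [ht.2, le_max_left (Metric.infDist t s - δ) 0]
  have := intervalIntegral.integral_mono_on (μ := volume) (by linarith) intervalIntegrable_const
    ((continuous_truncatedDist s δ).intervalIntegrable x (x + δ)) h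
  rw [intervalIntegral.integral_const, smul_eq_mul, add_sub_cancel_left] at this
  rwa [smoothedDist, le_inv_mul_iff₀ hδ]

theorem smoothedDist_eq_zero {s : Set ℝ} {δ : ℝ} (hδ : 0 < δ) {x : ℝ} (hx : x ∈ s) :
    smoothedDist s δ x = 0 := by
  refine le_antisymm (smoothedDist_le hδ fun t ht => ?_) (smoothedDist_nonneg s hδ x)
  have h := Metric.infDist_le_dist_of_mem (x := t) hx
  rw [Real.dist_eq, abs_of_nonneg (sub_nonneg.2 ht.1)] at h
  exact max_le (by linarith [ht.2]) le_rfl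

theorem smoothedDist_mem_F11 {s : Set ℝ} (hs : (s ∩ Set.Ioo 0 1).Nonempty) {δ : ℝ} (hδ : 0 < δ) :
    smoothedDist s δ ∈ F11 := by
  obtain ⟨y, hys, hy0, hy1⟩ := hs
  refine fun x hx => ⟨?_, (hasDerivAt_smoothedDist s δ x).differentiableAt,
    abs_deriv_smoothedDist_le s hδ x⟩
  rw [abs_of_nonneg (smoothedDist_nonneg s hδ x)]
  refine smoothedDist_le hδ fun t ht => max_le ?_ zero_le_one
  have h := Metric.infDist_le_dist_of_mem (x := t) hys
  have h2 : |t - y| ≤ 1 + δ := abs_le.2 ⟨by linarith [hx.1, ht.1], by linarith [hx.2, ht.2]⟩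
  rw [Real.dist_eq] at h
  linarith

theorem exists_F11_vanishing_lt_integral {n : ℕ} (hn : 0 < n) (x : Fin n → Set.Ioo (0 : ℝ) 1)
    {c : ℝ} (hc : c < 1 / (4 * n)) :
    ∃ f ∈ F11, (∀ i, f (x i) = 0) ∧ c < ∫ t in Set.Ioo (0 : ℝ) 1, f t := by
  set s : Set ℝ := Set.range fun i => (x i : ℝ)
  set δ : ℝ := (1 / (4 * n) - c) / 4 with hδ_def
  have hδ : 0 < δ := by linarith
  let i₀ : Fin n := ⟨0, hn⟩
  have hs : (s ∩ Set.Ioo 0 1).Nonempty := ⟨x i₀, Set.mem_range_self i₀, (x i₀).2⟩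
  have hF : smoothedDist s δ ∈ F11 := smoothedDist_mem_F11 hs hδ
  refine ⟨_, hF, fun i => smoothedDist_eq_zero hδ ⟨i, rfl⟩, ?_⟩
  have hd : IntegrableOn (fun t => Metric.infDist t s) (Set.Ioo 0 1) :=
    integrableOn_Ioo_of_continuous (Metric.continuous_infDist_pt s) _ _
  have hconst : IntegrableOn (fun _ : ℝ => 2 * δ) (Set.Ioo 0 1) := integrableOn_const (by simp)
  have h := setIntegral_mono (hd.sub hconst) (integrableOn_of_mem_F11 hF)
    fun t => le_smoothedDist s hδ t
  have h2 : ∫ t in Set.Ioo (0 : ℝ) 1, (Metric.infDist t s - 2 * δ)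
      = (∫ t in Set.Ioo (0 : ℝ) 1, Metric.infDist t s) - 2 * δ := by
    rw [integral_sub hd hconst]
    simp
  have h3 := le_setIntegral_infDist_range hn fun i => (x i : ℝ)
  simp only [Pi.sub_apply] at h
  rw [h2] at h
  linarith

/-- The nodes of the `n`-point midpoint rule. -/
noncomputable def midpointNode {n : ℕ} (hn : 0 < n) (i : Fin n) : Set.Ioo (0 : ℝ) 1 :=
  ⟨(2 * (i : ℝ) + 1) / (2 * n), midpoint_mem_Ioo hn i.2⟩

theorem midpointErr_eq_integral {n : ℕ} (hn : 0 < n) {f : ℝ → ℝ}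
    (hf : ∀ i, f (midpointNode hn i) = 0) :
    midpointErr n f = ∫ t in Set.Ioo (0 : ℝ) 1, f t := by
  have h : ∑ i : Fin n, f ((2 * (i : ℝ) + 1) / (2 * n)) = 0 := Finset.sum_eq_zero fun i _ => hf i
  rw [midpointErr, h, mul_zero, sub_zero]

/-- The worst-case error of the `n`-point midpoint rule on `F¹₁` equals `1/(4n)`, and the
midpoint rule is optimal: `e(n, F¹₁) = 1/(4n)`. -/
theorem midpoint_rule_optimal_F11 (n : ℕ) (hn : 0 < n) :
    sSup {y : ℝ | ∃ f ∈ F11, y = |midpointErr n f|} = 1 / (4 * n) ∧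
    interr1 (Set.Ioo 0 1) F11 n = 1 / (4 * n) := by
  have hlower (x : Fin n → Set.Ioo (0 : ℝ) 1) :
      1 / (4 * n) ≤ sSup ((fun f => ∫ t in Set.Ioo (0 : ℝ) 1, f t) ''
        {f | f ∈ F11 ∧ ∀ i, f ((x i : ℝ)) = 0}) := by
    refine le_of_forall_lt fun c hc => ?_
    obtain ⟨f, hf, hf0, hcf⟩ := exists_F11_vanishing_lt_integral hn x hc
    refine hcf.trans_le (le_csSup ⟨1, ?_⟩ ⟨f, ⟨hf, hf0⟩, rfl⟩)
    rintro _ ⟨g, ⟨hg, -⟩, rfl⟩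
    exact integral_le_one_of_mem_F11 hg
  constructor
  · refine csSup_eq_of_forall_le_of_forall_lt_exists_gt ?_ ?_ ?_
    · obtain ⟨f, hf, -⟩ := exists_F11_vanishing_lt_integral hn (midpointNode hn) (sub_one_lt _)
      exact ⟨_, f, hf, rfl⟩
    · rintro _ ⟨f, hf, rfl⟩
      exact abs_midpointErr_le hn hf
    · intro c hc
      obtain ⟨f, hf, hf0, hcf⟩ := exists_F11_vanishing_lt_integral hn (midpointNode hn) hc
      refine ⟨_, ⟨f, hf, rfl⟩, hcf.trans_le ?_⟩
      rw [midpointErr_eq_integral hn hf0]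
      exact le_abs_self _
  · have : Nonempty (Fin n → Set.Ioo (0 : ℝ) 1) := ⟨midpointNode hn⟩
    refine le_antisymm (ciInf_le_of_le ⟨1 / (4 * n), ?_⟩ (midpointNode hn) ?_) (le_ciInf hlower)
    · rintro _ ⟨x, rfl⟩
      exact hlower x
    · refine Real.sSup_le ?_ (by positivity)
      rintro _ ⟨f, ⟨hf, hf0⟩, rfl⟩
      have h := (le_abs_self _).trans (abs_midpointErr_le hn hf)
      rwa [midpointErr_eq_integral hn hf0] at h
end

section
/- Let n ∈ ℕ, k ≥ 2, and let A_n(f) = (1/n) Σ_{i=1}^n f((2i−1)/(2n)) be the n-point midpoint rule on [0,1]. Then sup{ | ∫₀¹ f(x) dx − A_n(f) | : f ∈ F^k₁ } = 1/(24 n²), and the supremum is attained by the function f(x) = ½ (x − ½)². -/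
open MeasureTheory

/-- The class `F^k₁`: functions on `(0,1)` that are `C^k` with all derivatives of order
`≤ k` bounded by one. -/
def Fk1 (k : ℕ) : Set (ℝ → ℝ) :=
  { f | ContDiffOn ℝ k f (Set.Ioo (0 : ℝ) 1) ∧
      ∀ j ≤ k, ∀ x ∈ Set.Ioo (0 : ℝ) 1, |iteratedDeriv j f x| ≤ 1 }

/-- The midpoint error on `(0,1)` is the sum of the midpoint errors on the `n` cells. -/
lemma midpointErr_eq_sum {n : ℕ} (hn : 0 < n) {f : ℝ → ℝ}
    (hf : IntegrableOn f (Set.Ioo (0 : ℝ) 1)) :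
    midpointErr n f = ∑ i ∈ Finset.range n,
      ((∫ x in (i / n : ℝ)..((i + 1 : ℕ) / n : ℝ), f x) -
        1 / n * f ((2 * (i : ℝ) + 1) / (2 * n))) := by
  have hn' : (0 : ℝ) < n := by exact_mod_cast hn
  have hcell : ∀ i < n, IntervalIntegrable f volume (i / n : ℝ) ((i + 1 : ℕ) / n : ℝ) := by
    intro i hi
    have hin : ((i + 1 : ℕ) : ℝ) ≤ n := by exact_mod_cast hi
    rw [intervalIntegrable_iff_integrableOn_Ioo_of_le (by gcongr; simp)]
    exact hf.mono_set (Set.Ioo_subset_Ioo (by positivity) ((div_le_one hn').2 hin))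
  rw [midpointErr, Finset.sum_sub_distrib, ← Finset.mul_sum,
    intervalIntegral.sum_integral_adjacent_intervals (a := fun i : ℕ => (i / n : ℝ)) hcell,
    Fin.sum_univ_eq_sum_range (fun i => f ((2 * (i : ℝ) + 1) / (2 * n)))]
  simp [div_self hn'.ne', intervalIntegral.integral_of_le zero_le_one,
    integral_Ioc_eq_integral_Ioo]

/-- A function within `(x - c)² / 2` of an affine function through `(c, f c)`, where `c` is the
midpoint of `[a, b]`, has midpoint error at most `(b - a)³ / 24`. -/
lemma abs_integral_sub_midpoint_le {f : ℝ → ℝ} {a b m : ℝ} (hab : a ≤ b)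
    (hf : IntervalIntegrable f volume a b)
    (h : ∀ᵐ x, x ∈ Set.Ioc a b →
      |f x - (f ((a + b) / 2) + m * (x - (a + b) / 2))| ≤ 1 / 2 * (x - (a + b) / 2) ^ 2) :
    |(∫ x in a..b, f x) - (b - a) * f ((a + b) / 2)| ≤ (b - a) ^ 3 / 24 := by
  have haff : ∫ x in a..b, (f ((a + b) / 2) + m * (x - (a + b) / 2)) =
      (b - a) * f ((a + b) / 2) := by
    rw [intervalIntegral.integral_add (by simp)
        (Continuous.intervalIntegrable (by fun_prop) _ _),
      intervalIntegral.integral_const_mul,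
      intervalIntegral.integral_sub intervalIntegral.intervalIntegrable_id (by simp)]
    simp only [intervalIntegral.integral_const, integral_id, smul_eq_mul]
    ring
  have hsq : ∫ x in a..b, 1 / 2 * (x - (a + b) / 2) ^ 2 = (b - a) ^ 3 / 24 := by
    rw [intervalIntegral.integral_const_mul,
      intervalIntegral.integral_comp_sub_right (fun x => x ^ 2), integral_pow]
    push_cast
    ring
  rw [← haff, ← intervalIntegral.integral_sub hf (Continuous.intervalIntegrable (by fun_prop) _ _),
    ← hsq, ← Real.norm_eq_abs]
  exact intervalIntegral.norm_integral_le_of_norm_le hab h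
    (Continuous.intervalIntegrable (by fun_prop) _ _)

/-- Second-order Taylor bound for functions in `F^k₁`, `k ≥ 2`. -/
lemma abs_sub_taylor_le_of_mem_Fk1 {k : ℕ} (hk : 2 ≤ k) {f : ℝ → ℝ} (hf : f ∈ Fk1 k)
    {c x : ℝ} (hc : c ∈ Set.Ioo (0 : ℝ) 1) (hx : x ∈ Set.Ioo (0 : ℝ) 1) :
    |f x - (f c + deriv f c * (x - c))| ≤ 1 / 2 * (x - c) ^ 2 := by
  rcases eq_or_ne c x with rfl | hne
  · simp
  have hsub : Set.uIcc c x ⊆ Set.Ioo (0 : ℝ) 1 := Set.ordConnected_Ioo.uIcc_subset hc hx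
  have hC2 : ContDiffOn ℝ 2 f (Set.Ioo (0 : ℝ) 1) := hf.1.of_le (by exact_mod_cast hk)
  have hd : DifferentiableAt ℝ f c :=
    (hC2.differentiableOn (by simp)).differentiableAt (isOpen_Ioo.mem_nhds hc)
  obtain ⟨y, hy, hfy⟩ := taylor_mean_remainder_lagrange_iteratedDeriv (n := 1) hne
    ((hC2.mono hsub).of_le (by norm_num))
  rw [taylorWithinEval_succ, taylor_within_zero_eval, iteratedDerivWithin_one,
    hd.derivWithin (uniqueDiffOn_uIcc hne c Set.left_mem_uIcc)] at hfy
  have hy1 := hf.2 2 hk y (hsub (Set.Ioo_subset_Icc_self hy))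
  have hfy' : f x - (f c + deriv f c * (x - c)) =
      iteratedDeriv 2 f y * (1 / 2 * (x - c) ^ 2) := by
    norm_num at hfy
    linarith
  rw [hfy', abs_mul, abs_of_nonneg (by positivity : 0 ≤ 1 / 2 * (x - c) ^ 2)]
  exact mul_le_of_le_one_left (by positivity) hy1

lemma integrableOn_of_mem_Fk1 {k : ℕ} {f : ℝ → ℝ} (hf : f ∈ Fk1 k) :
    IntegrableOn f (Set.Ioo (0 : ℝ) 1) := by
  refine IntegrableOn.of_bound (by simp)
    (hf.1.continuousOn.aestronglyMeasurable measurableSet_Ioo) 1 ?_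
  filter_upwards [ae_restrict_mem measurableSet_Ioo] with x hx
  simpa using hf.2 0 (Nat.zero_le k) x hx

lemma abs_midpointErr_le_of_mem_Fk1 {n k : ℕ} (hn : 0 < n) (hk : 2 ≤ k) {f : ℝ → ℝ}
    (hf : f ∈ Fk1 k) : |midpointErr n f| ≤ 1 / (24 * n ^ 2) := by
  have hn' : (0 : ℝ) < n := by exact_mod_cast hn
  have hint := integrableOn_of_mem_Fk1 hf
  rw [midpointErr_eq_sum hn hint]
  have hcell : ∀ i ∈ Finset.range n,
      |(∫ x in (i / n : ℝ)..((i + 1 : ℕ) / n : ℝ), f x) -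
        1 / n * f ((2 * (i : ℝ) + 1) / (2 * n))| ≤ (1 / n : ℝ) ^ 3 / 24 := by
    intro i hi
    have hin : (i : ℝ) + 1 ≤ n := by exact_mod_cast Finset.mem_range.1 hi
    have h0 : (0 : ℝ) ≤ i / n := by positivity
    have h1 : ((i + 1 : ℕ) / n : ℝ) ≤ 1 := (div_le_one hn').2 (by exact_mod_cast hin)
    have hlt : (i / n : ℝ) < (i + 1 : ℕ) / n := by gcongr; simp
    have hlen : ((i + 1 : ℕ) / n : ℝ) - i / n = 1 / n := by push_cast; ring
    have hmid : ((i / n : ℝ) + (i + 1 : ℕ) / n) / 2 = (2 * (i : ℝ) + 1) / (2 * n) := by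
      push_cast; field_simp; ring
    rw [← hlen, ← hmid]
    refine abs_integral_sub_midpoint_le (m := deriv f (((i / n : ℝ) + (i + 1 : ℕ) / n) / 2))
      hlt.le ?_ ?_
    · rw [intervalIntegrable_iff_integrableOn_Ioo_of_le hlt.le]
      exact hint.mono_set (Set.Ioo_subset_Ioo h0 h1)
    · filter_upwards [(Set.countable_singleton (1 : ℝ)).ae_notMem volume] with x hx1 hx
      exact abs_sub_taylor_le_of_mem_Fk1 hk hf ⟨by linarith, by linarith⟩
        ⟨h0.trans_lt hx.1, lt_of_le_of_ne (hx.2.trans h1) hx1⟩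
  refine (Finset.abs_sum_le_sum_abs _ _).trans ((Finset.sum_le_sum hcell).trans_eq ?_)
  rw [Finset.sum_const, Finset.card_range, nsmul_eq_mul]
  field_simp

lemma half_sq_mem_Fk1 (k : ℕ) : (fun x : ℝ => 1 / 2 * (x - 1 / 2) ^ 2) ∈ Fk1 k := by
  refine ⟨ContDiff.contDiffOn (by fun_prop), fun j _ x hx => ?_⟩
  have hd1 : deriv (fun x : ℝ => 1 / 2 * (x - 1 / 2) ^ 2) = fun x => x - 1 / 2 := by
    funext x
    have h := (((hasDerivAt_id x).sub_const (1 / 2)).pow 2).const_mul (1 / 2 : ℝ)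
    refine (h.congr_deriv ?_).deriv
    simp
  have hd2 : deriv (fun x : ℝ => x - 1 / 2) = fun _ => 1 := by
    funext x
    simp
  obtain ⟨hx0, hx1⟩ := hx
  match j with
  | 0 =>
    rw [iteratedDeriv_zero, abs_le]
    constructor <;> nlinarith
  | 1 =>
    rw [iteratedDeriv_one, hd1, abs_le]
    constructor <;> linarith
  | j + 2 =>
    rw [iteratedDeriv_succ', iteratedDeriv_succ', hd1, hd2, iteratedDeriv_const]
    split_ifs <;> simp

lemma midpointErr_half_sq {n : ℕ} (hn : 0 < n) :
    midpointErr n (fun x : ℝ => 1 / 2 * (x - 1 / 2) ^ 2) = 1 / (24 * n ^ 2) := by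
  have hn' : (0 : ℝ) < n := by exact_mod_cast hn
  rw [midpointErr_eq_sum hn (integrableOn_of_mem_Fk1 (half_sq_mem_Fk1 0))]
  have hcell : ∀ i ∈ Finset.range n,
      (∫ x in (i / n : ℝ)..((i + 1 : ℕ) / n : ℝ), 1 / 2 * (x - 1 / 2) ^ 2) -
        1 / n * (1 / 2 * ((2 * (i : ℝ) + 1) / (2 * n) - 1 / 2) ^ 2) = (1 / n : ℝ) ^ 3 / 24 := by
    intro i _
    rw [intervalIntegral.integral_const_mul,
      intervalIntegral.integral_comp_sub_right (fun x => x ^ 2), integral_pow]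
    push_cast
    field_simp
    ring
  rw [Finset.sum_congr rfl hcell, Finset.sum_const, Finset.card_range, nsmul_eq_mul]
  field_simp

/-- For every `k ≥ 2` the worst-case error of the `n`-point midpoint rule on `F^k₁` equals
`1/(24n²)`, and the supremum is attained by `f(x) = ½(x - ½)²`. -/
theorem midpoint_rule_Fk1 (n k : ℕ) (hn : 0 < n) (hk : 2 ≤ k) :
    sSup {y : ℝ | ∃ f ∈ Fk1 k, y = |midpointErr n f|} = 1 / (24 * n ^ 2) ∧
    (fun x : ℝ => 1 / 2 * (x - 1 / 2) ^ 2) ∈ Fk1 k ∧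
    |midpointErr n (fun x : ℝ => 1 / 2 * (x - 1 / 2) ^ 2)| = 1 / (24 * n ^ 2) := by
  have habs : |midpointErr n (fun x : ℝ => 1 / 2 * (x - 1 / 2) ^ 2)| = 1 / (24 * n ^ 2) := by
    rw [midpointErr_half_sq hn, abs_of_nonneg (by positivity)]
  refine ⟨IsGreatest.csSup_eq ⟨⟨_, half_sq_mem_Fk1 k, habs.symm⟩, ?_⟩, half_sq_mem_Fk1 k, habs⟩
  rintro _ ⟨f, hf, rfl⟩
  exact abs_midpointErr_le_of_mem_Fk1 hn hk hf
end
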